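/- Let μ be a Borel probability measure on SL₂(ℝ) with a finite exponential moment whose support generates a Zariski dense subgroup Γ_μ, and let ν be the unique μ-stationary Borel probability measure on the real projective line X = ℙ(ℝ²). Then the Fourier coefficients of ν tend to zero: for k ∈ ℤ, ν̂(k) := ∫_X ((v₁ + i v₂)²/(v₁² + v₂²))^k dν(ℝv) (equivalently, under the identification of X with ℝ/πℤ via θ ↦ ℝ(cos θ, sin θ), ν̂(k) = ∫ e^{2ikθ} dν(θ)) satisfies ν̂(k) → 0 as |k| → ∞; i.e. ν is a Rajchman measure. -/

import Mathlib

open MeasureTheory Filter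

noncomputable section

abbrev SL2 := Matrix.SpecialLinearGroup (Fin 2) ℝ

abbrev PX := Projectivization ℝ (Fin 2 → ℝ)

instance : TopologicalSpace SL2 := instTopologicalSpaceSubtype
instance : TopologicalSpace PX := instTopologicalSpaceQuotient
instance : MeasurableSpace SL2 := borel _
instance : MeasurableSpace PX := borel _

/-- Euclidean norm on ℝ². -/
def enorm2 (v : Fin 2 → ℝ) : ℝ := Real.sqrt (v 0 ^ 2 + v 1 ^ 2)

/-- Operator norm of g ∈ SL₂(ℝ) w.r.t. the Euclidean norm on ℝ². -/
def opNorm (g : SL2) : ℝ :=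
  ‖Matrix.toEuclideanCLM (𝕜 := ℝ) (n := Fin 2) (g : Matrix (Fin 2) (Fin 2) ℝ)‖

/-- Cartan projection κ(g) = log ‖g‖. -/
def kappa (g : SL2) : ℝ := Real.log (opNorm g)

/-- The projective action of SL₂(ℝ) on ℙ(ℝ²). -/
def act (g : SL2) (x : PX) : PX :=
  Projectivization.map ((Matrix.SpecialLinearGroup.toLin' g).toLinearMap)
    (LinearEquiv.injective _) x

/-- The norm cocycle σ(g, ℝv) = log (‖gv‖/‖v‖). -/
def cocycle (g : SL2) (x : PX) : ℝ :=
  Real.log (enorm2 ((g : Matrix (Fin 2) (Fin 2) ℝ).mulVec x.rep) / enorm2 x.rep)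

/-- The sine distance d(ℝv, ℝw) = |det(v,w)|/(‖v‖‖w‖) on ℙ(ℝ²). -/
def projDist (x y : PX) : ℝ :=
  |x.rep 0 * y.rep 1 - x.rep 1 * y.rep 0| / (enorm2 x.rep * enorm2 y.rep)

/-- An angle θ(x) ∈ ℝ representing x = ℝ(cos θ, sin θ). -/
def pangle (x : PX) : ℝ := Complex.arg (x.rep 0 + x.rep 1 * Complex.I)

/-- The (topological) support of a measure. -/
def measSupp (μ : Measure SL2) : Set SL2 :=
  {g | ∀ U : Set SL2, IsOpen U → g ∈ U → 0 < μ U}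

/-- μ has a finite exponential moment. -/
def HasExpMoment (μ : Measure SL2) : Prop :=
  ∃ ε₁ > (0 : ℝ), ∫⁻ g, ENNReal.ofReal (opNorm g ^ ε₁) ∂μ < ⊤

/-- The group generated by the support of μ is Zariski dense in SL₂(ℝ),
equivalently it is not solvable. -/
def ZariskiDense (μ : Measure SL2) : Prop :=
  ¬ IsSolvable (Subgroup.closure (measSupp μ))

/-- ν is μ-stationary: μ ∗ ν = ν. -/
def IsMuStationary (μ : Measure SL2) (ν : Measure PX) : Prop :=
  μ.bind (fun g => ν.map (act g)) = ν

/-- The product g₁ ⋯ gₙ of a word (g₁, …, gₙ). -/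
def word {n : ℕ} (g : Fin n → SL2) : SL2 := (List.ofFn g).prod

/-- The product measure μ^{⊗n} on words of length n. -/
def μpi (μ : Measure SL2) (n : ℕ) : Measure (Fin n → SL2) := Measure.pi fun _ => μ

open MeasureTheory Filter
noncomputable section

/-! ### Basic facts about SL2 -/

instance : BorelSpace SL2 := ⟨rfl⟩
instance : BorelSpace PX := ⟨rfl⟩
instance : T2Space SL2 := inferInstanceAs (T2Space {A : Matrix (Fin 2) (Fin 2) ℝ // A.det = 1})
instance : SecondCountableTopology (Matrix (Fin 2) (Fin 2) ℝ) :=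
  inferInstanceAs (SecondCountableTopology (Fin 2 → Fin 2 → ℝ))
instance : SecondCountableTopology SL2 :=
  TopologicalSpace.Subtype.secondCountableTopology
    {A : Matrix (Fin 2) (Fin 2) ℝ | A.det = 1}

lemma cont_coe : Continuous (fun g : SL2 => (g : Matrix (Fin 2) (Fin 2) ℝ)) :=
  continuous_subtype_val

lemma cont_entry (i j : Fin 2) : Continuous (fun g : SL2 => g i j) :=
  (continuous_apply_apply i j).comp cont_coe

lemma cont_to_SL2 {α : Type*} [TopologicalSpace α] {f : α → SL2}
    (h : ∀ i j, Continuous fun a => f a i j) : Continuous f := by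
  refine Continuous.subtype_mk (f := fun a => (f a : Matrix (Fin 2) (Fin 2) ℝ)) ?_ _
  exact continuous_matrix h

lemma tendsto_SL2 {α : Type*} {l : Filter α} {f : α → SL2} {g : SL2}
    (h : ∀ i j, Tendsto (fun a => f a i j) l (nhds (g i j))) : Tendsto f l (nhds g) := by
  have : Topology.IsInducing (fun g : SL2 => (g : Matrix (Fin 2) (Fin 2) ℝ)) :=
    Topology.IsInducing.subtypeVal
  exact this.tendsto_nhds_iff.2 (tendsto_pi_nhds.2 fun i => tendsto_pi_nhds.2 fun j => h i j)

instance : ContinuousMul SL2 := ⟨by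
  apply cont_to_SL2
  intro i j
  simp only [Matrix.SpecialLinearGroup.coe_mul, Matrix.mul_apply, Fin.sum_univ_two]
  have := fun i j => (cont_entry i j).comp (continuous_fst (X := SL2) (Y := SL2))
  have := fun i j => (cont_entry i j).comp (continuous_snd (X := SL2) (Y := SL2))
  simp only [Function.comp_def] at *
  fun_prop⟩

lemma inv00 (g : SL2) : g⁻¹ 0 0 = g 1 1 := by
  simp [Matrix.SpecialLinearGroup.coe_inv, Matrix.adjugate_fin_two]
lemma inv01 (g : SL2) : g⁻¹ 0 1 = - g 0 1 := by
  simp [Matrix.SpecialLinearGroup.coe_inv, Matrix.adjugate_fin_two]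
lemma inv10 (g : SL2) : g⁻¹ 1 0 = - g 1 0 := by
  simp [Matrix.SpecialLinearGroup.coe_inv, Matrix.adjugate_fin_two]
lemma inv11 (g : SL2) : g⁻¹ 1 1 = g 0 0 := by
  simp [Matrix.SpecialLinearGroup.coe_inv, Matrix.adjugate_fin_two]

lemma det_eq (g : SL2) : g 0 0 * g 1 1 - g 0 1 * g 1 0 = 1 := by
  have := g.det_coe
  rwa [Matrix.det_fin_two] at this

lemma mul_ent (g h : SL2) (i j : Fin 2) : (g * h) i j = g i 0 * h 0 j + g i 1 * h 1 j := by
  simp [Matrix.SpecialLinearGroup.coe_mul, Matrix.mul_apply, Fin.sum_univ_two]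

instance : ContinuousInv SL2 := ⟨by
  apply cont_to_SL2
  intro i j
  fin_cases i <;> fin_cases j
  · simpa only [Fin.zero_eta, Fin.mk_one, inv00] using cont_entry 1 1
  · simpa only [Fin.zero_eta, Fin.mk_one, inv01] using continuous_neg.comp' (cont_entry 0 1)
  · simpa only [Fin.zero_eta, Fin.mk_one, inv10] using continuous_neg.comp' (cont_entry 1 0)
  · simpa only [Fin.zero_eta, Fin.mk_one, inv11] using cont_entry 0 0⟩

instance : IsTopologicalGroup SL2 := {}

example : MeasurableMul₂ SL2 := inferInstance
example : MeasurableInv SL2 := inferInstance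

lemma sl_ext {g h : SL2} (h0 : g 0 0 = h 0 0) (h1 : g 0 1 = h 0 1) (h2 : g 1 0 = h 1 0)
    (h3 : g 1 1 = h 1 1) : g = h := by
  ext i j; fin_cases i <;> fin_cases j <;> assumption

/-! ### complex vectors -/

/-- linear action on ℂ² -/
def sm (g : SL2) (v : ℂ × ℂ) : ℂ × ℂ :=
  ((g 0 0 : ℂ) * v.1 + (g 0 1 : ℂ) * v.2, (g 1 0 : ℂ) * v.1 + (g 1 1 : ℂ) * v.2)

def N2 (v : ℂ × ℂ) : ℝ := ‖v.1‖ ^ 2 + ‖v.2‖ ^ 2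
def N (v : ℂ × ℂ) : ℝ := Real.sqrt (N2 v)

/-- Frobenius norm -/
def nF (g : SL2) : ℝ := Real.sqrt (g 0 0 ^ 2 + g 0 1 ^ 2 + g 1 0 ^ 2 + g 1 1 ^ 2)

def wd (v w : ℂ × ℂ) : ℂ := v.1 * w.2 - v.2 * w.1

lemma sm_mul (g h : SL2) (v : ℂ × ℂ) : sm (g * h) v = sm g (sm h v) := by
  simp only [sm, mul_ent]
  push_cast
  ext <;> simp <;> ring

lemma sm_one (v : ℂ × ℂ) : sm 1 v = v := by
  ext <;> simp [sm]

lemma sm_smul (g : SL2) (c : ℂ) (v : ℂ × ℂ) : sm g (c • v) = c • sm g v := by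
  ext <;> simp [sm] <;> ring

lemma sm_add (g : SL2) (v w : ℂ × ℂ) : sm g (v + w) = sm g v + sm g w := by
  ext <;> simp [sm] <;> ring

lemma wd_sm (g : SL2) (v w : ℂ × ℂ) : wd (sm g v) (sm g w) = wd v w := by
  have h : (g 0 0 : ℂ) * g 1 1 - g 0 1 * g 1 0 = 1 := by exact_mod_cast det_eq g
  simp only [wd, sm]
  linear_combination (v.1 * w.2 - v.2 * w.1) * h

lemma sm_inv_sm (g : SL2) (v : ℂ × ℂ) : sm g⁻¹ (sm g v) = v := by
  rw [← sm_mul, inv_mul_cancel, sm_one]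

lemma sm_sm_inv (g : SL2) (v : ℂ × ℂ) : sm g (sm g⁻¹ v) = v := by
  rw [← sm_mul, mul_inv_cancel, sm_one]

lemma sm_zero (g : SL2) : sm g 0 = 0 := by ext <;> simp [sm]

lemma sm_ne {g : SL2} {v : ℂ × ℂ} (h : v ≠ 0) : sm g v ≠ 0 := by
  intro h0
  apply h
  rw [← sm_inv_sm g v, h0, sm_zero]

lemma N2_nonneg (v : ℂ × ℂ) : 0 ≤ N2 v := by unfold N2; positivity
lemma N_nonneg (v : ℂ × ℂ) : 0 ≤ N v := Real.sqrt_nonneg _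
lemma N_sq (v : ℂ × ℂ) : N v ^ 2 = N2 v := Real.sq_sqrt (N2_nonneg v)
lemma N2_pos {v : ℂ × ℂ} (h : v ≠ 0) : 0 < N2 v := by
  unfold N2
  by_contra h'
  apply h
  have h1 := sq_nonneg ‖v.1‖
  have h2 := sq_nonneg ‖v.2‖
  have h3 : ‖v.1‖ ^ 2 = 0 := by linarith
  have h4 : ‖v.2‖ ^ 2 = 0 := by linarith
  ext1
  · simpa using h3
  · simpa using h4
lemma N_pos {v : ℂ × ℂ} (h : v ≠ 0) : 0 < N v := Real.sqrt_pos.2 (N2_pos h)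
lemma N_zero : N 0 = 0 := by simp [N, N2]
lemma ne_of_N {v : ℂ × ℂ} (h : 0 < N v) : v ≠ 0 := by
  rintro rfl; simp [N_zero] at h

lemma N_smul (c : ℂ) (v : ℂ × ℂ) : N (c • v) = ‖c‖ * N v := by
  unfold N
  rw [show N2 (c • v) = ‖c‖ ^ 2 * N2 v by simp [N2, mul_pow]; ring]
  rw [Real.sqrt_mul (by positivity), Real.sqrt_sq (by positivity)]

lemma N_add_le (v w : ℂ × ℂ) : N (v + w) ≤ N v + N w := by
  have h (v : ℂ × ℂ) : N v = ‖WithLp.toLp 2 v‖ := by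
    rw [WithLp.prod_norm_eq_of_L2]; rfl
  rw [h, h, h, WithLp.toLp_add]
  exact norm_add_le _ _

lemma nF_nonneg (g : SL2) : 0 ≤ nF g := Real.sqrt_nonneg _
lemma nF_sq (g : SL2) : nF g ^ 2 = g 0 0 ^ 2 + g 0 1 ^ 2 + g 1 0 ^ 2 + g 1 1 ^ 2 :=
  Real.sq_sqrt (by positivity)

lemma one_le_nF (g : SL2) : 1 ≤ nF g := by
  have h1 := nF_sq g
  have h2 := det_eq g
  have h3 := nF_nonneg g
  nlinarith [sq_nonneg (g 0 0 - g 1 1), sq_nonneg (g 0 1 + g 1 0)]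

lemma nF_pos (g : SL2) : 0 < nF g := lt_of_lt_of_le one_pos (one_le_nF g)

lemma nF_inv (g : SL2) : nF g⁻¹ = nF g := by
  unfold nF; rw [inv00, inv01, inv10, inv11]; congr 1; ring

lemma N2_sm_le (g : SL2) (v : ℂ × ℂ) : N2 (sm g v) ≤ nF g ^ 2 * N2 v := by
  have key (a b : ℝ) (z w : ℂ) : ‖(a : ℂ) * z + b * w‖ ^ 2 ≤ (a ^ 2 + b ^ 2) * (‖z‖ ^ 2 + ‖w‖ ^ 2) := by
    have h1 : ‖(a : ℂ) * z + b * w‖ ≤ |a| * ‖z‖ + |b| * ‖w‖ := by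
      refine (norm_add_le _ _).trans ?_
      simp
    calc _ ≤ (|a| * ‖z‖ + |b| * ‖w‖) ^ 2 := by gcongr
      _ ≤ (|a| ^ 2 + |b| ^ 2) * (‖z‖ ^ 2 + ‖w‖ ^ 2) := by
        nlinarith [sq_nonneg (|a| * ‖w‖ - |b| * ‖z‖)]
      _ = _ := by rw [sq_abs, sq_abs]
  rw [nF_sq]
  unfold N2 sm
  have h1 := key (g 0 0) (g 0 1) v.1 v.2
  have h2 := key (g 1 0) (g 1 1) v.1 v.2
  dsimp only
  linarith

lemma N_sm_le (g : SL2) (v : ℂ × ℂ) : N (sm g v) ≤ nF g * N v := by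
  unfold N
  rw [show nF g * Real.sqrt (N2 v) = Real.sqrt (nF g ^ 2 * N2 v) by
    rw [Real.sqrt_mul (by positivity), Real.sqrt_sq (nF_nonneg g)]]
  exact Real.sqrt_le_sqrt (N2_sm_le g v)

lemma N_le_sm (g : SL2) (v : ℂ × ℂ) : N v ≤ nF g * N (sm g v) := by
  have := N_sm_le g⁻¹ (sm g v)
  rwa [sm_inv_sm, nF_inv] at this

lemma nF_mul_le (g h : SL2) : nF (g * h) ≤ nF g * nF h := by
  unfold nF
  rw [← Real.sqrt_mul (by positivity)]
  apply Real.sqrt_le_sqrt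
  simp only [mul_ent]
  nlinarith [sq_nonneg (g 0 0 * h 1 0 - g 0 1 * h 0 0), sq_nonneg (g 0 0 * h 1 1 - g 0 1 * h 0 1),
    sq_nonneg (g 1 0 * h 1 0 - g 1 1 * h 0 0), sq_nonneg (g 1 0 * h 1 1 - g 1 1 * h 0 1)]

lemma cont_nF : Continuous nF := by
  unfold nF
  have := cont_entry
  fun_prop

lemma cont_N : Continuous N := by
  unfold N N2; fun_prop

lemma cont_sm : Continuous (fun p : SL2 × (ℂ × ℂ) => sm p.1 p.2) := by
  unfold sm
  have := fun i j => (cont_entry i j).comp (continuous_fst (X := SL2) (Y := ℂ × ℂ))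
  simp only [Function.comp_def] at this
  have h (i j) : Continuous (fun p : SL2 × (ℂ × ℂ) => ((p.1 i j : ℝ) : ℂ)) :=
    Complex.continuous_ofReal.comp (this i j)
  fun_prop

lemma cont_sm_left (v : ℂ × ℂ) : Continuous (fun g => sm g v) :=
  cont_sm.comp (continuous_id.prodMk continuous_const)
lemma cont_sm_right (g : SL2) : Continuous (sm g) :=
  cont_sm.comp (continuous_const.prodMk continuous_id)

lemma meas_nF : Measurable nF := cont_nF.measurable
lemma meas_N : Measurable N := cont_N.measurable

lemma wd_norm_le (v w : ℂ × ℂ) : ‖wd v w‖ ≤ N v * N w := by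
  have h1 : ‖wd v w‖ ≤ ‖v.1‖ * ‖w.2‖ + ‖v.2‖ * ‖w.1‖ := by
    unfold wd
    refine (norm_sub_le _ _).trans ?_
    simp
  refine h1.trans ?_
  unfold N
  rw [← Real.sqrt_mul (N2_nonneg v)]
  apply Real.le_sqrt_of_sq_le
  unfold N2
  nlinarith [sq_nonneg (‖v.1‖ * ‖w.1‖ - ‖v.2‖ * ‖w.2‖)]

lemma cont_wd : Continuous (fun p : (ℂ × ℂ) × (ℂ × ℂ) => wd p.1 p.2) := by
  unfold wd; fun_prop

/-- bounded sets of SL2 are relatively compact -/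
lemma isCompact_nF_le (R : ℝ) : IsCompact {g : SL2 | nF g ≤ R} := by
  have hind : Topology.IsClosedEmbedding (fun g : SL2 => (g : Matrix (Fin 2) (Fin 2) ℝ)) := by
    refine Topology.IsClosedEmbedding.subtypeVal ?_
    exact isClosed_eq (continuous_id.matrix_det) continuous_const
  have hK : IsCompact (Set.pi Set.univ (fun _ : Fin 2 => Set.pi Set.univ
      (fun _ : Fin 2 => Set.Icc (-R) R))) :=
    isCompact_univ_pi fun _ => isCompact_univ_pi fun _ => isCompact_Icc
  have h2 := hind.isCompact_preimage hK
  refine h2.of_isClosed_subset (isClosed_le cont_nF continuous_const) ?_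
  intro g hg
  have hg : nF g ≤ R := hg
  have hs := nF_sq g
  have h0 := nF_nonneg g
  intro i _ j _
  have : (g i j) ^ 2 ≤ nF g ^ 2 := by
    rw [hs]; fin_cases i <;> fin_cases j <;> simp <;> nlinarith [sq_nonneg (g 0 0), sq_nonneg (g 0 1), sq_nonneg (g 1 0), sq_nonneg (g 1 1)]
  obtain ⟨h1, h2⟩ := abs_le.1 (abs_le_of_sq_le_sq this h0)
  exact ⟨by linarith, by linarith⟩

end

open MeasureTheory Filter
noncomputable section

/-! ### Group theory -/

def tr (g : SL2) : ℝ := g 0 0 + g 1 1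

lemma cont_tr : Continuous tr := (cont_entry 0 0).add (cont_entry 1 1)

lemma abs_entry_le (g : SL2) (i j : Fin 2) : |g i j| ≤ nF g := by
  have : (g i j) ^ 2 ≤ nF g ^ 2 := by
    rw [nF_sq]; fin_cases i <;> fin_cases j <;> simp <;> nlinarith [sq_nonneg (g 0 0), sq_nonneg (g 0 1), sq_nonneg (g 1 0), sq_nonneg (g 1 1)]
  exact abs_le_of_sq_le_sq this (nF_nonneg g)

lemma abs_tr_le (g : SL2) : |tr g| ≤ 2 * nF g := by
  unfold tr
  have h1 := abs_entry_le g 0 0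
  have h2 := abs_entry_le g 1 1
  linarith [abs_add_le (g 0 0) (g 1 1)]

lemma tr_sq (g : SL2) : tr (g * g) = tr g ^ 2 - 2 := by
  have := det_eq g
  simp only [tr, mul_ent]; linear_combination -2 * this

lemma tr_le_of_bdd {g : SL2} {R : ℝ} (h : ∀ n : ℕ, nF (g ^ n) ≤ R) : |tr g| ≤ 2 := by
  by_contra hc
  push Not at hc
  have key : ∀ n : ℕ, 4 ^ n * (|tr g| - 2) ≤ |tr (g ^ (2 ^ n))| - 2 := by
    intro n
    induction n with
    | zero => simp
    | succ n ih =>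
      rw [pow_succ 2 n, mul_two, pow_add g, tr_sq, pow_succ]
      set s := |tr (g ^ 2 ^ n)| with hs
      have h2 : 0 ≤ s - 2 := le_trans (by have : 0 < |tr g| - 2 := by linarith
                                          positivity) ih
      rw [← sq_abs (tr (g ^ 2 ^ n)), ← hs, abs_of_nonneg (show (0:ℝ) ≤ s ^ 2 - 2 by nlinarith)]
      nlinarith
  have h4 : Tendsto (fun n : ℕ => (4 : ℝ) ^ n * (|tr g| - 2)) atTop atTop :=
    (tendsto_pow_atTop_atTop_of_one_lt (by norm_num)).atTop_mul_const (by linarith)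
  obtain ⟨n, hn⟩ := (h4.eventually (eventually_gt_atTop (2 * R))).exists
  have := key n
  have := abs_tr_le (g ^ (2 ^ n))
  have := h (2 ^ n)
  linarith

lemma pow_parab {g : SL2} (h : tr g = 2) (n : ℕ) :
    (g ^ n) 0 1 = n * g 0 1 ∧ (g ^ n) 1 0 = n * g 1 0 ∧ (g ^ n) 0 0 = 1 + n * (g 0 0 - 1) ∧
    (g ^ n) 1 1 = 1 + n * (g 1 1 - 1) := by
  have hd := det_eq g
  unfold tr at h
  have h11 : g 1 1 = 2 - g 0 0 := by linarith
  rw [h11] at hd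
  induction n with
  | zero => simp
  | succ n ih =>
    obtain ⟨h1, h2, h3, h4⟩ := ih
    rw [pow_succ]
    simp only [mul_ent, h1, h2, h3, h4, h11]
    push_cast
    refine ⟨?_, ?_, ?_, ?_⟩
    · ring
    · ring
    · linear_combination -(n:ℝ) * hd
    · linear_combination -(n:ℝ) * hd

lemma eq_zero_of_lin_bdd {a b R : ℝ} (h : ∀ n : ℕ, |b + n * a| ≤ R) : a = 0 := by
  by_contra ha
  have h1 : Tendsto (fun n : ℕ => (n : ℝ) * |a|) atTop atTop :=
    tendsto_natCast_atTop_atTop.atTop_mul_const (abs_pos.2 ha)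
  obtain ⟨n, hn⟩ := (h1.eventually (eventually_gt_atTop (R + |b|))).exists
  have h2 := h n
  have h3 : |n * a| ≤ |b + n * a| + |b| := by
    have := abs_sub (b + n * a) b
    simpa using this
  rw [abs_mul, Nat.abs_cast] at h3
  linarith

lemma one_of_parab {g : SL2} {R : ℝ} (h : ∀ n : ℕ, nF (g ^ n) ≤ R) (ht : tr g = 2) : g = 1 := by
  have e (i j) (n : ℕ) : |(g ^ n) i j| ≤ R := (abs_entry_le _ i j).trans (h n)
  have h0 := fun n => (pow_parab ht n).1
  have h1 := fun n => (pow_parab ht n).2.1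
  have h2 := fun n => (pow_parab ht n).2.2.1
  have h3 := fun n => (pow_parab ht n).2.2.2
  have a0 : g 0 1 = 0 := eq_zero_of_lin_bdd (b := 0) (R := R) fun n => by
    rw [zero_add, ← h0]; exact e _ _ n
  have a1 : g 1 0 = 0 := eq_zero_of_lin_bdd (b := 0) (R := R) fun n => by
    rw [zero_add, ← h1]; exact e _ _ n
  have a2 : g 0 0 - 1 = 0 := eq_zero_of_lin_bdd (b := 1) (R := R) fun n => by
    rw [← h2]; exact e _ _ n
  have a3 : g 1 1 - 1 = 0 := eq_zero_of_lin_bdd (b := 1) (R := R) fun n => by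
    rw [← h3]; exact e _ _ n
  apply sl_ext <;> simp [a0, a1] <;> linarith

lemma ell_cases {g : SL2} {R : ℝ} (h : ∀ n : ℕ, nF (g ^ n) ≤ R) :
    tr g ^ 2 < 4 ∨ ∀ b : SL2, g * b = b * g := by
  have h1 := tr_le_of_bdd h
  have h2 : tr g ^ 2 ≤ 4 := by
    rw [← sq_abs]; nlinarith [abs_nonneg (tr g)]
  rcases h2.lt_or_eq with h3 | h3
  · exact Or.inl h3
  · right
    have h4 : g * g = 1 := by
      refine one_of_parab (R := R) (fun n => ?_) (by rw [tr_sq]; linarith)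
      have := h (2 * n)
      rwa [pow_mul, pow_two] at this
    have e00 := congrArg (fun x : SL2 => x 0 0) h4
    have e01 := congrArg (fun x : SL2 => x 0 1) h4
    have e10 := congrArg (fun x : SL2 => x 1 0) h4
    have e11 := congrArg (fun x : SL2 => x 1 1) h4
    simp only [mul_ent, Matrix.SpecialLinearGroup.coe_one, Matrix.one_apply] at e00 e01 e10 e11
    simp at e00 e01 e10 e11
    have ht : g 0 0 + g 1 1 ≠ 0 := by
      intro h0; unfold tr at h3; rw [h0] at h3; norm_num at h3
    have a01 : g 0 1 = 0 := by
      have : g 0 1 * (g 0 0 + g 1 1) = 0 := by linarith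
      simpa [ht] using this
    have a10 : g 1 0 = 0 := by
      have : g 1 0 * (g 0 0 + g 1 1) = 0 := by linarith
      simpa [ht] using this
    have a11 : g 1 1 = g 0 0 := by
      have : (g 1 1 - g 0 0) * (g 0 0 + g 1 1) = 0 := by linear_combination e11 - e00
      have := (mul_eq_zero.1 this).resolve_right ht
      linarith
    intro b
    apply sl_ext <;> simp only [mul_ent, a01, a10, a11] <;> ring

lemma comm_of_tr {a b : SL2} (ha : tr a ^ 2 < 4)
    (hc : tr (a * b * a⁻¹ * b⁻¹) ≤ 2) : a * b = b * a := by
  have da := det_eq a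
  have db := det_eq b
  unfold tr at *
  simp only [mul_ent, inv00, inv01, inv10, inv11] at hc
  suffices H : a 0 1 * b 1 0 - b 0 1 * a 1 0 = 0 ∧
      a 0 0 * b 0 1 + a 0 1 * b 1 1 - b 0 0 * a 0 1 - b 0 1 * a 1 1 = 0 ∧
      a 1 0 * b 0 0 + a 1 1 * b 1 0 - b 1 0 * a 0 0 - b 1 1 * a 1 0 = 0 by
    obtain ⟨h1, h2, h3⟩ := H
    apply sl_ext <;> simp only [mul_ent] <;> linarith
  generalize a 0 0 = a0 at *
  generalize a 0 1 = a1 at *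
  generalize a 1 0 = a2 at *
  generalize a 1 1 = a3 at *
  generalize b 0 0 = b0 at *
  generalize b 0 1 = b1 at *
  generalize b 1 0 = b2 at *
  generalize b 1 1 = b3 at *
  -- commutator C = ab - ba
  have hC : (a1 * b2 - b1 * a2) ^ 2 + (a0 * b1 + a1 * b3 - b0 * a1 - b1 * a3) *
      (a2 * b0 + a3 * b2 - b2 * a0 - b3 * a2) ≤ 0 := by
    refine le_trans (le_of_eq ?_) (sub_nonpos.2 hc)
    linear_combination (-2 * (b0 * b3 - b1 * b2)) * da - 2 * db
  have hO : (a0 - a3) * (a1 * b2 - b1 * a2) + a1 * (a2 * b0 + a3 * b2 - b2 * a0 - b3 * a2) +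
      a2 * (a0 * b1 + a1 * b3 - b0 * a1 - b1 * a3) = 0 := by ring
  generalize (a1 * b2 - b1 * a2) = p at *
  generalize (a0 * b1 + a1 * b3 - b0 * a1 - b1 * a3) = q at *
  generalize (a2 * b0 + a3 * b2 - b2 * a0 - b3 * a2) = r at *
  have hP : (a0 - a3) ^ 2 + 4 * (a1 * a2) < 0 := by nlinarith
  have hqr : q * r = 0 := by
    by_contra hne
    have hneg : q * r < 0 := lt_of_le_of_ne (by nlinarith [sq_nonneg p]) hne
    have e1 : (a1 * r + a2 * q) ^ 2 = (a0 - a3) ^ 2 * p ^ 2 := by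
      have : a1 * r + a2 * q = -((a0 - a3) * p) := by linarith
      rw [this]; ring
    have e2 : (a0 - a3) ^ 2 * p ^ 2 ≤ (a0 - a3) ^ 2 * (-(q * r)) :=
      mul_le_mul_of_nonneg_left (by linarith) (sq_nonneg _)
    have e3 : (a0 - a3) ^ 2 * (-(q * r)) < (-(4 * (a1 * a2))) * (-(q * r)) :=
      mul_lt_mul_of_pos_right (by linarith) (by linarith)
    nlinarith [sq_nonneg (a1 * r - a2 * q)]
  have hp : p = 0 := by
    rw [hqr] at hC
    exact pow_eq_zero_iff (two_ne_zero) |>.1 (le_antisymm (by linarith) (sq_nonneg p))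
  have h12 : a1 * a2 ≠ 0 := by nlinarith [sq_nonneg (a0 - a3)]
  have h1 : a1 ≠ 0 := left_ne_zero_of_mul h12
  have h2 : a2 ≠ 0 := right_ne_zero_of_mul h12
  subst hp
  rcases mul_eq_zero.1 hqr with h | h <;> subst h <;> simp [h1, h2] at hO <;> simp [hO]

/-- a subgroup all of whose elements have bounded powers is commutative -/
lemma comm_of_bdd_powers (H : Subgroup SL2) (h : ∀ g ∈ H, ∃ R, ∀ n : ℕ, nF (g ^ n) ≤ R) :
    Group.IsSolvable H := by
  apply Group.isSolvable_of_comm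
  rintro ⟨a, ha⟩ ⟨b, hb⟩
  apply Subtype.ext
  show a * b = b * a
  obtain ⟨R, hR⟩ := h a ha
  rcases ell_cases hR with h1 | h1
  · have hm : a * b * a⁻¹ * b⁻¹ ∈ H :=
      H.mul_mem (H.mul_mem (H.mul_mem ha hb) (H.inv_mem ha)) (H.inv_mem hb)
    obtain ⟨R', hR'⟩ := h _ hm
    exact comm_of_tr h1 (le_trans (le_abs_self _) (tr_le_of_bdd hR'))
  · exact h1 b

/-- (1.3) -/
lemma semigroup_unbdd {S : Set SL2} (hS : ¬ Group.IsSolvable (Subgroup.closure S)) (R : ℝ) :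
    ∃ g ∈ Submonoid.closure S, R < nF g := by
  by_contra hc
  push Not at hc
  apply hS
  set T := Submonoid.closure S with hT
  have hcl : ∀ g ∈ T.topologicalClosure, nF g ≤ R := by
    intro g hg
    have : closure (T : Set SL2) ⊆ {g | nF g ≤ R} :=
      closure_minimal hc (isClosed_le cont_nF continuous_const)
    exact this hg
  have hinv : ∀ g ∈ T, g⁻¹ ∈ T.topologicalClosure := by
    intro g hg
    obtain ⟨b, -, φ, hφ, hb⟩ := (isCompact_nF_le R).tendsto_subseq (x := fun n : ℕ => g ^ n)
      (fun n => hc _ (T.pow_mem hg n))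
    have h1 : Tendsto (fun n => (g ^ φ (n + 1)) * (g ^ φ n)⁻¹ * g⁻¹) atTop (nhds (b * b⁻¹ * g⁻¹)) :=
      ((hb.comp (tendsto_add_atTop_nat 1)).mul hb.inv).mul_const _
    rw [mul_inv_cancel, one_mul] at h1
    refine mem_closure_of_tendsto h1 (Eventually.of_forall fun n => ?_)
    have h2 : φ n + 1 ≤ φ (n + 1) := hφ (Nat.lt_succ_self n)
    obtain ⟨k, hk⟩ := Nat.exists_eq_add_of_le h2
    have : (g ^ φ (n + 1)) * (g ^ φ n)⁻¹ * g⁻¹ = g ^ k := by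
      rw [hk, show φ n + 1 + k = k + 1 + φ n by ring, pow_add, pow_succ]; group
    rw [this]
    exact T.pow_mem hg k
  have hle : ∀ g ∈ Subgroup.closure S, g ∈ T.topologicalClosure := by
    intro g hg
    induction hg using Subgroup.closure_induction'' with
    | mem x hx => exact T.le_topologicalClosure (Submonoid.subset_closure hx)
    | inv_mem x hx => exact hinv x (Submonoid.subset_closure hx)
    | one => exact one_mem _
    | mul x y _ _ hx hy => exact mul_mem hx hy
  refine comm_of_bdd_powers _ fun g hg => ⟨R, fun n => hcl _ (hle _ (pow_mem hg n))⟩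

end

open MeasureTheory Filter
noncomputable section

lemma mulVec_ent (g : SL2) (v : Fin 2 → ℝ) (i : Fin 2) :
    (g • v) i = g i 0 * v 0 + g i 1 * v 1 := by
  rw [Matrix.SpecialLinearGroup.smul_def]
  simp [Matrix.mulVec, dotProduct, Fin.sum_univ_two]

/-- wedge of real vectors -/
def rw2 (v w : Fin 2 → ℝ) : ℝ := v 0 * w 1 - v 1 * w 0

lemma mk_eq_iff {v w : Fin 2 → ℝ} (hv : v ≠ 0) (hw : w ≠ 0) :
    Projectivization.mk ℝ v hv = Projectivization.mk ℝ w hw ↔ rw2 v w = 0 := by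
  rw [Projectivization.mk_eq_mk_iff']
  unfold rw2
  constructor
  · rintro ⟨a, rfl⟩
    simp; ring
  · intro h
    have : w 0 ≠ 0 ∨ w 1 ≠ 0 := by
      by_contra hc
      push Not at hc
      apply hw; ext i; fin_cases i; exacts [hc.1, hc.2]
    rcases this with h0 | h0
    · refine ⟨v 0 / w 0, ?_⟩
      ext i; fin_cases i <;> simp <;> field_simp
      linarith
    · refine ⟨v 1 / w 1, ?_⟩
      ext i; fin_cases i <;> simp <;> field_simp
      linarith

lemma smul_mk_eq_iff (g : SL2) {v w : Fin 2 → ℝ} (hv : v ≠ 0) (hw : w ≠ 0) :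
    g • Projectivization.mk ℝ v hv = Projectivization.mk ℝ w hw ↔ rw2 (g • v) w = 0 := by
  rw [Projectivization.smul_mk]
  exact mk_eq_iff _ _

lemma exists_basis {v : Fin 2 → ℝ} (hv : v ≠ 0) : ∃ B : SL2, B 0 0 = v 0 ∧ B 1 0 = v 1 := by
  have h : v 0 ^ 2 + v 1 ^ 2 ≠ 0 := by
    intro h
    apply hv
    ext i; fin_cases i
    · simp; nlinarith [sq_nonneg (v 0), sq_nonneg (v 1)]
    · simp; nlinarith [sq_nonneg (v 0), sq_nonneg (v 1)]
  refine ⟨⟨!![v 0, -v 1 / (v 0 ^ 2 + v 1 ^ 2); v 1, v 0 / (v 0 ^ 2 + v 1 ^ 2)], ?_⟩, ?_, ?_⟩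
  · rw [Matrix.det_fin_two_of]; field_simp; ring
  · simp
  · simp

/-- subgroups fixing a line are solvable -/
lemma solvable_of_fix {H : Type*} [Group H] (f : H →* SL2) (hf : Function.Injective f) (x : PX)
    (hx : ∀ h, f h • x = x) : Group.IsSolvable H := by
  induction x using Projectivization.ind with
  | h v hv =>
  obtain ⟨B, h0, h1⟩ := exists_basis hv
  have key : ∀ h, (B⁻¹ * f h * B) 1 0 = 0 := by
    intro h
    have := (smul_mk_eq_iff _ hv hv).1 (hx h)
    unfold rw2 at this
    simp only [mulVec_ent] at this
    simp only [mul_ent, inv10, inv11, h0, h1]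
    linarith
  let c : H →* ℝ :=
    { toFun := fun h => (B⁻¹ * f h * B) 0 0
      map_one' := by simp
      map_mul' := by
        intro a b
        have : B⁻¹ * f (a * b) * B = (B⁻¹ * f a * B) * (B⁻¹ * f b * B) := by rw [map_mul]; group
        rw [this, mul_ent, key b]; ring }
  let χ : H →* ℝˣ := c.toHomUnits
  have hk : ∀ a : χ.ker, (B⁻¹ * f a * B) 0 0 = 1 ∧ (B⁻¹ * f a * B) 1 1 = 1 := by
    intro a
    have h2 : χ a = 1 := a.2
    have h3 : c a = 1 := by
      have := congrArg Units.val h2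
      simpa [χ] using this
    have h4 : (B⁻¹ * f a * B) 0 0 = 1 := h3
    refine ⟨h4, ?_⟩
    have := det_eq (B⁻¹ * f a * B)
    rw [h4, key] at this
    linarith
  have : Group.IsSolvable χ.ker := by
    apply Group.isSolvable_of_comm
    intro a b
    apply Subtype.ext
    apply hf
    show f (a * b) = f (b * a)
    rw [map_mul, map_mul]
    have : (B⁻¹ * f a * B) * (B⁻¹ * f b * B) = (B⁻¹ * f b * B) * (B⁻¹ * f a * B) := by
      obtain ⟨a1, a2⟩ := hk a
      obtain ⟨b1, b2⟩ := hk b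
      have a3 := key a
      have b3 := key b
      generalize B⁻¹ * f a * B = a' at *
      generalize B⁻¹ * f b * B = b' at *
      apply sl_ext <;> simp only [mul_ent, a1, a2, a3, b1, b2, b3] <;> ring
    have h5 : B⁻¹ * (f a * f b) * B = B⁻¹ * (f b * f a) * B := by
      simpa [mul_assoc] using this
    exact mul_left_cancel (mul_right_cancel h5)
  exact Group.isSolvable_of_ker_le_range χ.ker.subtype χ (by simp)

lemma fix_three {g : SL2} {x y z : PX} (hxy : x ≠ y) (hyz : y ≠ z) (hxz : x ≠ z)
    (hx : g • x = x) (hy : g • y = y) (hz : g • z = z) : g * g = 1 := by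
  induction x using Projectivization.ind with
  | h v hv =>
  induction y using Projectivization.ind with
  | h w hw =>
  induction z using Projectivization.ind with
  | h u hu =>
  rw [smul_mk_eq_iff] at hx hy hz
  rw [Ne, mk_eq_iff] at *
  unfold rw2 at *
  simp only [mulVec_ent] at *
  -- quadratic form vanishing at three points
  have key : g 1 0 = 0 ∧ g 0 1 = 0 ∧ g 0 0 = g 1 1 := by
    have e : ∀ {a b c d: ℝ}, a * b - c * d ≠ 0 → a * b - c * d ≠ 0 := fun h => h
    have q (t : Fin 2 → ℝ) (h : (g 0 0 * t 0 + g 0 1 * t 1) * t 1 - (g 1 0 * t 0 + g 1 1 * t 1) * t 0 = 0) :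
      g 0 1 * t 1 ^ 2 + (g 0 0 - g 1 1) * (t 0 * t 1) - g 1 0 * t 0 ^ 2 = 0 := by linarith
    have q1 := q v hx
    have q2 := q w hy
    have q3 := q u hz
    generalize g 0 1 = A at *
    generalize hD : g 0 0 - g 1 1 = D at *
    generalize g 1 0 = C at *
    generalize v 0 = v0 at *
    generalize v 1 = v1 at *
    generalize w 0 = w0 at *
    generalize w 1 = w1 at *
    generalize u 0 = u0 at *
    generalize u 1 = u1 at *
    have hdet : (v0 * w1 - v1 * w0) * ((w0 * u1 - w1 * u0) * (v0 * u1 - v1 * u0)) ≠ 0 :=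
      mul_ne_zero hxy (mul_ne_zero hyz hxz)
    have hC : C * ((v0 * w1 - v1 * w0) * ((w0 * u1 - w1 * u0) * (v0 * u1 - v1 * u0))) = 0 := by
      linear_combination (-(w1*u1) * (w0 * u1 - w1 * u0)) * q1 + (v1*u1*(v0*u1-v1*u0)) * q2 - (v1*w1*(v0*w1-v1*w0)) * q3
    have hA : A * ((v0 * w1 - v1 * w0) * ((w0 * u1 - w1 * u0) * (v0 * u1 - v1 * u0))) = 0 := by
      linear_combination ((w0*u0) * (w0 * u1 - w1 * u0)) * q1 - (v0*u0*(v0*u1-v1*u0)) * q2 + (v0*w0*(v0*w1-v1*w0)) * q3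
    have hDD : D * ((v0 * w1 - v1 * w0) * ((w0 * u1 - w1 * u0) * (v0 * u1 - v1 * u0))) = 0 := by
      linear_combination (-(w0*u1+w1*u0) * (w0 * u1 - w1 * u0)) * q1 + ((v0*u1+v1*u0)*(v0*u1-v1*u0)) * q2 - ((v0*w1+v1*w0)*(v0*w1-v1*w0)) * q3
    refine ⟨(mul_eq_zero.1 hC).resolve_right hdet, (mul_eq_zero.1 hA).resolve_right hdet, ?_⟩
    have := (mul_eq_zero.1 hDD).resolve_right hdet
    linarith
  obtain ⟨k1, k2, k3⟩ := key
  have hd := det_eq g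
  rw [k1, k3] at hd
  apply sl_ext <;> simp [mul_ent, k1, k2, k3] <;> linarith

lemma bdd_of_pow_eq_one {g : SL2} {n : ℕ} (hn : 0 < n) (h : g ^ n = 1) :
    ∃ R, ∀ k : ℕ, nF (g ^ k) ≤ R := by
  refine ⟨∑ i ∈ Finset.range n, nF (g ^ i), fun k => ?_⟩
  rw [pow_eq_pow_mod k h]
  exact Finset.single_le_sum (f := fun i => nF (g ^ i)) (fun i _ => nF_nonneg _)
    (Finset.mem_range.2 (Nat.mod_lt _ hn))

lemma surjOn_of_fin {α : Type*} {A : Set α} (hf : A.Finite) {f : α → α} (h : Set.MapsTo f A A)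
    (hi : Function.Injective f) : Set.SurjOn f A A := by
  have := hf.to_subtype
  have h2 : Function.Injective (h.restrict f A A) := fun a b hab =>
    Subtype.ext (hi (congrArg Subtype.val hab))
  intro x hx
  obtain ⟨y, hy⟩ := Finite.surjective_of_injective h2 ⟨x, hx⟩
  exact ⟨y, y.2, congrArg Subtype.val hy⟩

lemma perm_comm {α : Type*} (h3' : ∀ x y z : α, x ≠ y → y ≠ z → x = z) (f g : Equiv.Perm α) (x : α) :
    f (g x) = g (f x) := by
  have i1 : ∀ a b, f a = f b → a = b := fun a b h => f.injective h
  have i2 : ∀ a b, g a = g b → a = b := fun a b h => g.injective h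
  have a1 := h3' x (f x) (g x)
  have a2 := h3' x (f x) (f (g x))
  have a3 := h3' x (g x) (g (f x))
  have a4 := h3' x (g x) (f (g x))
  have a5 := h3' x (f x) (g (f x))
  have b1 := i1 x (g x)
  have b2 := i2 x (f x)
  clear i1 i2
  by_cases c1 : f x = x
  · by_cases c2 : g x = x
    · rw [c1, c2, c1]
    · grind
  · by_cases c2 : g x = x
    · grind
    · grind

/-- (1.2) -/
lemma no_fin_inv {S : Set SL2} (hS : ¬ Group.IsSolvable (Subgroup.closure S)) (A : Set PX)
    (hf : A.Finite) (hne : A.Nonempty) (hinv : ∀ s ∈ S, ∀ x ∈ A, s • x ∈ A) : False := by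
  apply hS
  set Γ := Subgroup.closure S with hΓ
  have hinv' : ∀ s ∈ S, ∀ x ∈ A, s⁻¹ • x ∈ A := by
    intro s hs x hx
    have hsur : Set.SurjOn (fun x => s • x) A A :=
      surjOn_of_fin hf (fun x hx => hinv s hs x hx) (MulAction.injective s)
    obtain ⟨y, hy, rfl⟩ := hsur hx
    simpa using hy
  have hall : ∀ g ∈ Γ, ∀ x ∈ A, g • x ∈ A := by
    intro g hg
    induction hg using Subgroup.closure_induction'' with
    | mem x hx => exact hinv x hx
    | inv_mem x hx => exact hinv' x hx
    | one => simp
    | mul x y _ _ hx hy => intro z hz; rw [mul_smul]; exact hx _ (hy _ hz)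
  let A' : SubMulAction Γ PX :=
    { carrier := A
      smul_mem' := fun g x hx => hall g g.2 x hx }
  have : Finite A' := hf.to_subtype
  let F : Γ →* Equiv.Perm A' := MulAction.toPermHom Γ A'
  have hker : ∀ g : Γ, F g = 1 → ∀ x ∈ A, (g : SL2) • x = x := by
    intro g hg x hx
    have := congrArg (fun e : Equiv.Perm A' => ((e ⟨x, hx⟩ : A') : PX)) hg
    exact this
  by_cases h3 : ∃ x ∈ A, ∃ y ∈ A, ∃ z ∈ A, x ≠ y ∧ y ≠ z ∧ x ≠ z
  · obtain ⟨x, hx, y, hy, z, hz, h1, h2, h3⟩ := h3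
    apply comm_of_bdd_powers
    intro g hg
    have hn : F ⟨g, hg⟩ ^ (Nat.card (Equiv.Perm A')) = 1 := pow_card_eq_one'
    rw [← map_pow] at hn
    have hk := hker _ hn
    have := fix_three h1 h2 h3 (hk x hx) (hk y hy) (hk z hz)
    refine bdd_of_pow_eq_one (n := Nat.card (Equiv.Perm A') + Nat.card (Equiv.Perm A')) ?_ ?_
    · have : 0 < Nat.card (Equiv.Perm A') := Nat.card_pos
      omega
    · rw [pow_add]; simpa using this
  · push Not at h3
    have h3' : ∀ x y z : A', x ≠ y → y ≠ z → x = z := fun x y z a b =>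
      Subtype.ext (h3 x x.2 y y.2 z z.2 (fun h => a (Subtype.ext h)) (fun h => b (Subtype.ext h)))
    have s1 : Group.IsSolvable (Equiv.Perm A') := by
      apply Group.isSolvable_of_comm
      intro f g
      ext1 x
      show f (g x) = g (f x)
      exact perm_comm h3' f g x
    have s2 : Group.IsSolvable F.ker := by
      obtain ⟨x, hx⟩ := hne
      refine solvable_of_fix (Γ.subtype.comp F.ker.subtype) ?_ x ?_
      · exact Γ.subtype_injective.comp F.ker.subtype_injective
      · intro h; exact hker h h.2 x hx
    exact Group.isSolvable_of_ker_le_range F.ker.subtype F (by simp)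

end

open MeasureTheory Filter
noncomputable section

lemma irr {S : Set SL2} (hS : ¬ Group.IsSolvable (Subgroup.closure S)) {v : Fin 2 → ℝ} (hv : v ≠ 0) :
    ∃ s ∈ S, rw2 (s • v) v ≠ 0 := by
  by_contra hc
  push Not at hc
  refine no_fin_inv hS {Projectivization.mk ℝ v hv} (Set.finite_singleton _) ⟨_, rfl⟩ ?_
  intro s hs x hx
  rw [Set.mem_singleton_iff] at hx ⊢
  subst hx
  rw [smul_mk_eq_iff]
  exact hc s hs

def IsHyp (g : SL2) (l : ℝ) (B : SL2) : Prop :=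
  1 < |l| ∧ (B⁻¹ * g * B) 0 0 = l ∧ (B⁻¹ * g * B) 0 1 = 0 ∧ (B⁻¹ * g * B) 1 0 = 0 ∧
    (B⁻¹ * g * B) 1 1 = l⁻¹

lemma eig {g : SL2} {l m : ℝ} (h1 : l + m = tr g) (h2 : l * m = 1) (hlm : l ≠ m) :
    ∃ p : Fin 2 → ℝ, p ≠ 0 ∧ g 0 0 * p 0 + g 0 1 * p 1 = l * p 0 ∧
      g 1 0 * p 0 + g 1 1 * p 1 = l * p 1 := by
  have hd := det_eq g
  unfold tr at h1
  have hm : m = g 0 0 + g 1 1 - l := by linarith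
  by_cases h : g 0 1 ≠ 0 ∨ l ≠ g 0 0
  · refine ⟨![g 0 1, l - g 0 0], ?_, ?_, ?_⟩
    · intro h0
      have a := congrFun h0 0
      have b := congrFun h0 1
      simp at a b
      rcases h with h | h
      · exact h a
      · exact h (by linarith)
    · simp; ring
    · simp; rw [hm] at h2; linear_combination h2 - hd
  · push Not at h
    obtain ⟨h01, hl⟩ := h
    refine ⟨![l - g 1 1, g 1 0], ?_, ?_, ?_⟩
    · intro h0
      have a := congrFun h0 0
      simp at a
      apply hlm; linarith
    · simp; rw [h01, hl]; ring
    · simp; ring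

lemma hyp_of_tr {g : SL2} (h : 4 < tr g ^ 2) : ∃ l B, IsHyp g l B ∧ l + l⁻¹ = tr g := by
  obtain ⟨l, m, h1, h2, h3⟩ : ∃ l m : ℝ, l + m = tr g ∧ l * m = 1 ∧ 1 < |l| := by
    set t := tr g
    have hs : Real.sqrt (t ^ 2 - 4) ^ 2 = t ^ 2 - 4 := Real.sq_sqrt (by linarith)
    have hp : 0 < Real.sqrt (t ^ 2 - 4) := Real.sqrt_pos.2 (by linarith)
    set r := Real.sqrt (t ^ 2 - 4)
    rcases le_or_gt 0 t with ht | ht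
    · refine ⟨(t + r) / 2, (t - r) / 2, by ring, by nlinarith, ?_⟩
      rw [abs_of_pos (by linarith)]
      nlinarith
    · refine ⟨(t - r) / 2, (t + r) / 2, by ring, by nlinarith, ?_⟩
      rw [abs_of_neg (by linarith)]
      nlinarith
  have hl0 : l ≠ 0 := left_ne_zero_of_mul (by rw [h2]; exact one_ne_zero)
  have hm : m = l⁻¹ := eq_inv_of_mul_eq_one_right h2
  have hlm : l ≠ m := by
    rintro rfl
    have : |l| * |l| = 1 := by rw [← abs_mul, h2, abs_one]
    nlinarith
  obtain ⟨p, hp, p1, p2⟩ := eig h1 h2 hlm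
  obtain ⟨q, hq, q1, q2⟩ := eig (by rw [add_comm]; exact h1) (by rw [mul_comm]; exact h2) hlm.symm
  have hw : rw2 p q ≠ 0 := by
    intro h0
    rw [← mk_eq_iff hp hq, Projectivization.mk_eq_mk_iff'] at h0
    obtain ⟨a, rfl⟩ := h0
    simp only [Pi.smul_apply, smul_eq_mul] at p1 p2
    apply hp
    have e0 : (l - m) * (a * q 0) = 0 := by linear_combination a * q1 - p1
    have e1 : (l - m) * (a * q 1) = 0 := by linear_combination a * q2 - p2
    have hne : l - m ≠ 0 := sub_ne_zero.2 hlm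
    ext i; fin_cases i
    · simpa [hne] using e0
    · simpa [hne] using e1
  obtain ⟨B, b00, b01, b10, b11⟩ : ∃ B : SL2, B 0 0 = p 0 ∧ B 0 1 = q 0 / rw2 p q ∧ B 1 0 = p 1 ∧
      B 1 1 = q 1 / rw2 p q := by
    refine ⟨⟨!![p 0, q 0 / rw2 p q; p 1, q 1 / rw2 p q], ?_⟩, rfl, rfl, rfl, rfl⟩
    rw [Matrix.det_fin_two_of]; field_simp; unfold rw2; ring
  refine ⟨l, B, ⟨h3, ?_⟩, by rw [← hm, h1]⟩
  · simp only [mul_ent, inv00, inv01, inv10, inv11, b00, b01, b10, b11]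
    rw [← hm]
    have hw' : rw2 p q = p 0 * q 1 - p 1 * q 0 := rfl
    set w := rw2 p q
    refine ⟨?_, ?_, ?_, ?_⟩
    · field_simp
      linear_combination q 1 * p1 - q 0 * p2 - l * hw'
    · field_simp
      linear_combination q 1 * q1 - q 0 * q2
    · field_simp
      linear_combination p 0 * p2 - p 1 * p1
    · field_simp
      linear_combination p 0 * q2 - p 1 * q1 - m * hw'

lemma exists_hyp {S : Set SL2} (hS : ¬ Group.IsSolvable (Subgroup.closure S)) :
    ∃ g ∈ Submonoid.closure S, 4 < tr g ^ 2 := by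
  by_contra hc
  push Not at hc
  set T := Submonoid.closure S
  have htr : ∀ g ∈ T, |tr g| ≤ 2 := fun g hg => abs_le_of_sq_le_sq (by linarith [hc g hg]) (by norm_num)
  choose g hgT hg using fun n : ℕ => semigroup_unbdd hS (n : ℝ)
  -- normalized entries
  have hK : IsCompact (Set.pi Set.univ (fun _ : Fin 2 => Set.pi Set.univ
      (fun _ : Fin 2 => Set.Icc (-1:ℝ) 1))) :=
    isCompact_univ_pi fun _ => isCompact_univ_pi fun _ => isCompact_Icc
  obtain ⟨M, -, φ, hφ, hM⟩ := hK.tendsto_subseq (x := fun n : ℕ => fun i j => g n i j / nF (g n)) (by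
    intro n i _ j _
    show -1 ≤ _ ∧ _ ≤ 1
    rw [← abs_le, abs_div, abs_of_pos (nF_pos (g n)), div_le_one (nF_pos _)]
    exact abs_entry_le _ i j)
  have hM' (i j) : Tendsto (fun n => g (φ n) i j / nF (g (φ n))) atTop (nhds (M i j)) :=
    tendsto_pi_nhds.1 (tendsto_pi_nhds.1 hM i) j
  have hnF : Tendsto (fun n => nF (g (φ n))) atTop atTop :=
    tendsto_atTop_mono (fun n => (hg _).le) (tendsto_natCast_atTop_atTop.comp hφ.tendsto_atTop)
  have hinv : Tendsto (fun n => (nF (g (φ n)))⁻¹) atTop (nhds 0) := hnF.inv_tendsto_atTop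
  have e1 : M 0 0 ^ 2 + M 0 1 ^ 2 + M 1 0 ^ 2 + M 1 1 ^ 2 = 1 := by
    have l1 := ((((hM' 0 0).pow 2).add ((hM' 0 1).pow 2)).add ((hM' 1 0).pow 2)).add ((hM' 1 1).pow 2)
    refine tendsto_nhds_unique l1 (tendsto_const_nhds.congr fun n => ?_)
    have := nF_sq (g (φ n))
    have := (nF_pos (g (φ n))).ne'
    field_simp
    linarith
  have e2 : M 0 0 * M 1 1 - M 0 1 * M 1 0 = 0 := by
    have l1 := ((hM' 0 0).mul (hM' 1 1)).sub ((hM' 0 1).mul (hM' 1 0))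
    have l2 := hinv.mul hinv
    rw [mul_zero] at l2
    refine tendsto_nhds_unique l1 (l2.congr fun n => ?_)
    have := det_eq (g (φ n))
    have := (nF_pos (g (φ n))).ne'
    field_simp
    linarith
  have e3 : ∀ s ∈ T, M 0 0 * s 0 0 + M 0 1 * s 1 0 + (M 1 0 * s 0 1 + M 1 1 * s 1 1) = 0 := by
    intro s hs
    have l1 := (((hM' 0 0).mul_const (s 0 0)).add ((hM' 0 1).mul_const (s 1 0))).add
      (((hM' 1 0).mul_const (s 0 1)).add ((hM' 1 1).mul_const (s 1 1)))
    have l2 : Tendsto (fun n => tr (g (φ n) * s) * (nF (g (φ n)))⁻¹) atTop (nhds 0) := by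
      refine squeeze_zero_norm (a := fun n => 2 * (nF (g (φ n)))⁻¹) (fun n => ?_) (by simpa using hinv.const_mul 2)
      rw [norm_mul, norm_inv, Real.norm_eq_abs, Real.norm_eq_abs, abs_of_pos (nF_pos (g (φ n)))]
      have := htr _ (T.mul_mem (hgT (φ n)) hs)
      have := inv_pos.2 (nF_pos (g (φ n)))
      gcongr
    refine tendsto_nhds_unique l1 (l2.congr fun n => ?_)
    simp only [tr, mul_ent]
    have := (nF_pos (g (φ n))).ne'
    field_simp
  have e4 : M 1 1 = - M 0 0 := by
    have := e3 1 T.one_mem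
    simp at this
    linarith
  rw [e4] at e1 e2 e3
  obtain ⟨u, hu, hu2⟩ : ∃ u : Fin 2 → ℝ, u ≠ 0 ∧ ∀ s ∈ T, rw2 (s • u) u = 0 := by
    by_cases h : M 0 0 = 0 ∧ M 1 0 = 0
    · refine ⟨![M 0 1, 0], ?_, ?_⟩
      · intro h0
        have := congrFun h0 0
        simp at this
        rw [this, h.1, h.2] at e1
        norm_num at e1
      · intro s hs
        have := e3 s hs
        simp only [h.1, h.2] at this
        simp [rw2, mulVec_ent]
        simp at this
        tauto
    · refine ⟨![M 0 0, M 1 0], ?_, ?_⟩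
      · intro h0
        have a := congrFun h0 0
        have b := congrFun h0 1
        exact h ⟨by simpa using a, by simpa using b⟩
      · intro s hs
        have := e3 s hs
        simp [rw2, mulVec_ent]
        linear_combination M 1 0 * this + s 1 0 * e2
  obtain ⟨s, hs, hs2⟩ := irr hS hu
  exact hs2 (hu2 s (Submonoid.subset_closure hs))

lemma hyp_pow {g : SL2} {l : ℝ} {B : SL2} (h : IsHyp g l B) (n : ℕ) :
    (B⁻¹ * g ^ n * B) 0 0 = l ^ n ∧ (B⁻¹ * g ^ n * B) 0 1 = 0 ∧ (B⁻¹ * g ^ n * B) 1 0 = 0 ∧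
    (B⁻¹ * g ^ n * B) 1 1 = (l ^ n)⁻¹ := by
  obtain ⟨-, h0, h1, h2, h3⟩ := h
  induction n with
  | zero => simp
  | succ n ih =>
    obtain ⟨i0, i1, i2, i3⟩ := ih
    have : B⁻¹ * g ^ (n + 1) * B = (B⁻¹ * g ^ n * B) * (B⁻¹ * g * B) := by rw [pow_succ]; group
    rw [this]
    generalize B⁻¹ * g ^ n * B = x at *
    generalize B⁻¹ * g * B = y at *
    simp only [mul_ent, i0, i1, i2, i3, h0, h1, h2, h3]
    refine ⟨by ring, by ring, by ring, ?_⟩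
    rw [pow_succ, mul_inv]; ring

lemma tr_conj (g B : SL2) : tr (B⁻¹ * g * B) = tr g := by
  have := det_eq B
  simp only [tr, mul_ent, inv00, inv01, inv10, inv11]
  linear_combination (g 0 0 + g 1 1) * this

lemma int_lim {c L : ℝ} {x : ℕ → ℝ} (hx : ∀ᶠ n in atTop, ∃ k : ℤ, x n = k * c)
    (hL : Tendsto x atTop (nhds L)) : ∀ᶠ n in atTop, x n = L := by
  rcases eq_or_ne c 0 with rfl | hc
  · have h0 : ∀ᶠ n in atTop, x n = 0 := hx.mono fun n ⟨k, hk⟩ => by simpa using hk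
    have : L = 0 := tendsto_nhds_unique hL (tendsto_const_nhds.congr' (h0.mono fun n h => h.symm))
    rwa [this]
  · have hc' : 0 < |c| / 2 := by positivity
    have hev := hx.and (hL.eventually (Metric.ball_mem_nhds L hc'))
    obtain ⟨N, hN⟩ := eventually_atTop.1 hev
    have hconst : ∀ n ≥ N, x n = x N := by
      intro n hn
      obtain ⟨⟨k, hk⟩, h1⟩ := hN n hn
      obtain ⟨⟨k', hk'⟩, h2⟩ := hN N le_rfl
      have h3 : dist (x n) (x N) < |c| := by
        have := dist_triangle_right (x n) (x N) L
        linarith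
      rw [hk, hk', Real.dist_eq, ← sub_mul, abs_mul] at h3
      have h4 : |(k : ℝ) - k'| < 1 := by
        by_contra h
        push Not at h
        nlinarith [abs_pos.2 hc]
      have h5 : |k - k'| < 1 := by exact_mod_cast h4
      have h6 : k = k' := by
        rw [Int.abs_lt_one_iff] at h5; linarith
      rw [hk, hk', h6]
    have : L = x N := tendsto_nhds_unique hL (tendsto_const_nhds.congr'
      (eventually_atTop.2 ⟨N, fun n hn => (hconst n hn).symm⟩))
    rw [this]
    exact eventually_atTop.2 ⟨N, hconst⟩

lemma nonarith_key {T : Submonoid SL2} {c : ℝ}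
    (hc : ∀ g ∈ T, ∀ l B, IsHyp g l B → ∃ k : ℤ, Real.log |l| = k * c)
    {g : SL2} (hg : g ∈ T) {l : ℝ} {B : SL2} (hh : IsHyp g l B) {s : SL2} (hs : s ∈ T)
    (h0 : (B⁻¹ * s * B) 0 0 ≠ 0) : (B⁻¹ * s * B) 0 1 * (B⁻¹ * s * B) 1 0 = 0 := by
  have hl := hh.1
  have hl0 : l ≠ 0 := by rintro rfl; simp at hl; linarith
  have hdet := det_eq (B⁻¹ * s * B)
  set α := (B⁻¹ * s * B) 0 0 with hα
  set δ := (B⁻¹ * s * B) 1 1 with hδ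
  have htr : ∀ n : ℕ, tr (g ^ n * s) = l ^ n * α + (l ^ n)⁻¹ * δ := by
    intro n
    rw [← tr_conj _ B]
    have : B⁻¹ * (g ^ n * s) * B = (B⁻¹ * g ^ n * B) * (B⁻¹ * s * B) := by group
    rw [this]
    obtain ⟨i0, i1, i2, i3⟩ := hyp_pow hh n
    simp only [tr, mul_ent (B⁻¹ * g ^ n * B), i0, i1, i2, i3, hα, hδ]
    ring
  clear_value α δ
  have hli : Tendsto (fun n : ℕ => |l| ^ n) atTop atTop := tendsto_pow_atTop_atTop_of_one_lt hl
  have hinv : Tendsto (fun n : ℕ => (l ^ n)⁻¹) atTop (nhds 0) := by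
    rw [tendsto_zero_iff_abs_tendsto_zero]
    refine hli.inv_tendsto_atTop.congr fun n => ?_
    simp [abs_inv, abs_pow]
  have hq : Tendsto (fun n : ℕ => tr (g ^ n * s) * (l ^ n)⁻¹) atTop (nhds α) := by
    have : Tendsto (fun n : ℕ => α + (l ^ n)⁻¹ * (l ^ n)⁻¹ * δ) atTop (nhds (α + 0 * 0 * δ)) :=
      ((hinv.mul hinv).mul_const δ).const_add α
    simp only [zero_mul, add_zero] at this
    refine this.congr fun n => ?_
    rw [htr]
    have := pow_ne_zero n hl0
    field_simp
  have hbig : ∀ᶠ n in atTop, 4 < tr (g ^ n * s) ^ 2 := by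
    have h1 : Tendsto (fun n : ℕ => |tr (g ^ n * s) * (l ^ n)⁻¹| * |l| ^ n) atTop atTop :=
      hq.abs.pos_mul_atTop (abs_pos.2 h0) hli
    filter_upwards [h1.eventually (eventually_gt_atTop 2)] with n hn
    rw [abs_mul, abs_inv, abs_pow, mul_assoc, inv_mul_cancel₀ (pow_ne_zero n (abs_pos.2 hl0).ne'), mul_one] at hn
    rw [← sq_abs]; nlinarith
  have hΛ : ∀ n : ℕ, ∃ Λ : ℝ, 4 < tr (g ^ n * s) ^ 2 → (1 < |Λ| ∧ Λ + Λ⁻¹ = tr (g ^ n * s) ∧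
      ∃ k : ℤ, Real.log |Λ| = k * c) := by
    intro n
    by_cases h : 4 < tr (g ^ n * s) ^ 2
    · obtain ⟨Λ, B', h1, h2⟩ := hyp_of_tr h
      exact ⟨Λ, fun _ => ⟨h1.1, h2, hc _ (T.mul_mem (T.pow_mem hg n) hs) _ _ h1⟩⟩
    · exact ⟨0, fun h' => absurd h' h⟩
  choose Λ hΛ using hΛ
  have hlim : Tendsto (fun n => Λ n * (l ^ n)⁻¹) atTop (nhds α) := by
    have h1 : Tendsto (fun n => tr (g ^ n * s) * (l ^ n)⁻¹ - (Λ n)⁻¹ * (l ^ n)⁻¹) atTop (nhds (α - 0)) := by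
      refine hq.sub ?_
      refine squeeze_zero_norm' (a := fun n => |(l ^ n)⁻¹|) ?_ (by simpa using hinv.abs)
      filter_upwards [hbig] with n hn
      obtain ⟨h1, h2, h3⟩ := hΛ n hn
      rw [norm_mul, Real.norm_eq_abs, Real.norm_eq_abs, abs_inv]
      exact mul_le_of_le_one_left (abs_nonneg _) (inv_le_one_of_one_le₀ h1.le)
    rw [sub_zero] at h1
    refine h1.congr' ?_
    filter_upwards [hbig] with n hn
    obtain ⟨h1, h2, h3⟩ := hΛ n hn
    rw [← h2]; ring
  obtain ⟨k0, hk0⟩ := hc g hg l B hh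
  have hlog := (hlim.abs.log (abs_pos.2 h0).ne')
  have hev := int_lim (c := c) (hx := by
    filter_upwards [hbig] with n hn
    obtain ⟨h1, h2, k, hk⟩ := hΛ n hn
    refine ⟨k - n * k0, ?_⟩
    rw [abs_mul, Real.log_mul (by linarith) (by simp [hl0]), abs_inv, abs_pow, Real.log_inv,
      Real.log_pow, hk, hk0]
    push_cast; ring) hlog
  have hball := hlim.eventually (Metric.ball_mem_nhds α (abs_pos.2 h0))
  obtain ⟨n, hn, hn2, hn3⟩ := (hbig.and (hev.and hball)).exists
  obtain ⟨h1, h2, -⟩ := hΛ n hn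
  have hpn := pow_ne_zero n hl0
  have hΛ0 : Λ n ≠ 0 := by intro h; rw [h] at h1; simp at h1; linarith
  have habs : |Λ n * (l ^ n)⁻¹| = |α| := by
    have := congrArg Real.exp hn2
    rwa [Real.exp_log (abs_pos.2 (mul_ne_zero hΛ0 (inv_ne_zero hpn))), Real.exp_log (abs_pos.2 h0)] at this
  have heq : Λ n * (l ^ n)⁻¹ = α := by
    rcases abs_eq_abs.1 habs with h | h
    · exact h
    · rw [h, Real.dist_eq, show -α - α = -(2 * α) by ring, abs_neg, abs_mul] at hn3
      rw [abs_two] at hn3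
      linarith [abs_pos.2 h0]
  have heq' : Λ n = α * l ^ n := by rw [← heq]; field_simp
  rw [htr, heq'] at h2
  have h3 : α * δ = 1 := by
    have : (α * l ^ n)⁻¹ = (l ^ n)⁻¹ * δ := by linarith
    rw [mul_inv] at this
    field_simp at this
    linarith
  linarith

lemma nonarith {S : Set SL2} (hS : ¬ Group.IsSolvable (Subgroup.closure S)) (c : ℝ)
    (hc : ∀ g ∈ Submonoid.closure S, ∀ l B, IsHyp g l B → ∃ k : ℤ, Real.log |l| = k * c) : False := by
  obtain ⟨g, hg, hg4⟩ := exists_hyp hS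
  obtain ⟨l, B, hh, -⟩ := hyp_of_tr hg4
  set T := Submonoid.closure S
  have key := fun s (hs : s ∈ T) => nonarith_key hc hg hh hs
  have hB := det_eq B
  set pv : Fin 2 → ℝ := ![B 0 0, B 1 0] with hpv
  set qv : Fin 2 → ℝ := ![B 0 1, B 1 1] with hqv
  have hp : pv ≠ 0 := by
    intro h
    have a := congrFun h 0
    have b := congrFun h 1
    simp [hpv] at a b
    rw [a, b] at hB; simp at hB
  have hq : qv ≠ 0 := by
    intro h
    have a := congrFun h 0
    have b := congrFun h 1
    simp [hqv] at a b
    rw [a, b] at hB; simp at hB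
  set p := Projectivization.mk ℝ pv hp
  set q := Projectivization.mk ℝ qv hq
  have f1 (s : SL2) (h : (B⁻¹ * s * B) 1 0 = 0) : s • p = p := by
    rw [smul_mk_eq_iff]
    simp only [mul_ent, inv00, inv01, inv10, inv11] at h
    simp [rw2, mulVec_ent, hpv]; linarith
  have f2 (s : SL2) (h : (B⁻¹ * s * B) 0 0 = 0) : s • p = q := by
    rw [smul_mk_eq_iff]
    simp only [mul_ent, inv00, inv01, inv10, inv11] at h
    simp [rw2, mulVec_ent, hpv, hqv]; linarith
  have f3 (s : SL2) (h : (B⁻¹ * s * B) 0 1 = 0) : s⁻¹ • q = q := by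
    rw [smul_mk_eq_iff]
    simp only [mul_ent, inv00, inv01, inv10, inv11] at h
    simp only [rw2, mulVec_ent, inv00, inv01, inv10, inv11]
    simp [hqv]; linarith
  have f4 (s : SL2) (h : (B⁻¹ * s * B) 0 0 = 0) : s⁻¹ • q = p := by
    rw [smul_mk_eq_iff]
    simp only [mul_ent, inv00, inv01, inv10, inv11] at h
    simp only [rw2, mulVec_ent, inv00, inv01, inv10, inv11]
    simp [hqv, hpv]; linarith
  by_cases hA : ∀ s ∈ T, (B⁻¹ * s * B) 1 0 = 0 ∨ (B⁻¹ * s * B) 0 0 = 0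
  · refine no_fin_inv hS {x | ∃ s ∈ T, x = s • p} ((Set.toFinite {p, q}).subset ?_) ⟨_, 1, T.one_mem, rfl⟩ ?_
    · rintro x ⟨s, hs, rfl⟩
      rcases hA s hs with h | h
      · rw [f1 s h]; simp
      · rw [f2 s h]; simp
    · rintro s hs x ⟨t, ht, rfl⟩
      exact ⟨s * t, T.mul_mem (Submonoid.subset_closure hs) ht, (mul_smul s t p).symm⟩
  by_cases hA' : ∀ s ∈ T, (B⁻¹ * s * B) 0 1 = 0 ∨ (B⁻¹ * s * B) 0 0 = 0
  · have hS' : ¬ Group.IsSolvable (Subgroup.closure (S⁻¹)) := by rwa [Subgroup.closure_inv]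
    refine no_fin_inv hS' {x | ∃ s ∈ T, x = s⁻¹ • q} ((Set.toFinite {p, q}).subset ?_) ⟨_, 1, T.one_mem, rfl⟩ ?_
    · rintro x ⟨s, hs, rfl⟩
      rcases hA' s hs with h | h
      · rw [f3 s h]; simp
      · rw [f4 s h]; simp
    · rintro s hs x ⟨t, ht, rfl⟩
      refine ⟨t * s⁻¹, T.mul_mem ht (Submonoid.subset_closure (Set.mem_inv.1 hs)), ?_⟩
      rw [mul_inv_rev, inv_inv, mul_smul]
  push Not at hA hA'
  obtain ⟨s1, hs1, h1, h2⟩ := hA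
  obtain ⟨s2, hs2, h3, h4⟩ := hA'
  have k1 := (mul_eq_zero.1 (key s1 hs1 h2)).resolve_right h1
  have k2 := (mul_eq_zero.1 (key s2 hs2 h4)).resolve_left h3
  have k3 := key (s1 * s2) (T.mul_mem hs1 hs2)
  have : B⁻¹ * (s1 * s2) * B = (B⁻¹ * s1 * B) * (B⁻¹ * s2 * B) := by group
  rw [this] at k3
  generalize B⁻¹ * s1 * B = x at *
  generalize B⁻¹ * s2 * B = y at *
  simp only [mul_ent, k1, k2] at k3
  simp [h1, h2, h3, h4] at k3

end

open MeasureTheory Filter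
noncomputable section

/-! ### Projective line -/

/-- circle coordinate of a complexified vector -/
def Zc (v : ℂ × ℂ) : ℂ := (v.1 + v.2 * Complex.I) ^ 2 / (v.1 ^ 2 + v.2 ^ 2)

def rv (v : Fin 2 → ℝ) : ℂ × ℂ := ((v 0 : ℂ), (v 1 : ℂ))

lemma rv_smul (c : ℝ) (v : Fin 2 → ℝ) : rv (c • v) = (c : ℂ) • rv v := by
  ext <;> simp [rv]

lemma Zc_smul (c : ℂ) (hc : c ≠ 0) (v : ℂ × ℂ) : Zc (c • v) = Zc v := by
  unfold Zc
  simp only [Prod.smul_fst, Prod.smul_snd, smul_eq_mul]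
  rw [show (c * v.1 + c * v.2 * Complex.I) ^ 2 = c ^ 2 * (v.1 + v.2 * Complex.I) ^ 2 by ring,
    show (c * v.1) ^ 2 + (c * v.2) ^ 2 = c ^ 2 * (v.1 ^ 2 + v.2 ^ 2) by ring]
  rw [mul_div_mul_left _ _ (pow_ne_zero 2 hc)]

lemma sq_sum_ne {v : Fin 2 → ℝ} (hv : v ≠ 0) : v 0 ^ 2 + v 1 ^ 2 ≠ 0 := by
  intro h
  apply hv
  ext i; fin_cases i
  · simp; nlinarith [sq_nonneg (v 0), sq_nonneg (v 1)]
  · simp; nlinarith [sq_nonneg (v 0), sq_nonneg (v 1)]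

def zeta (x : PX) : ℂ := Projectivization.lift (fun v : {v : Fin 2 → ℝ // v ≠ 0} => Zc (rv v)) (by
  rintro ⟨a, ha⟩ ⟨b, hb⟩ t h
  simp only at h
  subst h
  rw [rv_smul]
  apply Zc_smul
  rintro h0
  rw [Complex.ofReal_eq_zero] at h0
  simp [h0] at ha) x

lemma zeta_mk (v : Fin 2 → ℝ) (hv : v ≠ 0) : zeta (Projectivization.mk ℝ v hv) = Zc (rv v) := rfl

lemma zeta_rep (x : PX) : zeta x = Zc (rv x.rep) := by
  conv_lhs => rw [← x.mk_rep]
  rw [zeta_mk]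

lemma cont_mk : Continuous (fun v : {v : Fin 2 → ℝ // v ≠ 0} => (Projectivization.mk ℝ v.1 v.2 : PX)) :=
  continuous_quot_mk

lemma cont_zeta : Continuous zeta := by
  refine Continuous.quotient_lift (s := projectivizationSetoid ℝ (Fin 2 → ℝ)) (f := fun v : {v : Fin 2 → ℝ // v ≠ 0} => Zc (rv v)) ?_ _
  have : ∀ i, Continuous (fun v : {v : Fin 2 → ℝ // v ≠ 0} => ((v.1 i : ℝ) : ℂ)) := fun i =>
    Complex.continuous_ofReal.comp ((continuous_apply i).comp continuous_subtype_val)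
  unfold Zc rv
  refine Continuous.div (by fun_prop) (by fun_prop) ?_
  intro v
  have := sq_sum_ne v.2
  simp only
  exact_mod_cast this

/-- real unit vector of angle t -/
def uv (t : ℝ) : Fin 2 → ℝ := ![Real.cos t, Real.sin t]

lemma uv_ne (t : ℝ) : uv t ≠ 0 := by
  intro h
  have a := congrFun h 0
  have b := congrFun h 1
  simp [uv] at a b
  have := Real.sin_sq_add_cos_sq t
  rw [a, b] at this; norm_num at this

lemma Zc_uv (t : ℝ) : Zc (rv (uv t)) = Complex.exp (2 * t * Complex.I) := by
  unfold Zc rv uv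
  simp only [Matrix.cons_val_zero, Matrix.cons_val_one]
  rw [Complex.ofReal_cos, Complex.ofReal_sin]
  rw [add_comm (Complex.cos _ ^ 2), Complex.sin_sq_add_cos_sq, div_one, ← Complex.exp_mul_I, ← Complex.exp_nat_mul]
  congr 1; push_cast; ring

lemma exists_uv (x : PX) : ∃ t, x = Projectivization.mk ℝ (uv t) (uv_ne t) := by
  induction x using Projectivization.ind with
  | h v hv =>
  refine ⟨Complex.arg (v 0 + v 1 * Complex.I), ?_⟩
  rw [mk_eq_iff]
  have h0 : (v 0 + v 1 * Complex.I : ℂ) ≠ 0 := by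
    intro h
    apply hv
    have a := congrArg Complex.re h
    have b := congrArg Complex.im h
    simp at a b
    ext i; fin_cases i; exacts [a, b]
  have hn := norm_pos_iff.2 h0
  unfold rw2 uv
  simp only [Matrix.cons_val_zero, Matrix.cons_val_one]
  rw [Complex.cos_arg h0, Complex.sin_arg]
  simp
  field_simp; ring

instance : CompactSpace PX := by
  refine ⟨?_⟩
  have h : (Set.univ : Set PX) = (fun t : ℝ => Projectivization.mk ℝ (uv t) (uv_ne t)) '' (Set.Icc (-Real.pi) Real.pi) := by
    symm
    rw [Set.eq_univ_iff_forall]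
    intro x
    obtain ⟨t, rfl⟩ := exists_uv x
    refine ⟨Complex.arg (Complex.exp (t * Complex.I)), ⟨(Complex.neg_pi_lt_arg _).le, Complex.arg_le_pi _⟩, ?_⟩
    simp only
    rw [mk_eq_iff]
    have hn : ‖Complex.exp (t * Complex.I)‖ = 1 := Complex.norm_exp_ofReal_mul_I t
    unfold rw2 uv
    simp only [Matrix.cons_val_zero, Matrix.cons_val_one]
    rw [Complex.cos_arg (Complex.exp_ne_zero _), Complex.sin_arg, hn, Complex.exp_ofReal_mul_I_re,
      Complex.exp_ofReal_mul_I_im]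
    ring
  rw [h]
  refine isCompact_Icc.image (cont_mk.comp (f := fun t : ℝ => (⟨uv t, uv_ne t⟩ : {v : Fin 2 → ℝ // v ≠ 0})) ?_)
  refine Continuous.subtype_mk ?_ _
  refine continuous_pi fun i => ?_
  fin_cases i
  · exact Real.continuous_cos
  · exact Real.continuous_sin

/-- measurable section -/
def sec (x : PX) : ℂ × ℂ := rv (uv (Complex.arg (zeta x) / 2))

lemma zeta_inj : Function.Injective zeta := by
  intro x y h
  obtain ⟨t, rfl⟩ := exists_uv x
  obtain ⟨s, rfl⟩ := exists_uv y
  rw [zeta_mk, zeta_mk, Zc_uv, Zc_uv, Complex.exp_eq_exp_iff_exists_int] at h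
  obtain ⟨n, hn⟩ := h
  have : t - s = n * Real.pi := by
    have := congrArg Complex.im hn
    simp at this
    linarith
  rw [mk_eq_iff]
  unfold rw2 uv
  simp only [Matrix.cons_val_zero, Matrix.cons_val_one]
  have h2 := Real.sin_int_mul_pi n
  rw [← this, Real.sin_sub] at h2
  linarith

lemma zeta_emb : Topology.IsClosedEmbedding zeta := cont_zeta.isClosedEmbedding zeta_inj

instance : T2Space PX := zeta_emb.isEmbedding.t2Space

lemma mk_sec (x : PX) : Projectivization.mk ℝ (uv (Complex.arg (zeta x) / 2)) (uv_ne _) = x := by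
  apply zeta_inj
  rw [zeta_mk, Zc_uv]
  obtain ⟨t, rfl⟩ := exists_uv x
  rw [zeta_mk, Zc_uv]
  push_cast
  rw [show 2 * ((Complex.arg (Complex.exp (2 * t * Complex.I)) : ℂ) / 2) * Complex.I =
    (Complex.arg (Complex.exp (2 * t * Complex.I)) : ℂ) * Complex.I by ring]
  have := Complex.norm_mul_exp_arg_mul_I (Complex.exp (2 * t * Complex.I))
  rw [show ‖Complex.exp (2 * t * Complex.I)‖ = 1 by
    have := Complex.norm_exp_ofReal_mul_I (2 * t); push_cast at this; exact this] at this
  simpa using this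

lemma meas_sec : Measurable sec := by
  unfold sec rv uv
  have h1 : Measurable fun x => Complex.arg (zeta x) / 2 :=
    (Complex.measurable_arg.comp cont_zeta.measurable).div_const 2
  simp only [Matrix.cons_val_zero, Matrix.cons_val_one]
  exact (Complex.measurable_ofReal.comp (Real.measurable_cos.comp h1)).prodMk
    (Complex.measurable_ofReal.comp (Real.measurable_sin.comp h1))

end

open MeasureTheory Filter
noncomputable section

lemma rv_mulVec (g : SL2) (v : Fin 2 → ℝ) : rv ((g : Matrix (Fin 2) (Fin 2) ℝ).mulVec v) = sm g (rv v) := by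
  unfold rv sm
  simp [Matrix.mulVec, dotProduct, Fin.sum_univ_two]

lemma act_mk (g : SL2) (v : Fin 2 → ℝ) (hv : v ≠ 0) :
    ∃ h, act g (Projectivization.mk ℝ v hv) =
      Projectivization.mk ℝ ((g : Matrix (Fin 2) (Fin 2) ℝ).mulVec v) h := by
  refine ⟨?_, rfl⟩
  intro h
  apply hv
  have : (Matrix.SpecialLinearGroup.toLin' g) v = (Matrix.SpecialLinearGroup.toLin' g) 0 := by
    rw [map_zero]; exact h
  exact (Matrix.SpecialLinearGroup.toLin' g).injective this

lemma sec_act (g : SL2) (x : PX) : ∃ c : ℝ, c ≠ 0 ∧ sm g (sec x) = (c : ℂ) • sec (act g x) := by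
  have hx := mk_sec x
  have hy := mk_sec (act g x)
  obtain ⟨h, h1⟩ := act_mk g _ (uv_ne (Complex.arg (zeta x) / 2))
  rw [hx] at h1
  have hy2 := h1.symm.trans hy.symm
  rw [Projectivization.mk_eq_mk_iff'] at hy2
  obtain ⟨c, hc⟩ := hy2
  refine ⟨c, ?_, ?_⟩
  · rintro rfl
    rw [zero_smul] at hc
    exact h hc.symm
  · unfold sec
    rw [← rv_mulVec, ← rv_smul, hc]

lemma Zc_sec (x : PX) : Zc (sec x) = zeta x := by
  unfold sec
  rw [← zeta_mk _ (uv_ne _), mk_sec]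

lemma meas_Zc : Measurable Zc := by
  unfold Zc; fun_prop

lemma meas_act : Measurable (fun p : SL2 × PX => act p.1 p.2) := by
  rw [← zeta_emb.measurableEmbedding.measurable_comp_iff]
  have : (zeta ∘ fun p : SL2 × PX => act p.1 p.2) = fun p => Zc (sm p.1 (sec p.2)) := by
    ext p
    obtain ⟨c, hc, h⟩ := sec_act p.1 p.2
    simp only [Function.comp]
    rw [h, Zc_smul _ (by exact_mod_cast hc), Zc_sec]
  rw [this]
  exact meas_Zc.comp (cont_sm.measurable.comp (measurable_fst.prodMk (meas_sec.comp measurable_snd)))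

lemma meas_act_g (g : SL2) : Measurable (act g) := meas_act.comp (measurable_const.prodMk measurable_id)

lemma stat_lint {μ : Measure SL2} {ν : Measure PX} [IsProbabilityMeasure ν] (h : IsMuStationary μ ν)
    (K : PX → ENNReal) (hK : Measurable K) :
    ∫⁻ x, K x ∂ν = ∫⁻ g, ∫⁻ x, K (act g x) ∂ν ∂μ := by
  conv_lhs => rw [← h]
  have hm : Measurable (fun g => ν.map (act g)) := by
    refine Measure.measurable_of_measurable_coe _ fun A hA => ?_
    have : (fun g => ν.map (act g) A) = fun g => ν (Prod.mk g ⁻¹' ((fun p : SL2 × PX => act p.1 p.2) ⁻¹' A)) := by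
      ext g
      rw [Measure.map_apply (meas_act_g g) hA]; rfl
    rw [this]
    exact measurable_measure_prodMk_left (meas_act hA)
  rw [Measure.lintegral_bind hm.aemeasurable hK.aemeasurable]
  refine lintegral_congr fun g => ?_
  rw [lintegral_map hK (meas_act_g g)]

lemma act_inv (g : SL2) (x y : PX) : act g x = y ↔ x = g⁻¹ • y := by
  change g • x = y ↔ _
  rw [eq_inv_smul_iff]

instance : MeasurableSingletonClass PX := inferInstance

lemma nonatomic {μ : Measure SL2} [IsProbabilityMeasure μ] (hzd : ZariskiDense μ)
    {ν : Measure PX} [IsProbabilityMeasure ν] (hst : IsMuStationary μ ν) (x : PX) : ν {x} = 0 := by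
  have key (x : PX) : ν {x} = ∫⁻ g, ν {g⁻¹ • x} ∂μ := by
    have := stat_lint hst (Set.indicator {x} 1) (measurable_one.indicator (measurableSet_singleton x))
    rw [lintegral_indicator_one (measurableSet_singleton x)] at this
    rw [this]
    refine lintegral_congr fun g => ?_
    rw [← lintegral_indicator_one (measurableSet_singleton _)]
    refine lintegral_congr fun y => ?_
    have := act_inv g y x
    by_cases h : y = g⁻¹ • x
    · rw [this.2 h, h]; simp
    · have h2 : act g y ≠ x := fun h' => h (this.1 h')
      simp [h, h2]
  by_contra hx
  have hxpos : 0 < ν {x} := pos_iff_ne_zero.2 hx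
  have hfin (c : ENNReal) (hc : c ≠ 0) : {y | c ≤ ν {y}}.Finite := by
    have := Measure.finite_const_le_meas_of_disjoint_iUnion₀ (μ := ν) (As := fun y : PX => {y}) (pos_iff_ne_zero.2 hc)
      (fun y => (measurableSet_singleton y).nullMeasurableSet) ?_ (measure_ne_top _ _)
    · exact this
    · intro a b hab
      exact (Set.disjoint_singleton.2 hab).aedisjoint
  obtain ⟨x0, hx0, hmax⟩ := (hfin (ν {x}) hx).exists_maximalFor (fun y => ν {y}) _ ⟨x, le_refl (ν {x})⟩
  have hM : ∀ y, ν {y} ≤ ν {x0} := by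
    intro y
    by_contra h
    push Not at h
    exact absurd (hmax (show y ∈ {y | ν {x} ≤ ν {y}} from le_trans hx0 h.le) h.le) (not_le.2 h)
  have hMpos : ν {x0} ≠ 0 := (lt_of_lt_of_le hxpos hx0).ne'
  set A : Set PX := {y | ν {x0} ≤ ν {y}} with hA
  have hAf : A.Finite := hfin _ hMpos
  refine no_fin_inv (S := (measSupp μ)⁻¹) ?_ A hAf ⟨x0, le_refl (ν {x0})⟩ ?_
  · rw [Subgroup.closure_inv]; exact hzd
  intro s hs y hy
  have hs' : s⁻¹ ∈ measSupp μ := hs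
  by_contra hsy
  -- open set
  have hco : Continuous (fun g : SL2 => g⁻¹ • y) := by
    rw [zeta_emb.isEmbedding.continuous_iff]
    have : zeta ∘ (fun g : SL2 => g⁻¹ • y) = fun g => Zc (sm g⁻¹ (sec y)) := by
      ext g
      obtain ⟨c, hc, h⟩ := sec_act g⁻¹ y
      simp only [Function.comp]
      rw [h, Zc_smul _ (by exact_mod_cast hc), Zc_sec]; rfl
    rw [this]
    unfold Zc
    have h1 : Continuous fun g : SL2 => sm g⁻¹ (sec y) := (cont_sm_left (sec y)).comp continuous_inv
    refine Continuous.div (by fun_prop) (by fun_prop) ?_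
    intro g
    obtain ⟨h2, h3⟩ := act_mk g⁻¹ _ (uv_ne (Complex.arg (zeta y) / 2))
    unfold sec
    rw [← rv_mulVec]
    have := sq_sum_ne h2
    simp only [rv]
    exact_mod_cast this
  have hopen : IsOpen {g : SL2 | g⁻¹ • y ∉ A} := (hAf.isClosed.isOpen_compl).preimage hco
  have hpos := hs' _ hopen (by simpa using hsy)
  have hyM : ν {y} = ν {x0} := le_antisymm (hM y) hy
  have h1 := key y
  have hmeas : Measurable fun g : SL2 => ν {g⁻¹ • y} := by
    have : (fun g : SL2 => ν {g⁻¹ • y}) = fun g => ν (Prod.mk g ⁻¹' ((fun p : SL2 × PX => act p.1 p.2) ⁻¹' {y})) := by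
      ext g
      congr 1
      ext z
      simp [act_inv]
    rw [this]
    exact measurable_measure_prodMk_left (meas_act (measurableSet_singleton y))
  have h2 : ∫⁻ g, (ν {x0} - ν {g⁻¹ • y}) ∂μ = 0 := by
    rw [lintegral_sub hmeas (by rw [← h1]; exact measure_ne_top _ _) (Eventually.of_forall fun g => hM _)]
    rw [← h1, hyM]; simp
  rw [lintegral_eq_zero_iff (by exact measurable_const.sub hmeas)] at h2
  have h3 : μ {g : SL2 | g⁻¹ • y ∉ A} = 0 := by
    refine measure_mono_null ?_ h2
    intro g hg
    simp only [Set.mem_setOf_eq, hA, not_le] at hg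
    simp only [Set.mem_compl_iff, Set.mem_setOf_eq, Pi.zero_apply]
    intro h
    rw [tsub_eq_zero_iff_le] at h
    exact absurd h (not_le.2 hg)
  exact absurd h3 hpos.ne'
end

open MeasureTheory Filter
noncomputable section

attribute [fun_prop] meas_nF meas_N cont_nF cont_N

/-! ### Reduction to a system on vectors -/

def IsR (x : ℂ × ℂ) : Prop := x.1.im = 0 ∧ x.2.im = 0
def Hom {β : Type*} (K : ℂ × ℂ → β) : Prop := ∀ c : ℝ, c ≠ 0 → ∀ x, K ((c : ℂ) • x) = K x

structure Sys (P : Measure SL2) (m : Measure (ℂ × ℂ)) : Prop where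
  unit : ∀ᵐ x ∂m, IsR x ∧ N x = 1
  stat : ∀ K : ℂ × ℂ → ENNReal, Measurable K → Hom K →
    ∫⁻ g, ∫⁻ x, K (sm g⁻¹ x) ∂m ∂P = ∫⁻ x, K x ∂m
  null : ∀ w, IsR w → w ≠ 0 → m {x | wd x w = 0} = 0
  nsolv : ¬ Group.IsSolvable (Subgroup.closure (measSupp P))
  one : (1 : SL2) ∈ measSupp P
  mom : ∃ ε > (0 : ℝ), ∫⁻ g, ENNReal.ofReal (nF g ^ ε) ∂P < ⊤

def lazyM (μ : Measure SL2) : Measure SL2 := (2⁻¹ : ENNReal) • Measure.dirac 1 + (2⁻¹ : ENNReal) • μ.map (fun g => g⁻¹)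

lemma lint_lazy (μ : Measure SL2) (f : SL2 → ENNReal) (hf : Measurable f) :
    ∫⁻ g, f g ∂(lazyM μ) = 2⁻¹ * f 1 + 2⁻¹ * ∫⁻ g, f g⁻¹ ∂μ := by
  unfold lazyM
  rw [lintegral_add_measure, lintegral_smul_measure, lintegral_smul_measure, lintegral_dirac,
    lintegral_map hf measurable_inv]
  rfl

instance (μ : Measure SL2) [IsProbabilityMeasure μ] : IsProbabilityMeasure (lazyM μ) := by
  refine ⟨?_⟩
  have := lint_lazy μ (fun _ => 1) measurable_const
  simp only [lintegral_const, measure_univ, mul_one, one_mul] at this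
  rw [this]; exact ENNReal.inv_two_add_inv_two

lemma lazy_apply (μ : Measure SL2) (A : Set SL2) (hA : MeasurableSet A) :
    lazyM μ A = 2⁻¹ * A.indicator 1 1 + 2⁻¹ * μ (A⁻¹) := by
  rw [← lintegral_indicator_one hA, lint_lazy _ _ (measurable_one.indicator hA)]
  congr 2
  rw [← lintegral_indicator_one hA.inv]
  rfl

lemma nsolv_mono {H K : Subgroup SL2} (h : H ≤ K) (hH : ¬ Group.IsSolvable H) : ¬ Group.IsSolvable K := by
  intro hK
  exact hH (Group.isSolvable_of_isSolvable_injective (Subgroup.inclusion_injective h))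

lemma nF_le_op (g : SL2) : nF g ≤ 2 * opNorm g := by
  have h (j : Fin 2) : g 0 j ^ 2 + g 1 j ^ 2 ≤ opNorm g ^ 2 := by
    have h1 := (Matrix.toEuclideanCLM (𝕜 := ℝ) (n := Fin 2) (g : Matrix (Fin 2) (Fin 2) ℝ)).le_opNorm (EuclideanSpace.single j 1)
    rw [PiLp.norm_single, norm_one, mul_one] at h1
    have h2 := pow_le_pow_left₀ (norm_nonneg _) h1 2
    rw [EuclideanSpace.norm_sq_eq] at h2
    rw [Fin.sum_univ_two] at h2
    have e (i : Fin 2) : (Matrix.toEuclideanCLM (𝕜 := ℝ) (n := Fin 2) (g : Matrix (Fin 2) (Fin 2) ℝ)) (EuclideanSpace.single j 1) i = g i j := by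
      change ((g : Matrix (Fin 2) (Fin 2) ℝ).mulVec (Pi.single j 1)) i = _
      simp
    rw [e, e, Real.norm_eq_abs, Real.norm_eq_abs, sq_abs, sq_abs] at h2
    exact h2
  have h0 := h 0
  have h1 := h 1
  have hp : 0 ≤ opNorm g := norm_nonneg _
  apply Real.sqrt_le_iff.2
  constructor
  · positivity
  · nlinarith

lemma sys_exists {μ : Measure SL2} [IsProbabilityMeasure μ] (hmom : HasExpMoment μ) (hzd : ZariskiDense μ)
    {ν : Measure PX} [IsProbabilityMeasure ν] (hst : IsMuStationary μ ν) : Sys (lazyM μ) (ν.map sec) where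
  unit := by
    refine (ae_map_iff meas_sec.aemeasurable ?_).2 (Eventually.of_forall fun x => ?_)
    · unfold IsR
      refine MeasurableSet.inter (MeasurableSet.inter ?_ ?_) ?_
      · exact measurableSet_eq_fun (by fun_prop) (by fun_prop)
      · exact measurableSet_eq_fun (by fun_prop) (by fun_prop)
      · exact measurableSet_eq_fun meas_N (by fun_prop)
    · refine ⟨by simp [IsR, sec, rv], ?_⟩
      unfold N N2 sec rv uv
      simp only [Matrix.cons_val_zero, Matrix.cons_val_one]
      rw [Complex.norm_real, Complex.norm_real, Real.norm_eq_abs, Real.norm_eq_abs, sq_abs, sq_abs,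
        Real.cos_sq_add_sin_sq, Real.sqrt_one]
  stat := by
    intro K hK hom
    have hm1 : Measurable fun p : SL2 × PX => K (sm p.1⁻¹ (sec p.2)) :=
      hK.comp (cont_sm.measurable.comp (measurable_fst.inv.prodMk (meas_sec.comp measurable_snd)))
    have e1 (g : SL2) : ∫⁻ x, K (sm g⁻¹ x) ∂(ν.map sec) = ∫⁻ x, K (sm g⁻¹ (sec x)) ∂ν :=
      lintegral_map (hK.comp (cont_sm_right _).measurable) meas_sec
    simp only [e1]
    rw [lint_lazy _ _ (by exact hm1.lintegral_prod_right'), lintegral_map hK meas_sec]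
    have h2 := stat_lint hst (fun x => K (sec x)) (hK.comp meas_sec)
    have e2 : ∫⁻ g, ∫⁻ x, K (sec (act g x)) ∂ν ∂μ = ∫⁻ g, ∫⁻ x, K (sm g⁻¹⁻¹ (sec x)) ∂ν ∂μ := by
      refine lintegral_congr fun g => lintegral_congr fun x => ?_
      obtain ⟨c, hc, h⟩ := sec_act g x
      rw [inv_inv, h, hom c hc]
    rw [← e2, ← h2]
    simp only [inv_one, sm_one]
    rw [← add_mul, ENNReal.inv_two_add_inv_two, one_mul]
  null := by
    intro w hw hne
    have hw2 : w = rv ![w.1.re, w.2.re] := by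
      unfold rv
      refine Prod.ext (Complex.ext ?_ ?_) (Complex.ext ?_ ?_) <;> simp [hw.1, hw.2]
    rw [Measure.map_apply meas_sec (by
      exact measurableSet_eq_fun (by unfold wd; fun_prop) (by fun_prop))]
    have hv : ![w.1.re, w.2.re] ≠ (0 : Fin 2 → ℝ) := by
      intro h
      rw [h] at hw2
      apply hne; rw [hw2]; ext <;> simp [rv]
    refine measure_mono_null ?_ (nonatomic hzd hst (Projectivization.mk ℝ ![w.1.re, w.2.re] hv))
    intro x hx
    change wd (sec x) w = 0 at hx
    rw [hw2] at hx
    change x = _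
    conv_lhs => rw [← mk_sec x]
    rw [mk_eq_iff]
    unfold wd sec rv at hx
    unfold rw2
    simp only at hx
    exact_mod_cast hx
  nsolv := by
    refine nsolv_mono (H := Subgroup.closure (measSupp μ)) ?_ hzd
    rw [← Subgroup.closure_inv]
    refine Subgroup.closure_mono fun s hs => ?_
    intro U hU hsU
    rw [lazy_apply _ _ hU.measurableSet]
    have : 0 < μ U⁻¹ := hs U⁻¹ hU.inv (by simpa using hsU)
    have h2 : 0 < 2⁻¹ * μ U⁻¹ := by
      apply ENNReal.mul_pos _ this.ne'
      simp
    exact lt_of_lt_of_le h2 le_add_self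
  one := by
    intro U hU h1
    rw [lazy_apply _ _ hU.measurableSet]
    rw [Set.indicator_of_mem h1]
    refine lt_of_lt_of_le ?_ le_self_add
    simp
  mom := by
    obtain ⟨ε, hε, h⟩ := hmom
    refine ⟨ε, hε, ?_⟩
    rw [lint_lazy _ _ (by fun_prop)]
    simp only [nF_inv]
    have h3 : ∫⁻ g, ENNReal.ofReal (nF g ^ ε) ∂μ < ⊤ := by
      calc _ ≤ ∫⁻ g, ENNReal.ofReal (2 ^ ε) * ENNReal.ofReal (opNorm g ^ ε) ∂μ := by
            refine lintegral_mono fun g => ?_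
            rw [← ENNReal.ofReal_mul (by positivity), ← Real.mul_rpow (by norm_num) (show 0 ≤ opNorm g from norm_nonneg _)]
            exact ENNReal.ofReal_le_ofReal (Real.rpow_le_rpow (nF_nonneg g) (nF_le_op g) hε.le)
        _ = ENNReal.ofReal (2 ^ ε) * ∫⁻ g, ENNReal.ofReal (opNorm g ^ ε) ∂μ := by
            rw [lintegral_const_mul' _ _ ENNReal.ofReal_ne_top]
        _ < ⊤ := ENNReal.mul_lt_top ENNReal.ofReal_lt_top h
    refine ENNReal.add_lt_top.2 ⟨ENNReal.mul_lt_top (by simp) ENNReal.ofReal_lt_top,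
      ENNReal.mul_lt_top (by simp) h3⟩

/-- reduction of the main theorem -/
lemma final_of_core {ν : Measure PX} [IsProbabilityMeasure ν]
    (h : Tendsto (fun k : ℕ => ∫ x, Zc x ^ k ∂(ν.map sec)) atTop (nhds 0)) :
    Filter.Tendsto
      (fun k : ℤ => ∫ x : PX,
        ((((x.rep 0 : ℂ) + (x.rep 1 : ℂ) * Complex.I) ^ 2) /
          ((x.rep 0 : ℂ) ^ 2 + (x.rep 1 : ℂ) ^ 2)) ^ k ∂ν)
      Filter.cofinite (nhds (0 : ℂ)) := by
  have e0 (k : ℤ) : ∫ x : PX, ((((x.rep 0 : ℂ) + (x.rep 1 : ℂ) * Complex.I) ^ 2) /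
          ((x.rep 0 : ℂ) ^ 2 + (x.rep 1 : ℂ) ^ 2)) ^ k ∂ν = ∫ x, zeta x ^ k ∂ν := by
    refine integral_congr_ae (Eventually.of_forall fun x => ?_)
    simp only
    rw [zeta_rep]; rfl
  simp only [e0]
  have e1 (k : ℕ) : ∫ x, Zc x ^ k ∂(ν.map sec) = ∫ x, zeta x ^ k ∂ν := by
    rw [integral_map meas_sec.aemeasurable (meas_Zc.pow_const k).aestronglyMeasurable]
    simp only [Zc_sec]
  simp only [e1] at h
  have hn (x : PX) : ‖zeta x‖ = 1 := by
    obtain ⟨t, rfl⟩ := exists_uv x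
    rw [zeta_mk, Zc_uv]
    have := Complex.norm_exp_ofReal_mul_I (2 * t); push_cast at this; exact this
  have e2 (k : ℕ) : ∫ x, zeta x ^ (-(k : ℤ)) ∂ν = (starRingEnd ℂ) (∫ x, zeta x ^ k ∂ν) := by
    rw [← integral_conj]
    refine integral_congr_ae (Eventually.of_forall fun x => ?_)
    simp only
    rw [zpow_neg, zpow_natCast, Complex.inv_def, Complex.normSq_eq_norm_sq, norm_pow, hn]
    simp
  have e3 (k : ℤ) : ‖∫ x, zeta x ^ k ∂ν‖ = ‖∫ x, zeta x ^ k.natAbs ∂ν‖ := by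
    rcases Int.natAbs_eq k with h | h
    · conv_lhs => rw [h]
      simp only [zpow_natCast]
    · conv_lhs => rw [h]
      rw [e2, RCLike.norm_conj]
  rw [tendsto_zero_iff_norm_tendsto_zero] at h ⊢
  simp only [e3]
  refine h.comp ?_
  have : Tendsto Int.natAbs cofinite cofinite := by
    refine Tendsto.cofinite_of_finite_preimage_singleton ?_
    intro n
    refine Set.Finite.subset (Set.toFinite {(n : ℤ), -(n : ℤ)}) ?_
    intro k hk
    exact Int.natAbs_eq_iff.1 hk
  rwa [Nat.cofinite_eq_atTop] at this
end

open MeasureTheory Filter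
noncomputable section

@[fun_prop]
lemma meas_sm_comp {α : Type*} [MeasurableSpace α] {f : α → SL2} {v : α → ℂ × ℂ}
    (hf : Measurable f) (hv : Measurable v) : Measurable fun a => sm (f a) (v a) :=
  cont_sm.measurable.comp (hf.prodMk hv)

@[fun_prop]
lemma cont_sm_comp {α : Type*} [TopologicalSpace α] {f : α → SL2} {v : α → ℂ × ℂ}
    (hf : Continuous f) (hv : Continuous v) : Continuous fun a => sm (f a) (v a) :=
  cont_sm.comp (hf.prodMk hv)

@[fun_prop]
lemma meas_wd_comp {α : Type*} [MeasurableSpace α] {f : α → ℂ × ℂ} {v : α → ℂ × ℂ}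
    (hf : Measurable f) (hv : Measurable v) : Measurable fun a => wd (f a) (v a) :=
  cont_wd.measurable.comp (hf.prodMk hv)

@[fun_prop]
lemma cont_wd_comp {α : Type*} [TopologicalSpace α] {f : α → ℂ × ℂ} {v : α → ℂ × ℂ}
    (hf : Continuous f) (hv : Continuous v) : Continuous fun a => wd (f a) (v a) :=
  cont_wd.comp (hf.prodMk hv)

/-! ### Convolution powers -/

def cp (P : Measure SL2) : ℕ → Measure SL2
  | 0 => Measure.dirac 1
  | n + 1 => Measure.mconv P (cp P n)

instance cp_prob (P : Measure SL2) [IsProbabilityMeasure P] (n : ℕ) : IsProbabilityMeasure (cp P n) := by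
  induction n with
  | zero => unfold cp; infer_instance
  | succ n ih => unfold cp; infer_instance

variable {P : Measure SL2} [IsProbabilityMeasure P]

lemma lint_zero {f : SL2 → ENNReal} (hf : Measurable f) : ∫⁻ g, f g ∂(cp P 0) = f 1 := by
  unfold cp; rw [lintegral_dirac' _ hf]

lemma cp_one : cp P 1 = P := by
  simp only [cp]; exact Measure.mconv_dirac_one P

lemma cp_add (m n : ℕ) : cp P (m + n) = Measure.mconv (cp P m) (cp P n) := by
  induction m with
  | zero => rw [zero_add]; simp only [cp]; rw [Measure.dirac_one_mconv]
  | succ m ih =>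
    rw [show m + 1 + n = (m + n) + 1 by ring]
    simp only [cp]
    rw [ih, Measure.mconv_assoc]

lemma lint_add {f : SL2 → ENNReal} (hf : Measurable f) (m n : ℕ) :
    ∫⁻ g, f g ∂(cp P (m + n)) = ∫⁻ g, ∫⁻ h, f (g * h) ∂(cp P n) ∂(cp P m) := by
  rw [cp_add, Measure.lintegral_mconv hf]

lemma lint_add' {f : SL2 → ENNReal} (hf : Measurable f) (m n : ℕ) :
    ∫⁻ g, f g ∂(cp P (m + n)) = ∫⁻ h, ∫⁻ g, f (g * h) ∂(cp P m) ∂(cp P n) := by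
  rw [lint_add hf, lintegral_lintegral_swap]
  exact Measurable.aemeasurable (by fun_prop)

lemma lint_succ {f : SL2 → ENNReal} (hf : Measurable f) (n : ℕ) :
    ∫⁻ g, f g ∂(cp P (n + 1)) = ∫⁻ g, ∫⁻ h, f (g * h) ∂P ∂(cp P n) := by
  rw [lint_add hf, cp_one]

lemma lint_succ' {f : SL2 → ENNReal} (hf : Measurable f) (n : ℕ) :
    ∫⁻ g, f g ∂(cp P (n + 1)) = ∫⁻ g, ∫⁻ h, f (g * h) ∂(cp P n) ∂P := by
  rw [add_comm, lint_add hf, cp_one]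

lemma mom_cp (ε : ℝ) (hε : 0 ≤ ε) (n : ℕ) :
    ∫⁻ g, ENNReal.ofReal (nF g ^ ε) ∂(cp P n) ≤ ENNReal.ofReal (nF 1 ^ ε) * (∫⁻ g, ENNReal.ofReal (nF g ^ ε) ∂P) ^ n := by
  induction n with
  | zero => rw [lint_zero (by fun_prop)]; simp
  | succ n ih =>
    rw [lint_succ' (by fun_prop)]
    calc _ ≤ ∫⁻ g, ∫⁻ h, ENNReal.ofReal (nF g ^ ε) * ENNReal.ofReal (nF h ^ ε) ∂(cp P n) ∂P := by
          refine lintegral_mono fun g => lintegral_mono fun h => ?_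
          rw [← ENNReal.ofReal_mul (Real.rpow_nonneg (nF_nonneg _) _), ← Real.mul_rpow (nF_nonneg _) (nF_nonneg _)]
          exact ENNReal.ofReal_le_ofReal (Real.rpow_le_rpow (nF_nonneg _) (nF_mul_le _ _) hε)
      _ = (∫⁻ g, ENNReal.ofReal (nF g ^ ε) ∂P) * (∫⁻ g, ENNReal.ofReal (nF g ^ ε) ∂(cp P n)) := by
          rw [lintegral_lintegral_mul] <;> exact Measurable.aemeasurable (by fun_prop)
      _ ≤ _ := by
          rw [pow_succ, ← mul_assoc, mul_comm]
          gcongr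

lemma supp_mul {Q R : Measure SL2} [IsProbabilityMeasure Q] [IsProbabilityMeasure R] {g h : SL2} (hg : g ∈ measSupp Q)
    (hh : h ∈ measSupp R) : g * h ∈ measSupp (Measure.mconv Q R) := by
  intro U hU hgh
  have h1 : (fun p : SL2 × SL2 => p.1 * p.2) ⁻¹' U ∈ nhds (g, h) :=
    (hU.preimage continuous_mul).mem_nhds hgh
  rw [nhds_prod_eq, mem_prod_iff] at h1
  obtain ⟨A, hA, B, hB, hAB⟩ := h1
  obtain ⟨A', hA', hA'o, hgA⟩ := mem_nhds_iff.1 hA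
  obtain ⟨B', hB', hB'o, hgB⟩ := mem_nhds_iff.1 hB
  unfold Measure.mconv
  rw [Measure.map_apply measurable_mul hU.measurableSet]
  refine lt_of_lt_of_le ?_ (measure_mono ((Set.prod_mono hA' hB').trans hAB))
  rw [Measure.prod_prod]
  exact ENNReal.mul_pos (hg A' hA'o hgA).ne' (hh B' hB'o hgB).ne'

lemma supp_cp_one (h1 : (1 : SL2) ∈ measSupp P) (n : ℕ) : (1 : SL2) ∈ measSupp (cp P n) := by
  induction n with
  | zero =>
    intro U hU h
    unfold cp
    rw [Measure.dirac_apply' _ hU.measurableSet, Set.indicator_of_mem h]; simp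
  | succ n ih =>
    have := supp_mul h1 ih
    rwa [one_mul] at this

lemma supp_cp (h1 : (1 : SL2) ∈ measSupp P) (n : ℕ) : measSupp P ⊆ measSupp (cp P (n + 1)) := by
  intro g hg
  have := supp_mul hg (supp_cp_one h1 n)
  rwa [mul_one] at this

lemma stat_cp {m : Measure (ℂ × ℂ)} [IsProbabilityMeasure m] (hs : Sys P m) (n : ℕ)
    (K : ℂ × ℂ → ENNReal) (hK : Measurable K) (hom : Hom K) :
    ∫⁻ g, ∫⁻ x, K (sm g⁻¹ x) ∂m ∂(cp P n) = ∫⁻ x, K x ∂m := by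
  induction n with
  | zero =>
    rw [lint_zero (by fun_prop)]
    simp [sm_one]
  | succ n ih =>
    rw [lint_succ' (by fun_prop)]
    have := hs.stat (fun x => ∫⁻ h, K (sm h⁻¹ x) ∂(cp P n)) (by fun_prop) (by
      intro c hc x
      refine lintegral_congr fun h => ?_
      rw [sm_smul, hom c hc])
    have e : ∫⁻ x, ∫⁻ h, K (sm h⁻¹ x) ∂(cp P n) ∂m = ∫⁻ x, K x ∂m := by
      rw [lintegral_lintegral_swap (Measurable.aemeasurable (by fun_prop)), ih]
    rw [← e, ← this]
    refine lintegral_congr fun g => ?_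
    rw [lintegral_lintegral_swap (Measurable.aemeasurable (by fun_prop))]
    simp only [mul_inv_rev, sm_mul]

lemma sys_cp {m : Measure (ℂ × ℂ)} [IsProbabilityMeasure m] (hs : Sys P m) (n : ℕ) : Sys (cp P (n + 1)) m where
  unit := hs.unit
  stat := stat_cp hs (n + 1)
  null := hs.null
  nsolv := nsolv_mono (Subgroup.closure_mono (supp_cp hs.one n)) hs.nsolv
  one := supp_cp_one hs.one _
  mom := by
    obtain ⟨ε, hε, h⟩ := hs.mom
    refine ⟨ε, hε, (mom_cp ε hε.le (n + 1)).trans_lt ?_⟩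
    exact ENNReal.mul_lt_top ENNReal.ofReal_lt_top (ENNReal.pow_lt_top h)

end

open MeasureTheory Filter
noncomputable section

/-! ### The norm of the random walk is unbounded -/

def e1 (k : SL2) : ℝ := |k 0 0 - 1| + |k 0 1| + |k 1 0| + |k 1 1 - 1|

lemma e1_nonneg (k : SL2) : 0 ≤ e1 k := by unfold e1; positivity

lemma cont_e1 : Continuous e1 := by
  unfold e1
  have := cont_entry
  fun_prop

lemma fst_le_N (v : ℂ × ℂ) : ‖v.1‖ ≤ N v := by
  apply Real.le_sqrt_of_sq_le
  unfold N2; nlinarith [sq_nonneg ‖v.2‖]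
lemma snd_le_N (v : ℂ × ℂ) : ‖v.2‖ ≤ N v := by
  apply Real.le_sqrt_of_sq_le
  unfold N2; nlinarith [sq_nonneg ‖v.1‖]
lemma N_le_add (v : ℂ × ℂ) : N v ≤ ‖v.1‖ + ‖v.2‖ := by
  apply Real.sqrt_le_iff.2
  constructor
  · positivity
  · unfold N2; nlinarith [norm_nonneg v.1, norm_nonneg v.2]

lemma N_sm_sub_le (k : SL2) (v : ℂ × ℂ) : N (sm k v - v) ≤ e1 k * N v := by
  refine (N_le_add _).trans ?_
  have h1 : ‖(sm k v - v).1‖ ≤ |k 0 0 - 1| * ‖v.1‖ + |k 0 1| * ‖v.2‖ := by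
    rw [show (sm k v - v).1 = ((k 0 0 - 1 : ℝ) : ℂ) * v.1 + ((k 0 1 : ℝ) : ℂ) * v.2 by simp [sm]; ring]
    refine (norm_add_le _ _).trans ?_
    rw [norm_mul, norm_mul, Complex.norm_real, Complex.norm_real]; rfl
  have h2 : ‖(sm k v - v).2‖ ≤ |k 1 0| * ‖v.1‖ + |k 1 1 - 1| * ‖v.2‖ := by
    rw [show (sm k v - v).2 = ((k 1 0 : ℝ) : ℂ) * v.1 + ((k 1 1 - 1 : ℝ) : ℂ) * v.2 by simp [sm]; ring]
    refine (norm_add_le _ _).trans ?_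
    rw [norm_mul, norm_mul, Complex.norm_real, Complex.norm_real]; rfl
  have h3 := fst_le_N v
  have h4 := snd_le_N v
  have a := mul_le_mul_of_nonneg_left h3 (abs_nonneg (k 0 0 - 1))
  have b := mul_le_mul_of_nonneg_left h4 (abs_nonneg (k 0 1))
  have c := mul_le_mul_of_nonneg_left h3 (abs_nonneg (k 1 0))
  have d := mul_le_mul_of_nonneg_left h4 (abs_nonneg (k 1 1 - 1))
  unfold e1; nlinarith

lemma N_sm_le_e1 (k : SL2) (v : ℂ × ℂ) : N (sm k v) ≤ (1 + e1 k) * N v := by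
  have := N_add_le (sm k v - v) v
  rw [sub_add_cancel] at this
  linarith [N_sm_sub_le k v]

lemma nF_sq_N (g : SL2) : nF g ^ 2 = N (sm g (1, 0)) ^ 2 + N (sm g (0, 1)) ^ 2 := by
  rw [nF_sq, N_sq, N_sq]
  simp [N2, sm]; ring

lemma nF_mul_le_e1 (k g : SL2) : nF (k * g) ≤ (1 + e1 k) * nF g := by
  have h0 := e1_nonneg k
  refine abs_le_of_sq_le_sq' ?_ (by have := nF_nonneg g; positivity) |>.2
  rw [mul_pow, nF_sq_N, nF_sq_N, sm_mul, sm_mul, mul_add, ← mul_pow, ← mul_pow]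
  gcongr
  · exact N_nonneg _
  · exact N_sm_le_e1 _ _
  · exact N_nonneg _
  · exact N_sm_le_e1 _ _

variable {P : Measure SL2} [IsProbabilityMeasure P]

lemma log_unbdd (hS : ¬ Group.IsSolvable (Subgroup.closure (measSupp P))) (C : ℝ) (hC : 0 ≤ C)
    (hb : ∀ n, ∫⁻ g, ENNReal.ofReal (Real.log (nF g)) ∂(cp P n) ≤ ENNReal.ofReal C) : False := by
  have hlog (g : SL2) : 0 ≤ Real.log (nF g) := Real.log_nonneg (one_le_nF g)
  set un : ℕ → SL2 → ENNReal := fun n g => ∫⁻ h, ENNReal.ofReal ((nF (g * h))⁻¹) ∂(cp P n) with hun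
  have hunm (n : ℕ) : Measurable (un n) := by simp only [hun]; fun_prop
  have hun1 (n : ℕ) (g : SL2) : un n g ≤ 1 := by
    simp only [hun]
    calc _ ≤ ∫⁻ h, 1 ∂(cp P n) := lintegral_mono fun h => by
          rw [← ENNReal.ofReal_one]
          exact ENNReal.ofReal_le_ofReal (inv_le_one_of_one_le₀ (one_le_nF _))
      _ = 1 := by simp
  set u : SL2 → ENNReal := fun g => limsup (fun n => un n g) atTop with hu
  have hum : Measurable u := Measurable.limsup hunm
  have hu1 (g : SL2) : u g ≤ 1 := by
    refine limsup_le_of_le (by isBoundedDefault) (Eventually.of_forall fun n => hun1 n g)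
  have hsub (g : SL2) : u g ≤ ∫⁻ y, u (g * y) ∂P := by
    have h1 : u g = limsup (fun n => ∫⁻ y, un n (g * y) ∂P) atTop := by
      simp only [hu]
      rw [← limsup_nat_add _ 1]
      congr 1; ext n
      simp only [hun]
      rw [lint_succ' (by fun_prop)]
      simp only [mul_assoc]
    rw [h1]
    refine limsup_lintegral_le (fun _ => 1) (fun n => (hunm n).comp (by fun_prop)) (fun n => Eventually.of_forall fun y => hun1 _ _) ?_
    simp
  have hcomp (g g' : SL2) : u g ≤ ENNReal.ofReal (1 + e1 (g' * g⁻¹)) * u g' := by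
    simp only [hu]
    rw [← ENNReal.limsup_const_mul_of_ne_top ENNReal.ofReal_ne_top]
    refine limsup_le_limsup (Eventually.of_forall fun n => ?_) (by isBoundedDefault) (by isBoundedDefault)
    simp only [hun]
    rw [← lintegral_const_mul' _ _ ENNReal.ofReal_ne_top]
    refine lintegral_mono fun h => ?_
    have h0 := e1_nonneg (g' * g⁻¹)
    rw [← ENNReal.ofReal_mul (by linarith)]
    apply ENNReal.ofReal_le_ofReal
    have := nF_mul_le_e1 (g' * g⁻¹) (g * h)
    rw [show g' * g⁻¹ * (g * h) = g' * h by group] at this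
    have p1 := nF_pos (g * h)
    have p2 := nF_pos (g' * h)
    rw [← div_eq_mul_inv, le_div_iff₀ p2, inv_mul_le_iff₀ p1]
    linarith
  have husc (g0 : SL2) (c : ENNReal) (hc : u g0 < c) : ∀ᶠ g in nhds g0, u g < c := by
    have h1 : Tendsto (fun g => ENNReal.ofReal (1 + e1 (g0 * g⁻¹)) * u g0) (nhds g0) (nhds (ENNReal.ofReal (1 + e1 (g0 * g0⁻¹)) * u g0)) := by
      refine ENNReal.Tendsto.mul_const ?_ (Or.inr (ne_top_of_le_ne_top ENNReal.one_ne_top (hu1 _)))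
      refine ENNReal.tendsto_ofReal ?_
      have : Continuous fun g => 1 + e1 (g0 * g⁻¹) := by
        have := cont_e1; fun_prop
      exact this.tendsto g0
    have h2 : ENNReal.ofReal (1 + e1 (g0 * g0⁻¹)) * u g0 = u g0 := by
      rw [mul_inv_cancel]; simp [e1]
    rw [h2] at h1
    filter_upwards [h1.eventually (gt_mem_nhds hc)] with g hg
    exact (hcomp g g0).trans_lt hg
  have hsmall (R : ℝ) (hR : 1 < R) (g : SL2) (hg : R ^ 2 ≤ nF g) : u g ≤ ENNReal.ofReal (R⁻¹ + C / Real.log R) := by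
    have hlR := Real.log_pos hR
    refine limsup_le_of_le (by isBoundedDefault) (Eventually.of_forall fun n => ?_)
    calc un n g ≤ ∫⁻ h, (ENNReal.ofReal R⁻¹ + ENNReal.ofReal (Real.log R)⁻¹ * ENNReal.ofReal (Real.log (nF h))) ∂(cp P n) := by
          refine lintegral_mono fun h => ?_
          rw [← ENNReal.ofReal_mul (by positivity), ← ENNReal.ofReal_add (by positivity) (by have := hlog h; positivity)]
          apply ENNReal.ofReal_le_ofReal
          by_cases hh : nF h ≤ R
          · have h1 : nF g ≤ nF (g * h) * R := by
              have := nF_mul_le (g * h) h⁻¹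
              rw [mul_inv_cancel_right, nF_inv] at this
              exact this.trans (by gcongr; exact nF_nonneg _)
            have h2 : R ≤ nF (g * h) := by nlinarith
            have h3 : (nF (g * h))⁻¹ ≤ R⁻¹ := by gcongr
            have : 0 ≤ (Real.log R)⁻¹ * Real.log (nF h) := by have := hlog h; positivity
            linarith
          · push Not at hh
            have h1 : Real.log R ≤ Real.log (nF h) := Real.log_le_log (by linarith) hh.le
            have h2 : 1 ≤ (Real.log R)⁻¹ * Real.log (nF h) := by
              rw [le_inv_mul_iff₀ hlR]; linarith
            have h3 : (nF (g * h))⁻¹ ≤ 1 := inv_le_one_of_one_le₀ (one_le_nF _)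
            have : 0 ≤ R⁻¹ := by positivity
            linarith
      _ = ENNReal.ofReal R⁻¹ + ENNReal.ofReal (Real.log R)⁻¹ * ∫⁻ h, ENNReal.ofReal (Real.log (nF h)) ∂(cp P n) := by
          rw [lintegral_add_left measurable_const, lintegral_const_mul' _ _ ENNReal.ofReal_ne_top]
          simp
      _ ≤ ENNReal.ofReal R⁻¹ + ENNReal.ofReal (Real.log R)⁻¹ * ENNReal.ofReal C := by
          gcongr; exact hb n
      _ = _ := by
          rw [← ENNReal.ofReal_mul (by positivity), ← ENNReal.ofReal_add (by positivity) (by positivity)]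
          congr 1; rw [div_eq_inv_mul]
  have hone : ENNReal.ofReal (Real.exp (-C)) ≤ u 1 := by
    refine le_limsup_of_frequently_le (Eventually.frequently (Eventually.of_forall fun n => ?_)) (by isBoundedDefault)
    have h1 : ENNReal.ofReal (Real.exp (-C) * (1 + C)) ≤ un n 1 + ENNReal.ofReal (Real.exp (-C) * C) := by
      calc _ = ∫⁻ h, ENNReal.ofReal (Real.exp (-C) * (1 + C)) ∂(cp P n) := by simp
        _ ≤ ∫⁻ h, (ENNReal.ofReal ((nF (1 * h))⁻¹) + ENNReal.ofReal (Real.exp (-C)) * ENNReal.ofReal (Real.log (nF h))) ∂(cp P n) := by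
          refine lintegral_mono fun h => ?_
          have p := nF_pos h
          rw [one_mul, ← ENNReal.ofReal_mul (by positivity), ← ENNReal.ofReal_add (by positivity) (by have := hlog h; positivity)]
          apply ENNReal.ofReal_le_ofReal
          have h2 : (nF h)⁻¹ = Real.exp (-C) * Real.exp (C - Real.log (nF h)) := by
            rw [← Real.exp_add, show -C + (C - Real.log (nF h)) = - Real.log (nF h) by ring, Real.exp_neg, Real.exp_log p]
          rw [h2, ← mul_add]
          refine mul_le_mul_of_nonneg_left ?_ (Real.exp_pos _).le
          have := Real.add_one_le_exp (C - Real.log (nF h))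
          linarith
        _ = un n 1 + ENNReal.ofReal (Real.exp (-C)) * ∫⁻ h, ENNReal.ofReal (Real.log (nF h)) ∂(cp P n) := by
          rw [lintegral_add_left (by fun_prop), lintegral_const_mul' _ _ ENNReal.ofReal_ne_top]
        _ ≤ un n 1 + ENNReal.ofReal (Real.exp (-C)) * ENNReal.ofReal C := by
          gcongr; exact hb n
        _ = _ := by rw [← ENNReal.ofReal_mul (by positivity)]
    rw [mul_add, mul_one, ENNReal.ofReal_add (by positivity) (by positivity)] at h1
    exact (ENNReal.add_le_add_iff_right ENNReal.ofReal_ne_top).1 h1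
  obtain ⟨R, hR2, hRs⟩ : ∃ R : ℝ, 2 ≤ R ∧ R⁻¹ + C / Real.log R < Real.exp (-C) := by
    have h1 : Tendsto (fun R : ℝ => R⁻¹ + C / Real.log R) atTop (nhds (0 + 0)) :=
      tendsto_inv_atTop_zero.add (Real.tendsto_log_atTop.const_div_atTop C)
    rw [add_zero] at h1
    obtain ⟨R, h2, h3⟩ := ((h1.eventually (gt_mem_nhds (Real.exp_pos (-C)))).and (eventually_ge_atTop 2)).exists
    exact ⟨R, h3, h2⟩
  have hout (g : SL2) (hg : R ^ 2 ≤ nF g) : u g < u 1 := by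
    refine lt_of_lt_of_le ((hsmall R (by linarith) g hg).trans_lt ?_) hone
    exact (ENNReal.ofReal_lt_ofReal_iff (Real.exp_pos _)).2 hRs
  have h1mem : nF 1 ≤ R ^ 2 := by
    by_contra h
    push Not at h
    exact absurd (hout 1 h.le) (lt_irrefl _)
  obtain ⟨g0, hg0, hmax⟩ := UpperSemicontinuousOn.exists_isMaxOn (s := {g : SL2 | nF g ≤ R ^ 2}) ⟨1, h1mem⟩ (isCompact_nF_le (R ^ 2)) (f := u)
    (fun g _ c hc => (husc g c hc).filter_mono nhdsWithin_le_nhds)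
  have hM (g : SL2) : u g ≤ u g0 := by
    by_cases h : nF g ≤ R ^ 2
    · exact hmax h
    · push Not at h
      exact (hout g h.le).le.trans (hmax h1mem)
  have hprop (g : SL2) (hg : u g = u g0) (s : SL2) (hs : s ∈ measSupp P) : u (g * s) = u g0 := by
    by_contra hne
    have hlt := lt_of_le_of_ne (hM (g * s)) hne
    have h1 : ∀ᶠ y in nhds s, u (g * y) < u g0 :=
      (continuous_const_mul g).tendsto s |>.eventually (husc _ _ hlt)
    obtain ⟨U, hU, hUo, hsU⟩ := eventually_nhds_iff.1 h1
    have hpos := hs U hUo hsU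
    have h2 : ∫⁻ y, (u g0 - u (g * y)) ∂P = 0 := by
      have hm : Measurable fun y => u (g * y) := hum.comp (by fun_prop)
      have hle : ∫⁻ y, u (g * y) ∂P ≤ u g0 := by
        calc _ ≤ ∫⁻ y, u g0 ∂P := lintegral_mono fun y => hM _
          _ = _ := by simp
      rw [lintegral_sub hm (ne_top_of_le_ne_top ENNReal.one_ne_top (hle.trans (hu1 _))) (Eventually.of_forall fun y => hM _)]
      simp only [lintegral_const, measure_univ, mul_one]
      rw [tsub_eq_zero_iff_le, ← hg]
      exact hsub g
    rw [lintegral_eq_zero_iff (by exact measurable_const.sub (hum.comp (by fun_prop)))] at h2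
    refine hpos.ne' (measure_mono_null ?_ h2)
    intro y hy h
    have h' : u g0 - u (g * y) = 0 := h
    rw [tsub_eq_zero_iff_le] at h'
    exact absurd h' (not_le.2 (hU y hy))
  have hT : ∀ t ∈ Submonoid.closure (measSupp P), ∀ g, u g = u g0 → u (g * t) = u g0 := by
    intro t ht
    induction ht using Submonoid.closure_induction with
    | mem s hs => exact fun g hg => hprop g hg s hs
    | one => intro g hg; rwa [mul_one]
    | mul a b _ _ ha hb => intro g hg; rw [← mul_assoc]; exact hb _ (ha g hg)
  obtain ⟨t, ht, htR⟩ := semigroup_unbdd hS (R ^ 2 * nF g0)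
  have h1 := hT t ht g0 rfl
  have h2 : R ^ 2 ≤ nF (g0 * t) := by
    have := nF_mul_le g0⁻¹ (g0 * t)
    rw [inv_mul_cancel_left, nF_inv] at this
    have p := nF_pos g0
    nlinarith
  have := hout _ h2
  rw [h1] at this
  exact absurd (hM 1) (not_le.2 this)
end

open MeasureTheory Filter
noncomputable section

/-! ### Uniform non-atomicity, stationarity -/

variable {P : Measure SL2} [IsProbabilityMeasure P] {m : Measure (ℂ × ℂ)} [IsProbabilityMeasure m]

lemma null_c (hs : Sys P m) {w : ℂ × ℂ} (hw : w ≠ 0) : m {x | wd x w = 0} = 0 := by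
  have key (w' : ℂ × ℂ) (hw' : IsR w') (hne : w' ≠ 0) (himp : ∀ x, IsR x → wd x w = 0 → wd x w' = 0) :
      m {x | wd x w = 0} = 0 := by
    have h1 := hs.null w' hw' hne
    refine measure_mono_null_ae ?_ h1
    filter_upwards [hs.unit] with x hx h
    exact himp x hx.1 h
  by_cases h : ((w.1.re : ℂ), (w.2.re : ℂ)) = (0 : ℂ × ℂ)
  · refine key ((w.1.im : ℂ), (w.2.im : ℂ)) ⟨by simp, by simp⟩ ?_ ?_
    · intro h2
      apply hw
      simp only [Prod.mk_eq_zero, Complex.ofReal_eq_zero] at h h2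
      exact Prod.ext (Complex.ext h.1 h2.1) (Complex.ext h.2 h2.2)
    · intro x hx h3
      have := congrArg Complex.im h3
      simp [wd, hx.1, hx.2] at this
      unfold wd
      rw [show x.1 = (x.1.re : ℂ) from Complex.ext rfl (by simp [hx.1]),
        show x.2 = (x.2.re : ℂ) from Complex.ext rfl (by simp [hx.2])]
      simp only
      exact_mod_cast this
  · refine key _ ⟨by simp, by simp⟩ h ?_
    intro x hx h3
    have := congrArg Complex.re h3
    simp [wd, hx.1, hx.2] at this
    unfold wd
    rw [show x.1 = (x.1.re : ℂ) from Complex.ext rfl (by simp [hx.1]),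
      show x.2 = (x.2.re : ℂ) from Complex.ext rfl (by simp [hx.2])]
    simp only
    exact_mod_cast this

lemma isCompact_sphere_N : IsCompact {y : ℂ × ℂ | N y = 1} := by
  refine Metric.isCompact_of_isClosed_isBounded (isClosed_eq cont_N continuous_const) ?_
  refine (Metric.isBounded_closedBall (x := (0 : ℂ × ℂ)) (r := 1)).subset fun y hy => ?_
  have hy' : N y = 1 := hy
  rw [mem_closedBall_zero_iff, Prod.norm_def]
  exact max_le (hy' ▸ fst_le_N y) (hy' ▸ snd_le_N y)

lemma wd_sub_right (x y z : ℂ × ℂ) : wd x (y - z) = wd x y - wd x z := by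
  simp [wd]; ring
lemma wd_smul_left (c : ℂ) (x y : ℂ × ℂ) : wd (c • x) y = c * wd x y := by
  simp [wd]; ring
lemma wd_smul_right (c : ℂ) (x y : ℂ × ℂ) : wd x (c • y) = c * wd x y := by
  simp [wd]; ring
lemma wd_comm (x y : ℂ × ℂ) : wd x y = - wd y x := by
  simp [wd]; ring

lemma unif_null (hs : Sys P m) (q : ENNReal) (hq : 0 < q) :
    ∃ r : ℝ, 0 < r ∧ r ≤ 1 ∧ ∀ y, N y = 1 → m {x | ‖wd x y‖ < r} ≤ q := by
  refine isCompact_sphere_N.induction_on (p := fun s => ∃ r : ℝ, 0 < r ∧ r ≤ 1 ∧ ∀ y ∈ s, m {x | ‖wd x y‖ < r} ≤ q) ?_ ?_ ?_ ?_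
  · exact ⟨1, one_pos, le_refl _, by simp⟩
  · rintro s t hst ⟨r, h0, h1, h⟩
    exact ⟨r, h0, h1, fun y hy => h y (hst hy)⟩
  · rintro s t ⟨r, h0, h1, h⟩ ⟨r', h0', h1', h'⟩
    refine ⟨min r r', lt_min h0 h0', (min_le_left _ _).trans h1, ?_⟩
    rintro y (hy | hy)
    · refine le_trans (measure_mono fun x hx => ?_) (h y hy)
      have hx' : ‖wd x y‖ < min r r' := hx
      exact lt_of_lt_of_le hx' (min_le_left _ _)
    · refine le_trans (measure_mono fun x hx => ?_) (h' y hy)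
      have hx' : ‖wd x y‖ < min r r' := hx
      exact lt_of_lt_of_le hx' (min_le_right _ _)
  · intro y hy
    have hyne : y ≠ 0 := ne_of_N (by rw [show N y = 1 from hy]; exact one_pos)
    have hnull := null_c hs hyne
    have hlim : Tendsto (fun n : ℕ => m {x | ‖wd x y‖ < 1 / ((n : ℝ) + 1)}) atTop (nhds (m (⋂ n : ℕ, {x | ‖wd x y‖ < 1 / ((n : ℝ) + 1)}))) := by
      refine tendsto_measure_iInter_atTop (fun n => ?_) ?_ ⟨0, measure_ne_top _ _⟩
      · exact (measurableSet_lt (by fun_prop) (by fun_prop)).nullMeasurableSet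
      · intro a b hab x hx
        have hx' : ‖wd x y‖ < 1 / ((b : ℝ) + 1) := hx
        exact lt_of_lt_of_le hx' (Nat.one_div_le_one_div hab)
    have he : (⋂ n : ℕ, {x | ‖wd x y‖ < 1 / ((n : ℝ) + 1)}) ⊆ {x | wd x y = 0} := by
      intro x hx
      rw [Set.mem_iInter] at hx
      change wd x y = 0
      by_contra hne
      obtain ⟨n, hn⟩ := exists_nat_one_div_lt (norm_pos_iff.2 hne)
      exact absurd (hx n) (not_lt.2 hn.le)
    rw [measure_mono_null he hnull] at hlim
    obtain ⟨n, hn⟩ := (hlim.eventually (gt_mem_nhds hq)).exists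
    set r : ℝ := 1 / ((n : ℝ) + 1) with hr
    have hr0 : 0 < r := by positivity
    have hr1 : r ≤ 1 := by
      rw [hr, div_le_one (by positivity)]; linarith [Nat.cast_nonneg (α := ℝ) n]
    refine ⟨{z | N (z - y) < r / 2}, mem_nhdsWithin_of_mem_nhds ?_, r / 2, by positivity, by linarith, ?_⟩
    · refine (isOpen_lt (cont_N.comp (continuous_id.sub continuous_const)) continuous_const).mem_nhds ?_
      change N (y - y) < r / 2
      rw [sub_self, N_zero]; positivity
    · intro z hz
      refine le_trans (measure_mono_ae ?_) hn.le
      filter_upwards [hs.unit] with x hx h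
      have h1 : ‖wd x z‖ < r / 2 := h
      have h2 := wd_norm_le x (z - y)
      rw [hx.2, one_mul, wd_sub_right] at h2
      have h3 : N (z - y) < r / 2 := hz
      change ‖wd x y‖ < r
      have h4 := norm_sub_le (wd x z) (wd x z - wd x y)
      rw [sub_sub_cancel] at h4
      linarith

lemma map_stat {β : Type*} [MeasurableSpace β] (hs : Sys P m) (n : ℕ) {F : ℂ × ℂ → β} (hF : Measurable F) (hom : Hom F) :
    ((cp P n).prod m).map (fun p => F (sm p.1⁻¹ p.2)) = m.map F := by
  have hm : Measurable fun p : SL2 × (ℂ × ℂ) => F (sm p.1⁻¹ p.2) := by fun_prop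
  ext A hA
  rw [Measure.map_apply hm hA, Measure.map_apply hF hA]
  have := stat_cp hs n (Set.indicator (F ⁻¹' A) 1) (measurable_one.indicator (hF hA)) (by
    intro c hc x
    have h1 : (c : ℂ) • x ∈ F ⁻¹' A ↔ x ∈ F ⁻¹' A := by
      rw [Set.mem_preimage, Set.mem_preimage, hom c hc]
    by_cases h : x ∈ F ⁻¹' A
    · rw [Set.indicator_of_mem h, Set.indicator_of_mem (h1.2 h)]; rfl
    · rw [Set.indicator_of_notMem h, Set.indicator_of_notMem (fun h' => h (h1.1 h'))])
  rw [lintegral_indicator_one (hF hA)] at this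
  rw [← this, ← lintegral_indicator_one (hm hA), lintegral_prod _ (Measurable.aemeasurable (measurable_one.indicator (hm hA)))]
  rfl

lemma int_stat (hs : Sys P m) (n : ℕ) {F : ℂ × ℂ → ℝ} (hF : Measurable F) (hom : Hom F) :
    ∫ p, F (sm p.1⁻¹ p.2) ∂((cp P n).prod m) = ∫ x, F x ∂m := by
  have h := map_stat hs n hF hom
  have hm : Measurable fun p : SL2 × (ℂ × ℂ) => F (sm p.1⁻¹ p.2) := by fun_prop
  have h1 := integral_map (μ := (cp P n).prod m) hm.aemeasurable (f := fun t : ℝ => t) (by fun_prop)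
  have h2 := integral_map (μ := m) hF.aemeasurable (f := fun t : ℝ => t) (by fun_prop)
  rw [← h1, ← h2, h]

/-! moments -/

lemma log_le_pow (x ε : ℝ) (hx : 1 ≤ x) (hε : 0 < ε) : Real.log x ^ 2 ≤ 4 / ε ^ 2 * x ^ ε := by
  have h0 : 0 < x := by linarith
  have h1 := Real.log_le_rpow_div h0.le (show 0 < ε / 2 by positivity)
  have h2 := Real.log_nonneg hx
  have h3 : Real.log x ^ 2 ≤ (x ^ (ε / 2) / (ε / 2)) ^ 2 := pow_le_pow_left₀ h2 h1 2
  have h4 : (x ^ (ε / 2)) ^ 2 = x ^ ε := by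
    rw [← Real.rpow_natCast, ← Real.rpow_mul h0.le]; norm_num
  rw [div_pow, h4] at h3
  refine h3.trans (le_of_eq ?_)
  field_simp; norm_num

lemma integrable_of_lint {α : Type*} [MeasurableSpace α] {μ : Measure α} {f : α → ℝ} (hf : Measurable f) (h0 : ∀ a, 0 ≤ f a)
    (h : ∫⁻ a, ENNReal.ofReal (f a) ∂μ < ⊤) : Integrable f μ := by
  refine ⟨hf.aestronglyMeasurable, ?_⟩
  rw [hasFiniteIntegral_iff_ofReal (Eventually.of_forall h0)]
  exact h

lemma exists_mom (hs : Sys P m) : ∃ ε > (0 : ℝ), ∀ n, Integrable (fun g => nF g ^ ε) (cp P n) := by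
  obtain ⟨ε, hε, h⟩ := hs.mom
  refine ⟨ε, hε, fun n => ?_⟩
  refine integrable_of_lint (by fun_prop) (fun g => Real.rpow_nonneg (nF_nonneg g) _) ?_
  exact (mom_cp ε hε.le n).trans_lt (ENNReal.mul_lt_top ENNReal.ofReal_lt_top (ENNReal.pow_lt_top h))

lemma log_nF_nonneg (g : SL2) : 0 ≤ Real.log (nF g) := Real.log_nonneg (one_le_nF g)

lemma int_sq (hs : Sys P m) (n : ℕ) : Integrable (fun g => Real.log (nF g) ^ 2) (cp P n) := by
  obtain ⟨ε, hε, h⟩ := exists_mom hs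
  refine Integrable.mono' ((h n).const_mul (4 / ε ^ 2)) (Measurable.aestronglyMeasurable (by fun_prop)) (Eventually.of_forall fun g => ?_)
  rw [Real.norm_eq_abs, abs_of_nonneg (by positivity)]
  exact log_le_pow _ _ (one_le_nF g) hε

lemma int_log (hs : Sys P m) (n : ℕ) : Integrable (fun g => Real.log (nF g)) (cp P n) := by
  refine Integrable.mono' ((int_sq hs n).add (integrable_const 1)) (Measurable.aestronglyMeasurable (by fun_prop)) (Eventually.of_forall fun g => ?_)
  have := log_nF_nonneg g
  rw [Real.norm_eq_abs, abs_of_nonneg this]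
  simp only [Pi.add_apply]; nlinarith [sq_nonneg (Real.log (nF g) - 1)]

lemma abs_log_N_le (g : SL2) {x : ℂ × ℂ} (hx : N x = 1) : |Real.log (N (sm g x))| ≤ Real.log (nF g) := by
  have h1 := N_sm_le g x
  have h2 := N_le_sm g x
  rw [hx] at h1 h2
  have hp : 0 < N (sm g x) := by
    have := nF_pos g
    by_contra h; push Not at h; nlinarith
  rw [abs_le]
  constructor
  · rw [← Real.log_inv]
    apply Real.log_le_log (inv_pos.2 (nF_pos g))
    rw [inv_le_iff_one_le_mul₀ (nF_pos g)]; linarith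
  · exact Real.log_le_log hp (by linarith)

end

open MeasureTheory Filter
noncomputable section

variable {P : Measure SL2} [IsProbabilityMeasure P] {m : Measure (ℂ × ℂ)} [IsProbabilityMeasure m]

def ell (P : Measure SL2) (m : Measure (ℂ × ℂ)) (n : ℕ) : ℝ :=
  ∫ p, Real.log (N (sm p.1⁻¹ p.2)) ∂((cp P n).prod m)

lemma ae_unit_snd (hs : Sys P m) (Q : Measure SL2) [IsProbabilityMeasure Q] :
    ∀ᵐ p ∂(Q.prod m), IsR p.2 ∧ N p.2 = 1 :=
  Measure.quasiMeasurePreserving_snd.ae hs.unit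

lemma int_L (hs : Sys P m) (n : ℕ) :
    Integrable (fun p : SL2 × (ℂ × ℂ) => Real.log (N (sm p.1⁻¹ p.2))) ((cp P n).prod m) := by
  refine Integrable.mono' ((int_log hs n).comp_fst m) (Measurable.aestronglyMeasurable (by fun_prop)) ?_
  filter_upwards [ae_unit_snd hs (cp P n)] with p hp
  have := abs_log_N_le p.1⁻¹ hp.2
  rwa [nF_inv] at this

lemma log_quot_le (g : SL2) (v : ℂ × ℂ) : |Real.log (N (sm g v) / N v)| ≤ Real.log (nF g) := by
  by_cases hv : v = 0
  · rw [hv]; simp [sm_zero, N_zero, log_nF_nonneg]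
  · have hp := N_pos hv
    have h1 : N (((N v)⁻¹ : ℝ) • v : ℂ × ℂ) = 1 := by
      rw [show (((N v)⁻¹ : ℝ) • v : ℂ × ℂ) = (((N v)⁻¹ : ℝ) : ℂ) • v by ext <;> simp, N_smul]
      simp [abs_of_pos hp, hp.ne']
    have h2 := abs_log_N_le g h1
    rw [show (((N v)⁻¹ : ℝ) • v : ℂ × ℂ) = (((N v)⁻¹ : ℝ) : ℂ) • v by ext <;> simp, sm_smul, N_smul] at h2
    rw [div_eq_inv_mul]
    convert h2 using 4
    simp [abs_of_pos hp]

lemma ell_succ (hs : Sys P m) (n : ℕ) : ell P m (n + 1) = ell P m n + ell P m 1 := by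
  set K : ℂ × ℂ → ℝ := fun v => ∫ g, Real.log (N (sm g⁻¹ v) / N v) ∂P with hK
  have hint1 : Integrable (fun g => Real.log (nF g)) P := by
    have := int_log hs 1; rwa [cp_one] at this
  have hKm : Measurable K := by
    have : StronglyMeasurable (fun p : (ℂ × ℂ) × SL2 => Real.log (N (sm p.2⁻¹ p.1) / N p.1)) :=
      Measurable.stronglyMeasurable (by fun_prop)
    exact this.integral_prod_right.measurable
  have hKb (v : ℂ × ℂ) : ‖K v‖ ≤ ∫ g, Real.log (nF g) ∂P := by
    refine norm_integral_le_of_norm_le hint1 (Eventually.of_forall fun g => ?_)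
    have := log_quot_le g⁻¹ v
    rwa [nF_inv] at this
  have hKh : Hom K := by
    intro c hc v
    simp only [hK]
    congr 1; ext g
    rw [sm_smul, N_smul, N_smul, mul_div_mul_left]
    simpa using hc
  have h1 : ell P m (n + 1) = ∫ x, ∫ g, Real.log (N (sm g⁻¹ x)) ∂(cp P (n + 1)) ∂m := by
    unfold ell
    rw [integral_prod_symm _ (int_L hs (n + 1))]
  have h2 : ∀ᵐ x ∂m, ∫ g, Real.log (N (sm g⁻¹ x)) ∂(cp P (n + 1)) =
      ∫ g, Real.log (N (sm g⁻¹ x)) ∂(cp P n) + ∫ g, K (sm g⁻¹ x) ∂(cp P n) := by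
    filter_upwards [hs.unit] with x hx
    have hi (k : ℕ) : Integrable (fun g : SL2 => Real.log (N (sm g⁻¹ x))) (cp P k) := by
      refine Integrable.mono' (int_log hs k) (Measurable.aestronglyMeasurable (by fun_prop)) (Eventually.of_forall fun g => ?_)
      have := abs_log_N_le g⁻¹ hx.2
      rwa [nF_inv] at this
    have hi1 := hi (n + 1)
    rw [cp_add, cp_one] at hi1 ⊢
    rw [integral_mconv hi1, ← integral_add (hi n)]
    · congr 1; ext g
      have hne : sm g⁻¹ x ≠ 0 := sm_ne (ne_of_N (by rw [hx.2]; exact one_pos))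
      have : ∀ h : SL2, Real.log (N (sm (g * h)⁻¹ x)) = Real.log (N (sm g⁻¹ x)) + Real.log (N (sm h⁻¹ (sm g⁻¹ x)) / N (sm g⁻¹ x)) := by
        intro h
        rw [mul_inv_rev, sm_mul, Real.log_div (N_pos (sm_ne hne)).ne' (N_pos hne).ne']
        ring
      simp only [this]
      rw [integral_add (integrable_const _)]
      · simp [hK]
      · refine Integrable.mono' hint1 (Measurable.aestronglyMeasurable (by fun_prop)) (Eventually.of_forall fun h => ?_)
        have := log_quot_le h⁻¹ (sm g⁻¹ x)
        rwa [nF_inv] at this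
    · exact Integrable.mono' (integrable_const _) (Measurable.aestronglyMeasurable (by fun_prop)) (Eventually.of_forall fun g => hKb _)
  have hKi : Integrable (fun p : SL2 × (ℂ × ℂ) => K (sm p.1⁻¹ p.2)) ((cp P n).prod m) :=
    Integrable.mono' (integrable_const _) (Measurable.aestronglyMeasurable (by fun_prop)) (Eventually.of_forall fun g => hKb _)
  rw [h1, integral_congr_ae h2, integral_add (int_L hs n).integral_prod_right hKi.integral_prod_right]
  congr 1
  · unfold ell; rw [integral_prod_symm _ (int_L hs n)]
  · rw [← integral_prod_symm _ hKi, int_stat hs n hKm hKh]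
    unfold ell
    rw [integral_prod_symm _ (int_L hs 1), cp_one]
    refine integral_congr_ae ?_
    filter_upwards [hs.unit] with x hx
    simp only [hK, hx.2, div_one]

lemma ell_mul (hs : Sys P m) (n : ℕ) : ell P m (n + 1) = (n + 1) * ell P m 1 := by
  induction n with
  | zero => simp
  | succ n ih => rw [ell_succ hs, ih]; push_cast; ring

lemma nF_le_of_pair (k : SL2) (x y : ℂ × ℂ) (hx : N x = 1) (hy : N y = 1) :
    nF k * ‖wd x y‖ ≤ 2 * (N (sm k x) + N (sm k y)) := by
  have key (e : ℂ × ℂ) (he : N e = 1) : N (sm k e) * ‖wd x y‖ ≤ N (sm k x) + N (sm k y) := by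
    have h1 : wd x y • sm k e = wd e y • sm k x + wd x e • sm k y := by
      simp only [← sm_smul, ← sm_add]
      congr 1
      ext <;> simp [wd] <;> ring
    have h2 := N_add_le (wd e y • sm k x) (wd x e • sm k y)
    rw [← h1, N_smul, N_smul, N_smul] at h2
    have h3 := wd_norm_le e y
    have h4 := wd_norm_le x e
    rw [he, hy, one_mul] at h3
    rw [hx, he, one_mul] at h4
    have := mul_le_mul_of_nonneg_right h3 (N_nonneg (sm k x))
    have := mul_le_mul_of_nonneg_right h4 (N_nonneg (sm k y))
    linarith
  have h1 := key (1, 0) (by simp [N, N2])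
  have h2 := key (0, 1) (by simp [N, N2])
  have h3 : nF k ≤ N (sm k (1, 0)) + N (sm k (0, 1)) := by
    refine (abs_le_of_sq_le_sq' ?_ (add_nonneg (N_nonneg _) (N_nonneg _))).2
    rw [nF_sq_N]
    nlinarith [N_nonneg (sm k (1, 0)), N_nonneg (sm k (0, 1))]
  have := mul_le_mul_of_nonneg_right h3 (norm_nonneg (wd x y))
  linarith

lemma ell_pos (hs : Sys P m) : 0 < ell P m 1 := by
  obtain ⟨r, hr0, hr1, hr⟩ := unif_null hs (ENNReal.ofReal (1 / 4)) (by simp)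
  set C : ℝ := - Real.log (r / 4) with hC
  have hC0 : 0 ≤ C := by
    rw [hC]; have := Real.log_nonpos (show 0 ≤ r / 4 by positivity) (by linarith); linarith
  have hlow (g : SL2) : 1 / 2 * Real.log (nF g) - C ≤ ∫ x, Real.log (N (sm g⁻¹ x)) ∂m := by
    set X := Real.log (nF g) with hX
    have hX0 : 0 ≤ X := log_nF_nonneg g
    set b : Set (ℂ × ℂ) := {x | N (sm g⁻¹ x) < r * nF g / 4} with hb
    have hbm : MeasurableSet b := measurableSet_lt (by fun_prop) (by fun_prop)
    have hbq : m.real b ≤ 1 / 4 := by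
      have : m b ≤ ENNReal.ofReal (1 / 4) := by
        by_cases hy : ∃ y, N y = 1 ∧ y ∈ b
        · obtain ⟨y, hy1, hyb⟩ := hy
          refine le_trans (measure_mono_ae ?_) (hr y hy1)
          filter_upwards [hs.unit] with x hx hxb
          have h1 := nF_le_of_pair g⁻¹ x y hx.2 hy1
          have h2 : N (sm g⁻¹ x) < r * nF g / 4 := hxb
          have h3 : N (sm g⁻¹ y) < r * nF g / 4 := hyb
          rw [nF_inv] at h1
          have := nF_pos g
          change ‖wd x y‖ < r
          nlinarith
        · have : m b = 0 := by
            rw [← compl_compl b]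
            refine mem_ae_iff.1 ?_
            filter_upwards [hs.unit] with x hx hxb
            exact hy ⟨x, hx.2, hxb⟩
          rw [this]; simp
      have h2 := ENNReal.toReal_mono ENNReal.ofReal_ne_top this
      rwa [ENNReal.toReal_ofReal (by norm_num)] at h2
    have hi : Integrable (fun x => X - C - b.indicator (fun _ => 2 * X) x) m :=
      (integrable_const _).sub ((integrable_const _).indicator hbm)
    have hi2 : Integrable (fun x => Real.log (N (sm g⁻¹ x))) m := by
      refine Integrable.mono' (integrable_const X) (Measurable.aestronglyMeasurable (by fun_prop)) ?_
      filter_upwards [hs.unit] with x hx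
      have := abs_log_N_le g⁻¹ hx.2
      rwa [nF_inv] at this
    calc _ ≤ X - C - m.real b * (2 * X) := by nlinarith
      _ = ∫ x, (X - C - b.indicator (fun _ => 2 * X) x) ∂m := by
          rw [integral_sub (integrable_const _) ((integrable_const _).indicator hbm), integral_indicator_const _ hbm]
          simp
      _ ≤ _ := by
          refine integral_mono_ae hi hi2 ?_
          filter_upwards [hs.unit] with x hx
          have h1 := (abs_le.1 (abs_log_N_le g⁻¹ hx.2)).1
          rw [nF_inv, ← hX] at h1
          by_cases hxb : x ∈ b
          · simp only [Set.indicator_of_mem hxb]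
            linarith
          · simp only [Set.indicator_of_notMem hxb]
            have h2 : r * nF g / 4 ≤ N (sm g⁻¹ x) := not_lt.1 hxb
            have h3 := Real.log_le_log (by have := nF_pos g; positivity) h2
            rw [show r * nF g / 4 = (r / 4) * nF g by ring, Real.log_mul (by positivity) (nF_pos g).ne'] at h3
            linarith
  by_contra hneg
  push Not at hneg
  have hn (n : ℕ) : ∫ g, Real.log (nF g) ∂(cp P n) ≤ 2 * C + Real.log (nF 1) := by
    cases n with
    | zero =>
      simp only [cp]
      rw [integral_dirac]; linarith
    | succ n =>
      have h1 := ell_mul hs n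
      have h2 : ell P m (n + 1) ≤ 0 := by
        rw [h1]; exact mul_nonpos_of_nonneg_of_nonpos (by positivity) hneg
      have h3 : ∫ g, (1 / 2 * Real.log (nF g) - C) ∂(cp P (n + 1)) ≤ ell P m (n + 1) := by
        unfold ell
        rw [integral_prod _ (int_L hs (n + 1))]
        exact integral_mono (((int_log hs _).const_mul _).sub (integrable_const _)) (int_L hs (n + 1)).integral_prod_left hlow
      rw [integral_sub ((int_log hs _).const_mul _) (integrable_const _), integral_const_mul] at h3
      simp at h3
      have := log_nF_nonneg 1
      linarith
  refine log_unbdd hs.nsolv (2 * C + Real.log (nF 1)) (by have := log_nF_nonneg 1; positivity) fun n => ?_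
  rw [← ofReal_integral_eq_lintegral_ofReal (int_log hs n) (Eventually.of_forall log_nF_nonneg)]
  exact ENNReal.ofReal_le_ofReal (hn n)
end

open MeasureTheory Filter
noncomputable section

variable {P : Measure SL2} [IsProbabilityMeasure P] {m : Measure (ℂ × ℂ)} [IsProbabilityMeasure m]

lemma sq_cp (hs : Sys P m) (n : ℕ) :
    ∫ g, Real.log (nF g) ^ 2 ∂(cp P (n + 1)) ≤ ((n : ℝ) + 1) ^ 2 * ∫ g, Real.log (nF g) ^ 2 ∂P := by
  set M := ∫ g, Real.log (nF g) ^ 2 ∂P with hM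
  have hP : Integrable (fun g => Real.log (nF g) ^ 2) P := by
    have := int_sq hs 1; rwa [cp_one] at this
  induction n with
  | zero => simp [cp_one, hM]
  | succ n ih =>
    have hi := int_sq hs (n + 2)
    have hn : (0 : ℝ) < (n : ℝ) + 1 := by positivity
    set c : ℝ := (n : ℝ) + 1 with hc
    change Integrable _ (Measure.mconv P (cp P (n + 1))) at hi
    change ∫ g, Real.log (nF g) ^ 2 ∂(Measure.mconv P (cp P (n + 1))) ≤ _
    rw [integral_mconv hi]
    have hb (g : SL2) : ∫ h, Real.log (nF (g * h)) ^ 2 ∂(cp P (n + 1)) ≤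
        (1 + c) * Real.log (nF g) ^ 2 + (1 + 1 / c) * ∫ h, Real.log (nF h) ^ 2 ∂(cp P (n + 1)) := by
      rw [← integral_const_mul]
      have : (1 + c) * Real.log (nF g) ^ 2 = ∫ h, (1 + c) * Real.log (nF g) ^ 2 ∂(cp P (n + 1)) := by simp
      rw [this, ← integral_add (integrable_const _) ((int_sq hs _).const_mul _)]
      refine integral_mono_of_nonneg (Eventually.of_forall fun h => by positivity)
        ((integrable_const _).add ((int_sq hs _).const_mul _)) (Eventually.of_forall fun h => ?_)
      have h1 : Real.log (nF (g * h)) ≤ Real.log (nF g) + Real.log (nF h) := by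
        rw [← Real.log_mul (nF_pos g).ne' (nF_pos h).ne']
        exact Real.log_le_log (nF_pos _) (nF_mul_le g h)
      have h2 := log_nF_nonneg (g * h)
      set x := Real.log (nF g)
      set y := Real.log (nF h)
      have h3 : Real.log (nF (g * h)) ^ 2 ≤ (x + y) ^ 2 := pow_le_pow_left₀ h2 h1 2
      have h4 : (1 + c) * x ^ 2 + (1 + 1 / c) * y ^ 2 - (x + y) ^ 2 = (c * x - y) ^ 2 / c := by
        field_simp; ring
      have h5 : 0 ≤ (c * x - y) ^ 2 / c := by positivity
      simp only
      linarith
    calc _ ≤ ∫ g, ((1 + c) * Real.log (nF g) ^ 2 + (1 + 1 / c) * ∫ h, Real.log (nF h) ^ 2 ∂(cp P (n + 1))) ∂P :=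
          integral_mono_of_nonneg (Eventually.of_forall fun h => by positivity)
            ((hP.const_mul _).add (integrable_const _)) (Eventually.of_forall hb)
      _ = (1 + c) * M + (1 + 1 / c) * ∫ h, Real.log (nF h) ^ 2 ∂(cp P (n + 1)) := by
          rw [integral_add (hP.const_mul _) (integrable_const _), integral_const_mul]; simp [hM]
      _ ≤ (1 + c) * M + (1 + 1 / c) * (c ^ 2 * M) := by gcongr
      _ = _ := by
        push_cast
        rw [← hc]; field_simp; ring

lemma int_logN (hs : Sys P m) (n : ℕ) {v : ℂ × ℂ} (hv : N v = 1) :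
    Integrable (fun g => Real.log (N (sm g v))) (cp P n) :=
  Integrable.mono' (int_log hs n) (Measurable.aestronglyMeasurable (by fun_prop))
    (Eventually.of_forall fun g => abs_log_N_le g hv)

lemma bad_le (hs : Sys P m) (n : ℕ) {v : ℂ × ℂ} (hv : N v = 1) {δ q : ℝ} (hq : 0 ≤ q)
    (h : ∀ y, N y = 1 → m {x | ‖wd x y‖ < δ} ≤ ENNReal.ofReal q) :
    ∫ p : SL2 × (ℂ × ℂ), {y : ℂ × ℂ | ‖wd v y‖ < δ * N y}.indicator (fun _ => (1 : ℝ)) (sm p.1⁻¹ p.2) ∂((cp P n).prod m) ≤ q := by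
  have hbm : MeasurableSet {y : ℂ × ℂ | ‖wd v y‖ < δ * N y} := measurableSet_lt (by fun_prop) (by fun_prop)
  rw [int_stat hs n (measurable_const.indicator hbm)]
  · rw [integral_indicator_const _ hbm]
    have : m {y : ℂ × ℂ | ‖wd v y‖ < δ * N y} ≤ ENNReal.ofReal q := by
      refine le_trans (measure_mono_ae ?_) (h v hv)
      filter_upwards [hs.unit] with x hx hx2
      have h1 : ‖wd v x‖ < δ * N x := hx2
      rw [hx.2, mul_one, wd_comm, norm_neg] at h1
      exact h1
    have h2 := ENNReal.toReal_mono ENNReal.ofReal_ne_top this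
    rw [ENNReal.toReal_ofReal hq] at h2
    simpa [Measure.real] using h2
  · intro c hc x
    have h1 : (c : ℂ) • x ∈ {y : ℂ × ℂ | ‖wd v y‖ < δ * N y} ↔ x ∈ {y : ℂ × ℂ | ‖wd v y‖ < δ * N y} := by
      change ‖wd v ((c : ℂ) • x)‖ < δ * N ((c : ℂ) • x) ↔ ‖wd v x‖ < δ * N x
      rw [wd_smul_right, N_smul, norm_mul]
      have : 0 < ‖(c : ℂ)‖ := by simpa using hc
      rw [show δ * (‖(c : ℂ)‖ * N x) = ‖(c : ℂ)‖ * (δ * N x) by ring]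
      exact mul_lt_mul_iff_right₀ this
    by_cases h : x ∈ {y : ℂ × ℂ | ‖wd v y‖ < δ * N y}
    · rw [Set.indicator_of_mem h, Set.indicator_of_mem (h1.2 h)]
    · rw [Set.indicator_of_notMem h, Set.indicator_of_notMem (fun h' => h (h1.1 h'))]

lemma log_low (hs : Sys P m) (n : ℕ) {v : ℂ × ℂ} (hv : N v = 1) {δ q s : ℝ} (hδ : 0 < δ) (hδ1 : δ ≤ 1) (hq : 0 ≤ q) (hs0 : 0 < s)
    (h : ∀ y, N y = 1 → m {x | ‖wd x y‖ < δ} ≤ ENNReal.ofReal q) :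
    Real.log δ + ((n : ℝ) + 1) * (ell P m 1 - s * (∫ g, Real.log (nF g) ^ 2 ∂P) - q / s) ≤ ∫ g, Real.log (N (sm g v)) ∂(cp P (n + 1)) := by
  set b : Set (ℂ × ℂ) := {y : ℂ × ℂ | ‖wd v y‖ < δ * N y} with hb
  have hbm : MeasurableSet b := measurableSet_lt (by fun_prop) (by fun_prop)
  set c : ℝ := (n : ℝ) + 1 with hc
  have hc0 : 0 < c := by positivity
  set F : SL2 × (ℂ × ℂ) → ℝ := fun p => b.indicator (fun _ => (1 : ℝ)) (sm p.1⁻¹ p.2) with hF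
  have hFm : Measurable F := by
    have h1 : Measurable (b.indicator (fun _ => (1 : ℝ))) := measurable_const.indicator hbm
    fun_prop
  have hFi : Integrable F ((cp P (n + 1)).prod m) := by
    refine Integrable.mono' (integrable_const 1) hFm.aestronglyMeasurable (Eventually.of_forall fun p => ?_)
    simp only [hF]
    by_cases hp : sm p.1⁻¹ p.2 ∈ b
    · rw [Set.indicator_of_mem hp]; simp
    · rw [Set.indicator_of_notMem hp]; simp
  have hFq : ∫ p, F p ∂((cp P (n + 1)).prod m) ≤ q := bad_le hs (n + 1) hv hq h
  have hX := (int_sq hs (n + 1)).comp_fst m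
  have hXe : ∫ p, Real.log (nF p.1) ^ 2 ∂((cp P (n + 1)).prod m) = ∫ g, Real.log (nF g) ^ 2 ∂(cp P (n + 1)) := by
    rw [integral_fun_fst (fun g => Real.log (nF g) ^ 2)]; simp
  have hYe : ∫ p, Real.log (N (sm p.1 v)) ∂((cp P (n + 1)).prod m) = ∫ g, Real.log (N (sm g v)) ∂(cp P (n + 1)) := by
    rw [integral_fun_fst (fun g => Real.log (N (sm g v)))]; simp
  have hL := int_L hs (n + 1)
  have hell := ell_mul hs n
  have hsq := sq_cp hs n
  set M := ∫ g, Real.log (nF g) ^ 2 ∂P with hM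
  rw [← hYe]
  calc Real.log δ + c * (ell P m 1 - s * M - q / s)
      ≤ Real.log δ + (ell P m (n + 1) - (s / c) * (c ^ 2 * M) - (c / s) * q) := by
        rw [hell, ← hc]; apply le_of_eq; field_simp
    _ ≤ Real.log δ + (ell P m (n + 1) - (s / c) * (∫ g, Real.log (nF g) ^ 2 ∂(cp P (n + 1))) - (c / s) * ∫ p, F p ∂((cp P (n + 1)).prod m)) := by gcongr
    _ = ∫ p, (Real.log δ + (Real.log (N (sm p.1⁻¹ p.2)) - (s / c) * Real.log (nF p.1) ^ 2 - (c / s) * F p)) ∂((cp P (n + 1)).prod m) := by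
        have j1 : Integrable (fun p : SL2 × (ℂ × ℂ) => Real.log (N (sm p.1⁻¹ p.2)) - (s / c) * Real.log (nF p.1) ^ 2) ((cp P (n + 1)).prod m) := hL.sub (hX.const_mul _)
        have j2 : Integrable (fun p : SL2 × (ℂ × ℂ) => Real.log (N (sm p.1⁻¹ p.2)) - (s / c) * Real.log (nF p.1) ^ 2 - (c / s) * F p) ((cp P (n + 1)).prod m) := j1.sub (hFi.const_mul _)
        rw [integral_add (integrable_const _) j2, integral_sub j1 (hFi.const_mul _),
          integral_sub hL (hX.const_mul _), integral_const_mul, integral_const_mul, hXe]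
        simp [ell]
    _ ≤ _ := by
        refine integral_mono_ae ((integrable_const _).add ((hL.sub (hX.const_mul _)).sub (hFi.const_mul _))) ((int_logN hs (n + 1) hv).comp_fst m) ?_
        filter_upwards [ae_unit_snd hs (cp P (n + 1))] with p hp
        have e1 : wd (sm p.1 v) p.2 = wd v (sm p.1⁻¹ p.2) := by
          rw [← wd_sm p.1 v, sm_sm_inv]
        have e2 := wd_norm_le (sm p.1 v) p.2
        rw [hp.2, mul_one, e1] at e2
        have hX0 := log_nF_nonneg p.1
        have h1 := (abs_le.1 (abs_log_N_le p.1 hv)).1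
        have h2 := (abs_le.1 (abs_log_N_le p.1⁻¹ hp.2)).2
        rw [nF_inv] at h2
        have hld : Real.log δ ≤ 0 := Real.log_nonpos hδ.le hδ1
        have hpos : 0 ≤ s / c * Real.log (nF p.1) ^ 2 := by positivity
        simp only [hF]
        by_cases hpb : sm p.1⁻¹ p.2 ∈ b
        · rw [Set.indicator_of_mem hpb]
          have : s / c * Real.log (nF p.1) ^ 2 + c / s * 1 - 2 * Real.log (nF p.1) = (s * Real.log (nF p.1) - c) ^ 2 / (s * c) := by
            field_simp; ring
          have h5 : 0 ≤ (s * Real.log (nF p.1) - c) ^ 2 / (s * c) := by positivity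
          linarith
        · rw [Set.indicator_of_notMem hpb]
          have h3 : δ * N (sm p.1⁻¹ p.2) ≤ ‖wd v (sm p.1⁻¹ p.2)‖ := not_lt.1 hpb
          have h4 : 0 < N (sm p.1⁻¹ p.2) := N_pos (sm_ne (ne_of_N (by rw [hp.2]; exact one_pos)))
          have h5 := Real.log_le_log (by positivity) (h3.trans e2)
          rw [Real.log_mul hδ.ne' h4.ne'] at h5
          linarith

lemma log_pos_unif (hs : Sys P m) : ∃ n : ℕ, ∀ v, N v = 1 → 1 ≤ ∫ g, Real.log (N (sm g v)) ∂(cp P (n + 1)) := by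
  set M := ∫ g, Real.log (nF g) ^ 2 ∂P with hM
  have hM0 : 0 ≤ M := integral_nonneg fun g => by positivity
  have hl := ell_pos hs
  set l := ell P m 1 with hl0
  set s : ℝ := l / (4 * (M + 1)) with hs'
  have hs0 : 0 < s := by positivity
  obtain ⟨δ, hδ, hδ1, h⟩ := unif_null hs (ENNReal.ofReal (s * l / 4)) (by simp; positivity)
  obtain ⟨n, hn⟩ := exists_nat_ge ((1 - Real.log δ) / (l / 2))
  refine ⟨n, fun v hv => ?_⟩
  refine le_trans ?_ (log_low hs n hv hδ hδ1 (by positivity) hs0 h)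
  have h1 : s * M ≤ l / 4 := by
    rw [hs']; rw [div_mul_eq_mul_div, div_le_div_iff₀ (by positivity) (by positivity)]; nlinarith
  have h2 : s * l / 4 / s = l / 4 := by field_simp
  rw [h2, ← hM]
  rw [div_le_iff₀ (by positivity)] at hn
  nlinarith

/-- the contraction property -/
lemma exp_le_aux (t : ℝ) : Real.exp (-t) ≤ 1 - t + t ^ 2 * Real.exp |t| := by
  have h := Real.add_one_le_exp (|t|)
  have h0 : 0 ≤ |t| := abs_nonneg t
  by_cases ht : |t| ≤ 1
  · have h1 := Real.abs_exp_sub_one_sub_id_le (x := -t) (by rwa [abs_neg])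
    have h2 := (abs_le.1 h1).2
    have h3 : t ^ 2 * 1 ≤ t ^ 2 * Real.exp |t| := by gcongr; exact Real.one_le_exp h0
    nlinarith
  · push Not at ht
    have h1 : Real.exp (-t) ≤ Real.exp |t| := Real.exp_le_exp.2 (neg_le_abs t)
    have h2 : 1 ≤ t ^ 2 := by rw [← sq_abs]; nlinarith
    by_cases hp : 0 ≤ t
    · rw [abs_of_nonneg hp] at *
      have : Real.exp (-t) ≤ 1 := Real.exp_le_one_iff.2 (by linarith)
      have : t ^ 2 * (t + 1) ≤ t ^ 2 * Real.exp t := by gcongr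
      nlinarith
    · push Not at hp
      have : Real.exp |t| ≤ t ^ 2 * Real.exp |t| := le_mul_of_one_le_left (Real.exp_pos _).le h2
      linarith

/-- standing contraction hypotheses -/
structure Ctr (P : Measure SL2) (ε ρ : ℝ) : Prop where
  pos : 0 < ε
  le1 : ε ≤ 1
  rho0 : 0 < ρ
  rho : ρ < 1
  mom : Integrable (fun g => nF g ^ (4 * ε)) P
  ctr : ∀ v : ℂ × ℂ, v ≠ 0 → ∫ g, N (sm g v) ^ (-ε) ∂P ≤ ρ * N v ^ (-ε)

set_option maxHeartbeats 800000 in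
lemma exists_ctr (hs : Sys P m) : ∃ n ε ρ, Ctr (cp P (n + 1)) ε ρ := by
  obtain ⟨n, hn⟩ := log_pos_unif hs
  obtain ⟨ε₀, hε₀, hmom⟩ := exists_mom hs
  set Q := cp P (n + 1) with hQ
  have hmomQ := hmom (n + 1)
  obtain ⟨ε₁, hε₁⟩ : ∃ e, e = min ε₀ 1 := ⟨_, rfl⟩
  have hε₁0 : 0 < ε₁ := hε₁ ▸ lt_min hε₀ one_pos
  obtain ⟨M, hM⟩ : ∃ e, e = ∫ g, 4 / (ε₁ / 2) ^ 2 * nF g ^ ε₀ ∂Q := ⟨_, rfl⟩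
  have hM0 : 0 ≤ M := hM ▸ integral_nonneg fun g => by have := nF_nonneg g; positivity
  obtain ⟨ε, hε⟩ : ∃ e, e = min (ε₁ / 4) (1 / (2 * (M + 1))) := ⟨_, rfl⟩
  have hεp : 0 < ε := by rw [hε]; exact lt_min (by positivity) (by positivity)
  have hε4 : ε ≤ ε₁ / 4 := hε ▸ min_le_left _ _
  have hεM : ε * (2 * (M + 1)) ≤ 1 := by
    have : ε ≤ 1 / (2 * (M + 1)) := hε ▸ min_le_right _ _
    rwa [le_div_iff₀ (by positivity)] at this
  have h01 : ε₁ ≤ 1 := hε₁ ▸ min_le_right _ _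
  have h00 : ε₁ ≤ ε₀ := hε₁ ▸ min_le_left _ _
  have hmom4 : Integrable (fun g => nF g ^ (4 * ε)) Q := by
    refine Integrable.mono' hmomQ (Measurable.aestronglyMeasurable (by fun_prop)) (Eventually.of_forall fun g => ?_)
    rw [Real.norm_eq_abs, abs_of_nonneg (Real.rpow_nonneg (nF_nonneg g) _)]
    exact Real.rpow_le_rpow_of_exponent_le (one_le_nF g) (by linarith)
  refine ⟨n, ε, 1 - ε / 2, hεp, by linarith, by linarith, by linarith, hmom4, ?_⟩
  have key (v : ℂ × ℂ) (hv : N v = 1) : ∫ g, N (sm g v) ^ (-ε) ∂Q ≤ 1 - ε / 2 := by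
    have hi1 := int_logN hs (n + 1) hv
    have hvne : v ≠ 0 := ne_of_N (by rw [hv]; exact one_pos)
    have j1 : Integrable (fun g => 1 - ε * Real.log (N (sm g v))) Q := (integrable_const _).sub (hi1.const_mul _)
    calc _ ≤ ∫ g, ((1 - ε * Real.log (N (sm g v))) + ε ^ 2 * (4 / (ε₁ / 2) ^ 2 * nF g ^ ε₀)) ∂Q := by
          refine integral_mono_of_nonneg (Eventually.of_forall fun g => Real.rpow_nonneg (N_nonneg _) _)
            (j1.add ((hmomQ.const_mul _).const_mul _)) (Eventually.of_forall fun g => ?_)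
          have hN := N_pos (sm_ne (g := g) hvne)
          have h1 := exp_le_aux (ε * Real.log (N (sm g v)))
          have h2 := abs_log_N_le g hv
          have hX := log_nF_nonneg g
          simp only
          rw [Real.rpow_def_of_pos hN, show Real.log (N (sm g v)) * -ε = -(ε * Real.log (N (sm g v))) by ring]
          refine h1.trans ?_
          have h3 : (ε * Real.log (N (sm g v))) ^ 2 ≤ ε ^ 2 * Real.log (nF g) ^ 2 := by
            rw [mul_pow]; gcongr ε ^ 2 * ?_
            rw [← sq_abs]; gcongr
          have h4 : Real.exp |ε * Real.log (N (sm g v))| ≤ nF g ^ (ε₁ / 2) := by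
            rw [Real.rpow_def_of_pos (nF_pos g), abs_mul, abs_of_pos hεp]
            apply Real.exp_le_exp.2
            calc _ ≤ ε * Real.log (nF g) := mul_le_mul_of_nonneg_left h2 hεp.le
              _ ≤ (ε₁ / 2) * Real.log (nF g) := by gcongr; linarith
              _ = _ := by ring
          have h5 := log_le_pow (nF g) (ε₁ / 2) (one_le_nF g) (by positivity)
          have h6 : nF g ^ (ε₁ / 2) * nF g ^ (ε₁ / 2) ≤ nF g ^ ε₀ := by
            rw [← Real.rpow_add (nF_pos g)]
            exact Real.rpow_le_rpow_of_exponent_le (one_le_nF g) (by linarith)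
          have h7 : 0 ≤ nF g ^ (ε₁ / 2) := Real.rpow_nonneg (nF_nonneg g) _
          gcongr 1 - _ + ?_
          calc _ ≤ (ε ^ 2 * Real.log (nF g) ^ 2) * nF g ^ (ε₁ / 2) := mul_le_mul h3 h4 (Real.exp_pos _).le (by positivity)
            _ ≤ (ε ^ 2 * (4 / (ε₁ / 2) ^ 2 * nF g ^ (ε₁ / 2))) * nF g ^ (ε₁ / 2) := by gcongr
            _ = ε ^ 2 * (4 / (ε₁ / 2) ^ 2 * (nF g ^ (ε₁ / 2) * nF g ^ (ε₁ / 2))) := by ring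
            _ ≤ _ := by gcongr
      _ = 1 - ε * (∫ g, Real.log (N (sm g v)) ∂Q) + ε ^ 2 * M := by
          rw [integral_add j1 ((hmomQ.const_mul _).const_mul _),
            integral_sub (integrable_const _) (hi1.const_mul _), integral_const_mul, integral_const_mul, ← hM]
          simp [hQ]
      _ ≤ 1 - ε * 1 + ε ^ 2 * M := by gcongr; exact hn v hv
      _ ≤ _ := by nlinarith
  intro v hv
  have hp := N_pos hv
  have h1 : N ((((N v)⁻¹ : ℝ) : ℂ) • v) = 1 := by
    rw [N_smul]; simp [abs_of_pos hp, hp.ne']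
  have h2 := key _ h1
  have h3 : ∀ g, N (sm g ((((N v)⁻¹ : ℝ) : ℂ) • v)) ^ (-ε) = N v ^ ε * N (sm g v) ^ (-ε) := by
    intro g
    rw [sm_smul, N_smul, Complex.norm_real, Real.norm_eq_abs, abs_of_pos (inv_pos.2 hp), Real.mul_rpow (inv_pos.2 hp).le (N_nonneg _),
      Real.inv_rpow hp.le, Real.rpow_neg hp.le, inv_inv]
  simp only [h3] at h2
  rw [integral_const_mul] at h2
  rw [Real.rpow_neg hp.le, ← div_eq_mul_inv, le_div_iff₀ (by positivity)]
  linarith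
end

open MeasureTheory Filter
noncomputable section

/-! ### The renewal measure -/

variable {P : Measure SL2} [IsProbabilityMeasure P]

def Ur (P : Measure SL2) [IsProbabilityMeasure P] : Measure SL2 := Measure.sum (fun n => cp P n)

instance : SFinite (Ur P) := by unfold Ur; infer_instance

lemma super_lint (u q : SL2 → ENNReal) (hu : Measurable u) (hq : Measurable q)
    (h : ∀ x, ∫⁻ y, u (y * x) ∂P + q x ≤ u x) : ∫⁻ g, q g ∂(Ur P) ≤ u 1 := by
  unfold Ur
  rw [lintegral_sum_measure]
  have step (n : ℕ) : ∫⁻ g, q g ∂(cp P n) + ∫⁻ g, u g ∂(cp P (n + 1)) ≤ ∫⁻ g, u g ∂(cp P n) := by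
    rw [lint_succ' hu n, lintegral_lintegral_swap (Measurable.aemeasurable (by fun_prop)),
      ← lintegral_add_left hq]
    refine lintegral_mono fun x => ?_
    rw [add_comm]; exact h x
  have part (n : ℕ) : ∑ i ∈ Finset.range n, ∫⁻ g, q g ∂(cp P i) + ∫⁻ g, u g ∂(cp P n) ≤ u 1 := by
    induction n with
    | zero => simp [lint_zero hu]
    | succ n ih =>
      rw [Finset.sum_range_succ, add_assoc]
      exact (add_le_add_right (step n) _).trans ih
  rw [ENNReal.tsum_eq_iSup_nat]
  exact iSup_le fun n => le_self_add.trans (part n)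

lemma super (u q : SL2 → ℝ) (hu : Measurable u) (hq : Measurable q) (hu0 : ∀ x, 0 ≤ u x) (hq0 : ∀ x, 0 ≤ q x)
    (hi : ∀ x, Integrable (fun y => u (y * x)) P)
    (h : ∀ x, ∫ y, u (y * x) ∂P + q x ≤ u x) : Integrable q (Ur P) ∧ ∫ g, q g ∂(Ur P) ≤ u 1 := by
  have key := super_lint (P := P) (fun x => ENNReal.ofReal (u x)) (fun x => ENNReal.ofReal (q x)) (by fun_prop) (by fun_prop) (by
    intro x
    rw [← ofReal_integral_eq_lintegral_ofReal (hi x) (Eventually.of_forall fun y => hu0 _),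
      ← ENNReal.ofReal_add (integral_nonneg fun y => hu0 _) (hq0 x)]
    exact ENNReal.ofReal_le_ofReal (h x))
  refine ⟨integrable_of_lint hq hq0 (key.trans_lt ENNReal.ofReal_lt_top), ?_⟩
  rw [integral_eq_lintegral_of_nonneg_ae (Eventually.of_forall hq0) hq.aestronglyMeasurable]
  exact ENNReal.toReal_le_of_le_ofReal (hu0 1) key

lemma Ur_eq : Ur P = Measure.dirac 1 + Measure.mconv (Ur P) P := by
  refine Measure.ext_of_lintegral _ fun f hf => ?_
  rw [lintegral_add_measure, lintegral_dirac, Measure.lintegral_mconv hf]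
  unfold Ur
  rw [lintegral_sum_measure, lintegral_sum_measure, tsum_eq_zero_add' ENNReal.summable]
  congr 1
  · exact lint_zero hf
  · congr 1; ext n
    exact lint_succ hf n

lemma Ur_integral {f : SL2 → ℝ} (hf : Integrable f (Ur P)) :
    ∫ g, f g ∂(Ur P) = f 1 + ∫ h, ∫ g, f (g * h) ∂(Ur P) ∂P := by
  rw [Ur_eq] at hf
  have h1 := hf.left_of_add_measure
  have h2 := hf.right_of_add_measure
  conv_lhs => rw [Ur_eq]
  rw [integral_add_measure h1 h2, integral_dirac, integral_mconv h2, integral_integral_swap]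
  exact (integrable_map_measure h2.1 (by fun_prop)).1 h2

/-! ### one-step estimates -/

def ph (ε : ℝ) (v : ℂ × ℂ) : ℝ := N v ^ (-ε)
def um (ε : ℝ) (v : ℂ × ℂ) : ℝ := ph ε v / (1 + ph ε v)
def mm (ε : ℝ) (v : ℂ × ℂ) : ℝ := ph ε v / (1 + ph ε v) ^ 2

lemma ph_nonneg (ε v) : 0 ≤ ph ε v := Real.rpow_nonneg (N_nonneg v) _
@[fun_prop] lemma meas_ph (ε) : Measurable (ph ε) := by unfold ph; fun_prop
@[fun_prop] lemma meas_um (ε) : Measurable (um ε) := by unfold um; fun_prop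
@[fun_prop] lemma meas_mm (ε) : Measurable (mm ε) := by unfold mm; fun_prop
lemma um_nonneg (ε v) : 0 ≤ um ε v := by have := ph_nonneg ε v; unfold um; positivity
lemma mm_nonneg (ε v) : 0 ≤ mm ε v := by have := ph_nonneg ε v; unfold mm; positivity
lemma um_le (ε v) : um ε v ≤ 1 := by
  have := ph_nonneg ε v; unfold um; rw [div_le_one (by positivity)]; linarith

lemma int_rpow {ε ρ : ℝ} (hc : Ctr P ε ρ) {s : ℝ} (hs : s ≤ 4 * ε) : Integrable (fun g => nF g ^ s) P := by
  refine Integrable.mono' hc.mom (Measurable.aestronglyMeasurable (by fun_prop)) (Eventually.of_forall fun g => ?_)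
  rw [Real.norm_eq_abs, abs_of_nonneg (Real.rpow_nonneg (nF_nonneg g) _)]
  exact Real.rpow_le_rpow_of_exponent_le (one_le_nF g) hs

lemma ph_sm_le {ε : ℝ} (he : 0 ≤ ε) (g : SL2) {v : ℂ × ℂ} (hv : v ≠ 0) : ph ε (sm g v) ≤ nF g ^ ε * ph ε v := by
  have h1 := N_le_sm g v
  have hp := N_pos hv
  have hp' := N_pos (sm_ne (g := g) hv)
  unfold ph
  rw [Real.rpow_neg hp.le, Real.rpow_neg hp'.le, ← div_eq_mul_inv, inv_eq_one_div, div_le_div_iff₀ (by positivity) (by positivity), one_mul,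
    ← Real.mul_rpow (nF_nonneg g) hp'.le]
  exact Real.rpow_le_rpow hp.le (by linarith) he

lemma int_ph {ε ρ : ℝ} (hc : Ctr P ε ρ) {v : ℂ × ℂ} (hv : v ≠ 0) : Integrable (fun g => ph ε (sm g v)) P := by
  refine Integrable.mono' ((int_rpow hc (s := ε) (by linarith [hc.pos])).mul_const (ph ε v)) (Measurable.aestronglyMeasurable (by fun_prop))
    (Eventually.of_forall fun g => ?_)
  rw [Real.norm_eq_abs, abs_of_nonneg (ph_nonneg _ _)]
  exact ph_sm_le hc.pos.le g hv

lemma int_um {ε : ℝ} (v : ℂ × ℂ) : Integrable (fun g => um ε (sm g v)) P := by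
  refine Integrable.mono' (integrable_const 1) (Measurable.aestronglyMeasurable (by fun_prop)) (Eventually.of_forall fun g => ?_)
  rw [Real.norm_eq_abs, abs_of_nonneg (um_nonneg _ _)]
  exact um_le _ _

lemma um_step {ε ρ : ℝ} (hc : Ctr P ε ρ) {v : ℂ × ℂ} (hv : v ≠ 0) :
    ∫ g, um ε (sm g v) ∂P + (1 - ρ) * mm ε v ≤ um ε v := by
  have hp := ph_nonneg ε v
  have hr := hc.rho0
  have hr1 := hc.rho
  have hctr : ∫ g, ph ε (sm g v) ∂P ≤ ρ * ph ε v := hc.ctr v hv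
  set t0 := ρ * ph ε v with ht0
  have ht : 0 ≤ t0 := by positivity
  have h1 : ∫ g, um ε (sm g v) ∂P ≤ t0 / (1 + t0) := by
    calc _ ≤ ∫ g, (t0 / (1 + t0) + ((1 + t0) ^ 2)⁻¹ * (ph ε (sm g v) - t0)) ∂P := by
          refine integral_mono (int_um v) ((integrable_const _).add (((int_ph hc hv).sub (integrable_const _)).const_mul _)) fun g => ?_
          have h0 := ph_nonneg ε (sm g v)
          simp only [um]
          set t := ph ε (sm g v)
          have : t0 / (1 + t0) + ((1 + t0) ^ 2)⁻¹ * (t - t0) - t / (1 + t) = (t - t0) ^ 2 / ((1 + t0) ^ 2 * (1 + t)) := by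
            field_simp; ring
          have h5 : 0 ≤ (t - t0) ^ 2 / ((1 + t0) ^ 2 * (1 + t)) := by positivity
          linarith
      _ = t0 / (1 + t0) + ((1 + t0) ^ 2)⁻¹ * (∫ g, ph ε (sm g v) ∂P - t0) := by
          have j1 : Integrable (fun g => ph ε (sm g v) - t0) P := (int_ph hc hv).sub (integrable_const _)
          rw [integral_add (integrable_const _) (j1.const_mul _), integral_const_mul,
            integral_sub (int_ph hc hv) (integrable_const _)]
          simp
      _ ≤ _ := by
          have : ((1 + t0) ^ 2)⁻¹ * (∫ g, ph ε (sm g v) ∂P - t0) ≤ 0 :=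
            mul_nonpos_of_nonneg_of_nonpos (by positivity) (by linarith)
          linarith
  have h2 : t0 / (1 + t0) + (1 - ρ) * mm ε v ≤ um ε v := by
    simp only [mm, um, ht0]
    set φ := ph ε v
    have : φ / (1 + φ) - ρ * φ / (1 + ρ * φ) - (1 - ρ) * (φ / (1 + φ) ^ 2) = (1 - ρ) ^ 2 * φ ^ 2 / ((1 + φ) ^ 2 * (1 + ρ * φ)) := by
      field_simp; ring
    have h5 : 0 ≤ (1 - ρ) ^ 2 * φ ^ 2 / ((1 + φ) ^ 2 * (1 + ρ * φ)) := by positivity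
    linarith
  linarith

lemma mm_U {ε ρ : ℝ} (hc : Ctr P ε ρ) {v : ℂ × ℂ} (hv : v ≠ 0) :
    Integrable (fun g => mm ε (sm g v)) (Ur P) ∧ ∫ g, mm ε (sm g v) ∂(Ur P) ≤ 1 / (1 - ρ) := by
  have hr : 0 < 1 - ρ := by linarith [hc.rho]
  have h := super (P := P) (fun g => um ε (sm g v)) (fun g => (1 - ρ) * mm ε (sm g v)) (by fun_prop) (by fun_prop)
    (fun x => um_nonneg _ _) (fun x => mul_nonneg hr.le (mm_nonneg _ _))
    (fun x => by simp only [sm_mul]; exact int_um _)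
    (fun x => by simp only [sm_mul]; exact um_step hc (sm_ne hv))
  have h1 := h.1.const_mul (1 - ρ)⁻¹
  have e : (fun g => (1 - ρ)⁻¹ * ((1 - ρ) * mm ε (sm g v))) = fun g => mm ε (sm g v) := by
    ext g; field_simp
  rw [e] at h1
  refine ⟨h1, ?_⟩
  have h2 := h.2
  rw [integral_const_mul] at h2
  rw [le_div_iff₀ hr]
  have := um_le ε (sm 1 v)
  linarith
end

open MeasureTheory Filter
noncomputable section

/-! ### pair estimates -/

variable {P : Measure SL2} [IsProbabilityMeasure P]

def dd (v w : ℂ × ℂ) : ℝ := ‖wd v w‖ / (N v * N w)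
def LL (v w : ℂ × ℂ) : ℝ := |Real.log (N v) - Real.log (N w)|

lemma dd_nonneg (v w) : 0 ≤ dd v w := div_nonneg (norm_nonneg _) (mul_nonneg (N_nonneg _) (N_nonneg _))
lemma LL_nonneg (v w) : 0 ≤ LL v w := abs_nonneg _
@[fun_prop] lemma meas_dd {α : Type*} [MeasurableSpace α] {f g : α → ℂ × ℂ} (hf : Measurable f) (hg : Measurable g) :
    Measurable fun a => dd (f a) (g a) := by unfold dd; fun_prop
@[fun_prop] lemma meas_LL {α : Type*} [MeasurableSpace α] {f g : α → ℂ × ℂ} (hf : Measurable f) (hg : Measurable g) :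
    Measurable fun a => LL (f a) (g a) := by
  unfold LL
  have : Measurable fun a => Real.log (N (f a)) - Real.log (N (g a)) := by fun_prop
  exact this.abs

def vp (v : ℂ × ℂ) : ℂ × ℂ := (-(starRingEnd ℂ) v.2, (starRingEnd ℂ) v.1)
lemma N_vp (v) : N (vp v) = N v := by
  simp [N, N2, vp, Complex.normSq_conj, add_comm]

lemma decomp (v w : ℂ × ℂ) : ((N v ^ 2 : ℝ) : ℂ) • w = (- wd (vp v) w) • v + wd v w • vp v := by
  have h1 : ((N v ^ 2 : ℝ) : ℂ) = v.1 * (starRingEnd ℂ) v.1 + v.2 * (starRingEnd ℂ) v.2 := by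
    rw [N_sq, Complex.mul_conj, Complex.mul_conj]
    simp [N2, Complex.normSq_eq_norm_sq]
  rw [h1]
  ext <;> simp [wd, vp] <;> ring

lemma N_pair_le (g : SL2) {v : ℂ × ℂ} (w : ℂ × ℂ) (hv : v ≠ 0) : N v * N (sm g w) ≤ N w * N (sm g v) + ‖wd v w‖ * nF g := by
  have hp := N_pos hv
  have h1 : ((N v ^ 2 : ℝ) : ℂ) • sm g w = (- wd (vp v) w) • sm g v + wd v w • sm g (vp v) := by
    rw [← sm_smul, ← sm_smul, ← sm_smul, ← sm_add, decomp]
  have h2 := N_add_le ((- wd (vp v) w) • sm g v) (wd v w • sm g (vp v))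
  rw [← h1, N_smul, N_smul, N_smul, norm_neg, Complex.norm_real, Real.norm_eq_abs, abs_of_nonneg (by positivity)] at h2
  have h3 := wd_norm_le (vp v) w
  have h4 := N_sm_le g (vp v)
  rw [N_vp] at h3 h4
  have h5 := mul_le_mul_of_nonneg_right h3 (N_nonneg (sm g v))
  have h6 := mul_le_mul_of_nonneg_left h4 (norm_nonneg (wd v w))
  have h7 : N v * (N v * N (sm g w)) ≤ N v * (N w * N (sm g v) + ‖wd v w‖ * nF g) := by nlinarith
  exact le_of_mul_le_mul_left h7 hp

lemma log_pair_le (g : SL2) {v w : ℂ × ℂ} (hv : v ≠ 0) (hw : w ≠ 0) :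
    (Real.log (N (sm g w)) - Real.log (N w)) - (Real.log (N (sm g v)) - Real.log (N v)) ≤ nF g ^ 2 * dd v w := by
  have h := N_pair_le g w hv
  have p1 := N_pos hv
  have p2 := N_pos hw
  have p3 := N_pos (sm_ne (g := g) hv)
  have p4 := N_pos (sm_ne (g := g) hw)
  have h1 : N v ≤ nF g * N (sm g v) := N_le_sm g v
  have hF := nF_pos g
  have key : N v * N (sm g w) ≤ N w * N (sm g v) * (1 + nF g ^ 2 * dd v w) := by
    have e : N w * N (sm g v) * (nF g ^ 2 * dd v w) = ‖wd v w‖ * nF g * (nF g * N (sm g v) / N v) := by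
      unfold dd; field_simp
    have h2 : 1 ≤ nF g * N (sm g v) / N v := by rw [le_div_iff₀ p1]; linarith
    have h3 := le_mul_of_one_le_right (mul_nonneg (norm_nonneg (wd v w)) hF.le) h2
    rw [mul_add, e]; linarith
  have hd := dd_nonneg v w
  have hlog := Real.log_le_log (by positivity) key
  rw [Real.log_mul p1.ne' p4.ne', Real.log_mul (by positivity) (by positivity), Real.log_mul p2.ne' p3.ne'] at hlog
  have h4 := Real.log_le_sub_one_of_pos (show 0 < 1 + nF g ^ 2 * dd v w by positivity)
  linarith

lemma dd_comm (v w) : dd v w = dd w v := by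
  unfold dd; rw [wd_comm, norm_neg, mul_comm]

lemma LL_step (g : SL2) {v w : ℂ × ℂ} (hv : v ≠ 0) (hw : w ≠ 0) : LL (sm g v) (sm g w) ≤ LL v w + nF g ^ 2 * dd v w := by
  have h1 := log_pair_le g hv hw
  have h2 := log_pair_le g hw hv
  rw [dd_comm] at h2
  unfold LL
  have h3 := neg_abs_le (Real.log (N v) - Real.log (N w))
  have h4 := le_abs_self (Real.log (N v) - Real.log (N w))
  rw [abs_le]; constructor <;> linarith

lemma dd_sm (g : SL2) {v w : ℂ × ℂ} (hv : v ≠ 0) (hw : w ≠ 0) {κ : ℝ} :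
    dd (sm g v) (sm g w) ^ κ = dd v w ^ κ * (N v ^ κ * N w ^ κ) * (N (sm g v) ^ (-κ) * N (sm g w) ^ (-κ)) := by
  have p1 := N_pos hv
  have p2 := N_pos hw
  have p3 := N_pos (sm_ne (g := g) hv)
  have p4 := N_pos (sm_ne (g := g) hw)
  unfold dd
  rw [wd_sm, Real.div_rpow (norm_nonneg _) (by positivity), Real.div_rpow (norm_nonneg _) (by positivity),
    Real.mul_rpow p1.le p2.le, Real.mul_rpow p3.le p4.le, Real.rpow_neg p3.le, Real.rpow_neg p4.le]
  have := Real.rpow_pos_of_pos p1 κ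
  have := Real.rpow_pos_of_pos p2 κ
  have := Real.rpow_pos_of_pos p3 κ
  have := Real.rpow_pos_of_pos p4 κ
  field_simp

lemma dd_step {ε ρ : ℝ} (hc : Ctr P ε ρ) {v w : ℂ × ℂ} (hv : v ≠ 0) (hw : w ≠ 0) :
    Integrable (fun g => dd (sm g v) (sm g w) ^ (ε / 2)) P ∧
    ∫ g, dd (sm g v) (sm g w) ^ (ε / 2) ∂P ≤ ρ * dd v w ^ (ε / 2) := by
  have p1 := N_pos hv
  have p2 := N_pos hw
  set κ := ε / 2 with hκ
  have q1 := Real.rpow_pos_of_pos p1 κ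
  have q2 := Real.rpow_pos_of_pos p2 κ
  have hd : 0 ≤ dd v w ^ κ := Real.rpow_nonneg (dd_nonneg _ _) _
  set x := N v ^ κ with hx
  set y := N w ^ κ with hy
  have hb (g : SL2) : dd (sm g v) (sm g w) ^ κ ≤ dd v w ^ κ * (1 / 2) * (x ^ 2 * ph ε (sm g v) + y ^ 2 * ph ε (sm g w)) := by
    rw [dd_sm g hv hw]
    have e (u : ℂ × ℂ) (hu : u ≠ 0) : ph ε u = (N u ^ (-κ)) ^ 2 := by
      unfold ph; rw [← Real.rpow_natCast, ← Real.rpow_mul (N_nonneg u)]; congr 1; rw [hκ]; push_cast; ring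
    rw [e _ (sm_ne hv), e _ (sm_ne hw)]
    set a := N (sm g v) ^ (-κ)
    set b := N (sm g w) ^ (-κ)
    have : dd v w ^ κ * (1 / 2) * (x ^ 2 * a ^ 2 + y ^ 2 * b ^ 2) - dd v w ^ κ * (x * y) * (a * b) = dd v w ^ κ * (1 / 2) * (x * a - y * b) ^ 2 := by ring
    have h5 : 0 ≤ dd v w ^ κ * (1 / 2) * (x * a - y * b) ^ 2 := by positivity
    linarith
  have j1 : Integrable (fun g => x ^ 2 * ph ε (sm g v)) P := (int_ph hc hv).const_mul _
  have j2 : Integrable (fun g => y ^ 2 * ph ε (sm g w)) P := (int_ph hc hw).const_mul _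
  have j3 : Integrable (fun g => dd v w ^ κ * (1 / 2) * (x ^ 2 * ph ε (sm g v) + y ^ 2 * ph ε (sm g w))) P := (j1.add j2).const_mul _
  constructor
  · refine Integrable.mono' j3 (Measurable.aestronglyMeasurable (by fun_prop)) (Eventually.of_forall fun g => ?_)
    rw [Real.norm_eq_abs, abs_of_nonneg (Real.rpow_nonneg (dd_nonneg _ _) _)]
    exact hb g
  · calc _ ≤ ∫ g, dd v w ^ κ * (1 / 2) * (x ^ 2 * ph ε (sm g v) + y ^ 2 * ph ε (sm g w)) ∂P :=
          integral_mono_of_nonneg (Eventually.of_forall fun g => Real.rpow_nonneg (dd_nonneg _ _) _) j3 (Eventually.of_forall hb)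
      _ = dd v w ^ κ * (1 / 2) * (x ^ 2 * (∫ g, ph ε (sm g v) ∂P) + y ^ 2 * ∫ g, ph ε (sm g w) ∂P) := by
          rw [integral_const_mul, integral_add j1 j2, integral_const_mul, integral_const_mul]
      _ ≤ dd v w ^ κ * (1 / 2) * (x ^ 2 * (ρ * N v ^ (-ε)) + y ^ 2 * (ρ * N w ^ (-ε))) := by
          gcongr
          · exact hc.ctr v hv
          · exact hc.ctr w hw
      _ = _ := by
          have e (u : ℂ × ℂ) (hu : u ≠ 0) : N u ^ (-ε) = ((N u ^ κ) ^ 2)⁻¹ := by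
            rw [Real.rpow_neg (N_nonneg u), ← Real.rpow_natCast, ← Real.rpow_mul (N_nonneg u)]; congr 2; rw [hκ]; push_cast; ring
          rw [e v hv, e w hw, ← hx, ← hy]
          field_simp; ring

def Wc (P : Measure SL2) (ε ρ : ℝ) : ℝ := 1 + 2 * (∫ g, nF g ^ ε ∂P) / (1 - ρ)

lemma Wc_pos {ε ρ : ℝ} (hc : Ctr P ε ρ) : 0 < Wc P ε ρ := by
  have : 0 < 1 - ρ := by linarith [hc.rho]
  have h2 : 0 ≤ ∫ g, nF g ^ ε ∂P := integral_nonneg fun g => Real.rpow_nonneg (nF_nonneg g) _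
  unfold Wc; positivity

def WW (ε B : ℝ) (v w : ℂ × ℂ) : ℝ := LL v w ^ (ε / 2) * (um ε v + um ε w) + B * dd v w ^ (ε / 2)
def qq (ε : ℝ) (v w : ℂ × ℂ) : ℝ := LL v w ^ (ε / 2) * (mm ε v + mm ε w) + dd v w ^ (ε / 2)

lemma WW_step {ε ρ : ℝ} (hc : Ctr P ε ρ) {v w : ℂ × ℂ} (hv : v ≠ 0) (hw : w ≠ 0) :
    Integrable (fun g => WW ε (Wc P ε ρ) (sm g v) (sm g w)) P ∧
    ∫ g, WW ε (Wc P ε ρ) (sm g v) (sm g w) ∂P + (1 - ρ) * qq ε v w ≤ WW ε (Wc P ε ρ) v w := by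
  have hB := Wc_pos hc
  set B := Wc P ε ρ with hBd
  have hr : 0 < 1 - ρ := by linarith [hc.rho]
  have he := hc.pos
  have he1 := hc.le1
  obtain ⟨i1, i2⟩ := dd_step hc hv hw
  set l := LL v w ^ (ε / 2) with hl
  set d := dd v w ^ (ε / 2) with hd
  have hl0 : 0 ≤ l := Real.rpow_nonneg (LL_nonneg _ _) _
  have hd0 : 0 ≤ d := Real.rpow_nonneg (dd_nonneg _ _) _
  have hb (g : SL2) : WW ε B (sm g v) (sm g w) ≤ l * (um ε (sm g v) + um ε (sm g w)) + (2 * d * nF g ^ ε + B * dd (sm g v) (sm g w) ^ (ε / 2)) := by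
    unfold WW
    have h1 : LL (sm g v) (sm g w) ^ (ε / 2) ≤ l + nF g ^ ε * d := by
      calc _ ≤ (LL v w + nF g ^ 2 * dd v w) ^ (ε / 2) := Real.rpow_le_rpow (LL_nonneg _ _) (LL_step g hv hw) (by positivity)
        _ ≤ LL v w ^ (ε / 2) + (nF g ^ 2 * dd v w) ^ (ε / 2) :=
            Real.rpow_add_le_add_rpow (LL_nonneg _ _) (mul_nonneg (by positivity) (dd_nonneg _ _)) (by positivity) (by linarith)
        _ = _ := by
            rw [Real.mul_rpow (by positivity) (dd_nonneg _ _), ← Real.rpow_natCast, ← Real.rpow_mul (nF_nonneg g)]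
            congr 3; push_cast; ring
    have u1 := um_le ε (sm g v)
    have u2 := um_le ε (sm g w)
    have u3 := um_nonneg ε (sm g v)
    have u4 := um_nonneg ε (sm g w)
    have h2 := mul_le_mul_of_nonneg_right h1 (add_nonneg u3 u4)
    have h3 : 0 ≤ nF g ^ ε * d := mul_nonneg (Real.rpow_nonneg (nF_nonneg g) _) hd0
    nlinarith
  have j1 : Integrable (fun g => l * (um ε (sm g v) + um ε (sm g w))) P := ((int_um v).add (int_um w)).const_mul _
  have j2 : Integrable (fun g => 2 * d * nF g ^ ε) P := (int_rpow hc (s := ε) (by linarith)).const_mul _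
  have j3 : Integrable (fun g => B * dd (sm g v) (sm g w) ^ (ε / 2)) P := i1.const_mul _
  have j4 : Integrable (fun g => 2 * d * nF g ^ ε + B * dd (sm g v) (sm g w) ^ (ε / 2)) P := j2.add j3
  have h0 (v w : ℂ × ℂ) : 0 ≤ WW ε B v w := by
    unfold WW
    have u3 := um_nonneg ε v
    have u4 := um_nonneg ε w
    have := Real.rpow_nonneg (LL_nonneg v w) (ε / 2)
    have := Real.rpow_nonneg (dd_nonneg v w) (ε / 2)
    positivity
  have j5 := j1.add j4
  constructor
  · refine Integrable.mono' j5 (Measurable.aestronglyMeasurable (by unfold WW; fun_prop)) (Eventually.of_forall fun g => ?_)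
    rw [Real.norm_eq_abs, abs_of_nonneg (h0 _ _)]
    exact hb g
  · have k1 : ∫ g, WW ε B (sm g v) (sm g w) ∂P ≤ l * (∫ g, um ε (sm g v) ∂P + ∫ g, um ε (sm g w) ∂P) + (2 * d * (∫ g, nF g ^ ε ∂P) + B * (ρ * d)) := by
      calc _ ≤ ∫ g, (l * (um ε (sm g v) + um ε (sm g w)) + (2 * d * nF g ^ ε + B * dd (sm g v) (sm g w) ^ (ε / 2))) ∂P :=
            integral_mono_of_nonneg (Eventually.of_forall fun g => h0 _ _) j5 (Eventually.of_forall hb)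
        _ = l * (∫ g, um ε (sm g v) ∂P + ∫ g, um ε (sm g w) ∂P) + (2 * d * (∫ g, nF g ^ ε ∂P) + B * ∫ g, dd (sm g v) (sm g w) ^ (ε / 2) ∂P) := by
            rw [integral_add j1 j4, integral_add j2 j3, integral_const_mul, integral_const_mul, integral_const_mul, integral_add (int_um v) (int_um w)]
        _ ≤ _ := by gcongr
    have s1 := um_step hc hv
    have s2 := um_step hc hw
    have hBe : B * (1 - ρ) = (1 - ρ) + 2 * (∫ g, nF g ^ ε ∂P) := by
      rw [hBd]; unfold Wc; field_simp
    have s3 := mul_le_mul_of_nonneg_left (add_le_add s1 s2) hl0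
    have eq1 : qq ε v w = l * (mm ε v + mm ε w) + d := rfl
    have eq2 : WW ε B v w = l * (um ε v + um ε w) + B * d := rfl
    rw [eq1, eq2]
    have s4 : (B * (1 - ρ)) * d = ((1 - ρ) + 2 * (∫ g, nF g ^ ε ∂P)) * d := by rw [hBe]
    linarith

lemma qq_U {ε ρ : ℝ} (hc : Ctr P ε ρ) {v w : ℂ × ℂ} (hv : v ≠ 0) (hw : w ≠ 0) :
    Integrable (fun g => qq ε (sm g v) (sm g w)) (Ur P) ∧
    ∫ g, qq ε (sm g v) (sm g w) ∂(Ur P) ≤ (2 * LL v w ^ (ε / 2) + Wc P ε ρ * dd v w ^ (ε / 2)) / (1 - ρ) := by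
  have hr : 0 < 1 - ρ := by linarith [hc.rho]
  have hB := Wc_pos hc
  have hq0 (v w) : 0 ≤ qq ε v w := by
    unfold qq
    have u3 := mm_nonneg ε v
    have u4 := mm_nonneg ε w
    have := Real.rpow_nonneg (LL_nonneg v w) (ε / 2)
    have := Real.rpow_nonneg (dd_nonneg v w) (ε / 2)
    positivity
  have h0 (v w : ℂ × ℂ) : 0 ≤ WW ε (Wc P ε ρ) v w := by
    unfold WW
    have u3 := um_nonneg ε v
    have u4 := um_nonneg ε w
    have := Real.rpow_nonneg (LL_nonneg v w) (ε / 2)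
    have := Real.rpow_nonneg (dd_nonneg v w) (ε / 2)
    positivity
  have h := super (P := P) (fun g => WW ε (Wc P ε ρ) (sm g v) (sm g w)) (fun g => (1 - ρ) * qq ε (sm g v) (sm g w))
    (by unfold WW; fun_prop) (by unfold qq; fun_prop)
    (fun x => h0 _ _) (fun x => mul_nonneg hr.le (hq0 _ _))
    (fun x => by simp only [sm_mul]; exact (WW_step hc (sm_ne hv) (sm_ne hw)).1)
    (fun x => by simp only [sm_mul]; exact (WW_step hc (sm_ne hv) (sm_ne hw)).2)
  have h1 := h.1.const_mul (1 - ρ)⁻¹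
  have e : (fun g => (1 - ρ)⁻¹ * ((1 - ρ) * qq ε (sm g v) (sm g w))) = fun g => qq ε (sm g v) (sm g w) := by
    ext g; field_simp
  rw [e] at h1
  refine ⟨h1, ?_⟩
  have h2 := h.2
  rw [integral_const_mul, sm_one, sm_one] at h2
  rw [le_div_iff₀ hr]
  have u1 := um_le ε v
  have u2 := um_le ε w
  have := Real.rpow_nonneg (LL_nonneg v w) (ε / 2)
  unfold WW at h2
  nlinarith
end

open MeasureTheory Filter
noncomputable section

/-! ### Renewal potentials of admissible functions -/

variable {P : Measure SL2} [IsProbabilityMeasure P]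

structure Adm (ε C : ℝ) (f : ℂ × ℂ → ℝ) : Prop where
  cont : ContinuousOn f {0}ᶜ
  phase : ∀ c : ℂ, ‖c‖ = 1 → ∀ v, f (c • v) = f v
  up : ∀ v, v ≠ 0 → |f v| ≤ C * N v ^ (2 * ε)
  dn : ∀ v, v ≠ 0 → |f v| ≤ C * N v ^ (-(2 * ε))

def Gr (P : Measure SL2) [IsProbabilityMeasure P] (f : ℂ × ℂ → ℝ) (v : ℂ × ℂ) : ℝ := ∫ g, f (sm g v) ∂(Ur P)

variable {ε ρ C : ℝ} {f : ℂ × ℂ → ℝ}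

lemma Adm.meas (h : Adm ε C f) : Measurable f := measurable_of_continuousOn_compl_singleton 0 h.cont

lemma ph_pos (ε) {v : ℂ × ℂ} (hv : v ≠ 0) : 0 < ph ε v := Real.rpow_pos_of_pos (N_pos hv) _

lemma Adm.dn' (h : Adm ε C f) {v : ℂ × ℂ} (hv : v ≠ 0) : |f v| ≤ C * ph ε v ^ 2 := by
  refine (h.dn v hv).trans (le_of_eq ?_)
  unfold ph; rw [← Real.rpow_natCast, ← Real.rpow_mul (N_nonneg v)]; congr 2; push_cast; ring

lemma Adm.up' (h : Adm ε C f) {v : ℂ × ℂ} (hv : v ≠ 0) : |f v| ≤ C * (ph ε v)⁻¹ ^ 2 := by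
  refine (h.up v hv).trans (le_of_eq ?_)
  unfold ph; rw [← Real.rpow_neg (N_nonneg v), ← Real.rpow_natCast, ← Real.rpow_mul (N_nonneg v)]; congr 2; push_cast; ring

lemma Adm.C_nonneg (h : Adm ε C f) : 0 ≤ C := by
  have h1 := h.up (1, 0) (by simp)
  have : N ((1 : ℂ), (0 : ℂ)) = 1 := by simp [N, N2]
  rw [this] at h1
  simp at h1
  exact (abs_nonneg _).trans h1

lemma mm_ge_small {v : ℂ × ℂ} (h : ph ε v ≤ 1) : ph ε v ≤ 4 * mm ε v := by
  have h0 := ph_nonneg ε v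
  unfold mm
  rw [← mul_div_assoc, le_div_iff₀ (by positivity)]
  nlinarith [mul_nonneg h0 h0, mul_nonneg h0 (sub_nonneg.2 h)]

lemma mm_ge_large {v : ℂ × ℂ} (h : 1 ≤ ph ε v) : (ph ε v)⁻¹ ≤ 4 * mm ε v := by
  have h0 : 0 < ph ε v := by linarith
  unfold mm
  rw [← mul_div_assoc, le_div_iff₀ (by positivity), inv_mul_le_iff₀ h0]
  nlinarith

lemma Adm.le_mm (h : Adm ε C f) {v : ℂ × ℂ} (hv : v ≠ 0) : |f v| ≤ 4 * C * mm ε v := by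
  have hC := h.C_nonneg
  have h0 := ph_pos ε hv
  rcases le_total (ph ε v) 1 with h1 | h1
  · have := mul_le_mul_of_nonneg_left (mm_ge_small h1) hC
    have h2 := h.dn' hv
    have h3 : C * ph ε v ^ 2 ≤ C * ph ε v := by gcongr; nlinarith
    linarith
  · have := mul_le_mul_of_nonneg_left (mm_ge_large h1) hC
    have h2 := h.up' hv
    have h4 : (ph ε v)⁻¹ ≤ 1 := inv_le_one_of_one_le₀ h1
    have h5 : 0 < (ph ε v)⁻¹ := inv_pos.2 h0
    have h3 : C * (ph ε v)⁻¹ ^ 2 ≤ C * (ph ε v)⁻¹ := by gcongr; nlinarith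
    linarith

lemma Adm.le_C (h : Adm ε C f) {v : ℂ × ℂ} (hv : v ≠ 0) : |f v| ≤ C := by
  have hC := h.C_nonneg
  have h0 := ph_pos ε hv
  rcases le_total (ph ε v) 1 with h1 | h1
  · exact (h.dn' hv).trans (mul_le_of_le_one_right hC (by nlinarith))
  · have h4 : (ph ε v)⁻¹ ≤ 1 := inv_le_one_of_one_le₀ h1
    have h5 : 0 < (ph ε v)⁻¹ := inv_pos.2 h0
    exact (h.up' hv).trans (mul_le_of_le_one_right hC (by nlinarith))

lemma Adm.int (h : Adm ε C f) (hc : Ctr P ε ρ) {v : ℂ × ℂ} (hv : v ≠ 0) : Integrable (fun g => f (sm g v)) (Ur P) := by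
  have hm := h.meas
  refine Integrable.mono' ((mm_U hc hv).1.const_mul (4 * C)) (Measurable.aestronglyMeasurable (by fun_prop)) (Eventually.of_forall fun g => ?_)
  exact h.le_mm (sm_ne hv)

lemma Adm.Gr_le (h : Adm ε C f) (hc : Ctr P ε ρ) {v : ℂ × ℂ} (hv : v ≠ 0) : |Gr P f v| ≤ 4 * C / (1 - ρ) := by
  have hC := h.C_nonneg
  calc |Gr P f v| ≤ ∫ g, 4 * C * mm ε (sm g v) ∂(Ur P) :=
        by
          unfold Gr
          rw [← Real.norm_eq_abs]
          exact norm_integral_le_of_norm_le (f := fun g => f (sm g v)) ((mm_U hc hv).1.const_mul (4 * C)) (Eventually.of_forall fun g => h.le_mm (sm_ne hv))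
    _ = 4 * C * ∫ g, mm ε (sm g v) ∂(Ur P) := integral_const_mul _ _
    _ ≤ 4 * C * (1 / (1 - ρ)) := by gcongr; exact (mm_U hc hv).2
    _ = _ := by ring

lemma Adm.Gr_eq (h : Adm ε C f) (hc : Ctr P ε ρ) {v : ℂ × ℂ} (hv : v ≠ 0) : Gr P f v = f v + ∫ g, Gr P f (sm g v) ∂P := by
  unfold Gr
  rw [Ur_integral (h.int hc hv), sm_one]
  simp only [sm_mul]

lemma Adm.Gr_phase (h : Adm ε C f) (c : ℂ) (hc : ‖c‖ = 1) (v : ℂ × ℂ) : Gr P f (c • v) = Gr P f v := by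
  unfold Gr
  simp only [sm_smul, h.phase c hc]

lemma Adm.Gr_meas (h : Adm ε C f) : Measurable (Gr P f) := by
  have hm := h.meas
  have : StronglyMeasurable (fun p : (ℂ × ℂ) × SL2 => f (sm p.2 p.1)) := Measurable.stronglyMeasurable (by fun_prop)
  exact this.integral_prod_right.measurable

lemma isCompact_annulus (r R : ℝ) : IsCompact {y : ℂ × ℂ | r ≤ N y ∧ N y ≤ R} := by
  refine Metric.isCompact_of_isClosed_isBounded ((isClosed_le continuous_const cont_N).inter (isClosed_le cont_N continuous_const)) ?_
  refine (Metric.isBounded_closedBall (x := (0 : ℂ × ℂ)) (r := R)).subset fun y hy => ?_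
  have hy' : N y ≤ R := hy.2
  rw [mem_closedBall_zero_iff, Prod.norm_def]
  exact max_le ((fst_le_N y).trans hy') ((snd_le_N y).trans hy')

lemma eq_of_LL_dd {v w : ℂ × ℂ} (hv : v ≠ 0) (hw : w ≠ 0) (h1 : LL v w = 0) (h2 : dd v w = 0) : ∃ c : ℂ, ‖c‖ = 1 ∧ w = c • v := by
  have p1 := N_pos hv
  have p2 := N_pos hw
  have hN : N v = N w := Real.log_injOn_pos p1 p2 (by unfold LL at h1; rw [abs_eq_zero] at h1; linarith)
  have hwd : wd v w = 0 := by
    unfold dd at h2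
    rw [div_eq_zero_iff, norm_eq_zero] at h2
    rcases h2 with h | h
    · exact h
    · exact absurd h (by positivity)
  have hd := decomp v w
  rw [hwd, zero_smul, add_zero] at hd
  have hne : ((N v ^ 2 : ℝ) : ℂ) ≠ 0 := by
    rw [Complex.ofReal_ne_zero]; positivity
  have hw' : w = (((N v ^ 2 : ℝ) : ℂ)⁻¹ * (- wd (vp v) w)) • v := by
    rw [mul_smul, ← hd, smul_smul, inv_mul_cancel₀ hne, one_smul]
  refine ⟨_, ?_, hw'⟩
  have := congrArg N hw'
  rw [N_smul, ← hN] at this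
  have h3 : (‖(((N v ^ 2 : ℝ) : ℂ)⁻¹ * (- wd (vp v) w))‖ - 1) * N v = 0 := by linarith
  rcases mul_eq_zero.1 h3 with h | h
  · linarith
  · exact absurd h p1.ne'

lemma Adm.unif (h : Adm ε C f) (r R η : ℝ) (hr : 0 < r) (hη : 0 < η) :
    ∃ δ > 0, ∀ v w : ℂ × ℂ, r ≤ N v → N v ≤ R → w ≠ 0 → LL v w < δ → dd v w < δ → |f v - f w| ≤ η := by
  set A : Set ((ℂ × ℂ) × (ℂ × ℂ)) := {y : ℂ × ℂ | r ≤ N y ∧ N y ≤ R} ×ˢ {y : ℂ × ℂ | r / Real.exp 1 ≤ N y ∧ N y ≤ R * Real.exp 1} with hA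
  have hAc : IsCompact A := (isCompact_annulus _ _).prod (isCompact_annulus _ _)
  have hA1 : ∀ p ∈ A, p.1 ≠ 0 ∧ p.2 ≠ 0 := by
    intro p hp
    have h1 : r ≤ N p.1 := hp.1.1
    have h2 : r / Real.exp 1 ≤ N p.2 := hp.2.1
    exact ⟨ne_of_N (by linarith), ne_of_N (lt_of_lt_of_le (by positivity) h2)⟩
  have hfc : ContinuousOn (fun p : (ℂ × ℂ) × (ℂ × ℂ) => |f p.1 - f p.2|) A := by
    refine ContinuousOn.abs (ContinuousOn.sub ?_ ?_)
    · exact h.cont.comp continuousOn_fst fun p hp => (hA1 p hp).1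
    · exact h.cont.comp continuousOn_snd fun p hp => (hA1 p hp).2
  set K := A ∩ (fun p : (ℂ × ℂ) × (ℂ × ℂ) => |f p.1 - f p.2|) ⁻¹' (Set.Ici η) with hK
  have hKc : IsCompact K := hAc.of_isClosed_subset (hfc.preimage_isClosed_of_isClosed hAc.isClosed isClosed_Ici) Set.inter_subset_left
  have hGc : ContinuousOn (fun p : (ℂ × ℂ) × (ℂ × ℂ) => LL p.1 p.2 + dd p.1 p.2) K := by
    have hN1 : ContinuousOn (fun p : (ℂ × ℂ) × (ℂ × ℂ) => N p.1) K := by fun_prop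
    have hN2 : ContinuousOn (fun p : (ℂ × ℂ) × (ℂ × ℂ) => N p.2) K := by fun_prop
    have n1 : ∀ p ∈ K, N p.1 ≠ 0 := fun p hp => (N_pos (hA1 p hp.1).1).ne'
    have n2 : ∀ p ∈ K, N p.2 ≠ 0 := fun p hp => (N_pos (hA1 p hp.1).2).ne'
    unfold LL dd
    refine ContinuousOn.add (((hN1.log n1).sub (hN2.log n2)).abs) (ContinuousOn.div ?_ (hN1.mul hN2) fun p hp => mul_ne_zero (n1 p hp) (n2 p hp))
    fun_prop
  have main : ∃ δ > 0, ∀ p ∈ K, δ ≤ LL p.1 p.2 + dd p.1 p.2 := by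
    by_cases hne : K.Nonempty
    · obtain ⟨p, hp, hmin⟩ := hKc.exists_isMinOn hne hGc
      refine ⟨LL p.1 p.2 + dd p.1 p.2, ?_, fun q hq => hmin hq⟩
      have := LL_nonneg p.1 p.2
      have := dd_nonneg p.1 p.2
      by_contra hcon
      obtain ⟨c, hc, he⟩ := eq_of_LL_dd (hA1 p hp.1).1 (hA1 p hp.1).2 (by linarith) (by linarith)
      have h2 : η ≤ |f p.1 - f p.2| := hp.2
      rw [he, h.phase c hc, sub_self, abs_zero] at h2
      linarith
    · exact ⟨1, one_pos, fun p hp => absurd ⟨p, hp⟩ hne⟩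
  obtain ⟨δ, hδ, hmain⟩ := main
  refine ⟨min 1 (δ / 2), lt_min one_pos (by positivity), fun v w hv1 hv2 hw h1 h2 => ?_⟩
  by_contra hcon
  push Not at hcon
  have h3 : LL v w < 1 := h1.trans_le (min_le_left _ _)
  have h4 : LL v w < δ / 2 := h1.trans_le (min_le_right _ _)
  have h5 : dd v w < δ / 2 := h2.trans_le (min_le_right _ _)
  have pv : 0 < N v := by linarith
  have pw := N_pos hw
  have h6 := abs_lt.1 h3
  have := hmain (v, w) ⟨⟨⟨hv1, hv2⟩, ?_, ?_⟩, hcon.le⟩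
  · simp only at this; linarith
  · rw [div_le_iff₀ (Real.exp_pos _)]
    refine hv1.trans ?_
    rw [← Real.log_le_log_iff pv (by positivity), Real.log_mul pw.ne' (Real.exp_pos _).ne', Real.log_exp]
    linarith
  · have : N w ≤ N v * Real.exp 1 := by
      rw [← Real.log_le_log_iff pw (by positivity), Real.log_mul pv.ne' (Real.exp_pos _).ne', Real.log_exp]
      linarith
    exact this.trans (by gcongr)
end

open MeasureTheory Filter
noncomputable section

variable {P : Measure SL2} [IsProbabilityMeasure P]
variable {ε ρ C : ℝ} {f : ℂ × ℂ → ℝ}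

lemma qq_nonneg (ε) (v w) : 0 ≤ qq ε v w := by
  unfold qq
  have u3 := mm_nonneg ε v
  have u4 := mm_nonneg ε w
  have := Real.rpow_nonneg (LL_nonneg v w) (ε / 2)
  have := Real.rpow_nonneg (dd_nonneg v w) (ε / 2)
  positivity

lemma LL_comm (v w) : LL v w = LL w v := by unfold LL; rw [abs_sub_comm]
lemma qq_comm (ε) (v w) : qq ε v w = qq ε w v := by
  unfold qq; rw [LL_comm, dd_comm, add_comm (mm ε v)]

lemma Adm.pw (h : Adm ε C f) (he : 0 < ε) {η : ℝ} (hη : 0 < η) :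
    ∃ K ≥ 0, ∀ v w : ℂ × ℂ, v ≠ 0 → w ≠ 0 → |f v - f w| ≤ η * (mm ε v + mm ε w) + K * qq ε v w := by
  have hC := h.C_nonneg
  obtain ⟨τ, hτ⟩ : ∃ t, t = min 1 (η / (4 * C + 1)) := ⟨_, rfl⟩
  have hτ0 : 0 < τ := hτ ▸ lt_min one_pos (by positivity)
  have hτ1 : τ ≤ 1 := hτ ▸ min_le_left _ _
  have hτ2 : τ * (4 * C + 1) ≤ η := by
    have : τ ≤ η / (4 * C + 1) := hτ ▸ min_le_right _ _
    rwa [le_div_iff₀ (by positivity)] at this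
  have hτC : 4 * C * τ ≤ η := by nlinarith
  obtain ⟨r, hr⟩ : ∃ r : ℝ, r = τ ^ (1 / ε) := ⟨_, rfl⟩
  have hr0 : 0 < r := hr ▸ Real.rpow_pos_of_pos hτ0 _
  have hre : r ^ ε = τ := by rw [hr, ← Real.rpow_mul hτ0.le, one_div, inv_mul_cancel₀ he.ne', Real.rpow_one]
  -- outside the annulus
  have hout (v : ℂ × ℂ) (hv : v ≠ 0) (hn : ¬ (r ≤ N v ∧ N v ≤ r⁻¹)) : |f v| ≤ η * mm ε v := by
    have hp := N_pos hv
    have hφ := ph_pos ε hv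
    have hm := mm_nonneg ε v
    by_cases h1 : r ≤ N v
    · have h2 : r⁻¹ < N v := by by_contra hh; exact hn ⟨h1, not_lt.1 hh⟩
      have h3 : ph ε v ≤ τ := by
        unfold ph
        rw [Real.rpow_neg hp.le, ← hre, inv_le_comm₀ (by positivity) (by positivity), ← Real.inv_rpow hr0.le]
        exact Real.rpow_le_rpow (inv_nonneg.2 hr0.le) h2.le he.le
      have h4 := mm_ge_small (h3.trans hτ1)
      calc |f v| ≤ C * ph ε v ^ 2 := h.dn' hv
        _ = C * ph ε v * ph ε v := by ring
        _ ≤ C * τ * (4 * mm ε v) := by gcongr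
        _ = (4 * C * τ) * mm ε v := by ring
        _ ≤ _ := by gcongr
    · push Not at h1
      have h3 : (ph ε v)⁻¹ ≤ τ := by
        unfold ph
        rw [Real.rpow_neg hp.le, inv_inv, ← hre]
        exact Real.rpow_le_rpow hp.le h1.le he.le
      have h5 : 1 ≤ ph ε v := (one_le_inv₀ (inv_pos.2 hφ)).2 (h3.trans hτ1) |>.trans (by rw [inv_inv])
      have h4 := mm_ge_large h5
      have h6 : 0 < (ph ε v)⁻¹ := inv_pos.2 hφ
      calc |f v| ≤ C * (ph ε v)⁻¹ ^ 2 := h.up' hv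
        _ = C * (ph ε v)⁻¹ * (ph ε v)⁻¹ := by ring
        _ ≤ C * τ * (4 * mm ε v) := by gcongr
        _ = (4 * C * τ) * mm ε v := by ring
        _ ≤ _ := by gcongr
  have hin (v : ℂ × ℂ) (h1 : r ≤ N v) (h2 : N v ≤ r⁻¹) : τ / 4 ≤ mm ε v := by
    have hp : 0 < N v := by linarith
    have hv := ne_of_N hp
    have hφ := ph_pos ε hv
    rcases le_total (ph ε v) 1 with h3 | h3
    · have h4 := mm_ge_small h3
      have : τ ≤ ph ε v := by
        unfold ph
        rw [Real.rpow_neg hp.le, ← hre, le_inv_comm₀ (by positivity) (by positivity), ← Real.inv_rpow hr0.le]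
        exact Real.rpow_le_rpow hp.le h2 he.le
      linarith
    · have h4 := mm_ge_large h3
      have : τ ≤ (ph ε v)⁻¹ := by
        unfold ph
        rw [Real.rpow_neg hp.le, inv_inv, ← hre]
        exact Real.rpow_le_rpow hr0.le h1 he.le
      linarith
  obtain ⟨δ, hδ, hun⟩ := h.unif r r⁻¹ (η * (τ / 4)) hr0 (by positivity)
  have hdk : 0 < δ ^ (ε / 2) := Real.rpow_pos_of_pos hδ _
  obtain ⟨K, hK⟩ : ∃ K, K = 2 * C / (δ ^ (ε / 2) * (τ / 4)) := ⟨_, rfl⟩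
  have hK0 : 0 ≤ K := by rw [hK]; positivity
  have key (v w : ℂ × ℂ) (hw : w ≠ 0) (h1 : r ≤ N v) (h2 : N v ≤ r⁻¹) : |f v - f w| ≤ η * (mm ε v + mm ε w) + K * qq ε v w := by
    have hv : v ≠ 0 := ne_of_N (by linarith)
    have m1 := hin v h1 h2
    have m2 := mm_nonneg ε w
    have q0 := qq_nonneg ε v w
    by_cases hcl : LL v w < δ ∧ dd v w < δ
    · have := hun v w h1 h2 hw hcl.1 hcl.2
      have h3 := mul_le_mul_of_nonneg_left m1 hη.le
      nlinarith [mul_nonneg hη.le m2, mul_nonneg hK0 q0]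
    · have hq : δ ^ (ε / 2) * (τ / 4) ≤ qq ε v w := by
        have l0 := Real.rpow_nonneg (LL_nonneg v w) (ε / 2)
        have d0 := Real.rpow_nonneg (dd_nonneg v w) (ε / 2)
        unfold qq
        by_cases hl : δ ≤ LL v w
        · have : δ ^ (ε / 2) ≤ LL v w ^ (ε / 2) := Real.rpow_le_rpow hδ.le hl (by positivity)
          have h3 : δ ^ (ε / 2) * (τ / 4) ≤ LL v w ^ (ε / 2) * (mm ε v + mm ε w) := mul_le_mul this (by linarith) (by positivity) l0
          linarith
        · have hd : δ ≤ dd v w := by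
            by_contra hh; exact hcl ⟨not_le.1 hl, not_le.1 hh⟩
          have : δ ^ (ε / 2) ≤ dd v w ^ (ε / 2) := Real.rpow_le_rpow hδ.le hd (by positivity)
          have h3 : 0 ≤ LL v w ^ (ε / 2) * (mm ε v + mm ε w) := mul_nonneg l0 (by linarith [mm_nonneg ε v])
          have h4 : δ ^ (ε / 2) * (τ / 4) ≤ δ ^ (ε / 2) := mul_le_of_le_one_right hdk.le (by linarith)
          linarith
      have h3 : 2 * C ≤ K * qq ε v w := by
        calc 2 * C = K * (δ ^ (ε / 2) * (τ / 4)) := by rw [hK]; field_simp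
          _ ≤ _ := by gcongr
      have h4 := abs_sub (f v) (f w)
      have := h.le_C hv
      have := h.le_C hw
      have : 0 ≤ η * (mm ε v + mm ε w) := mul_nonneg hη.le (by linarith [mm_nonneg ε v])
      linarith
  refine ⟨K, hK0, fun v w hv hw => ?_⟩
  by_cases h1 : r ≤ N v ∧ N v ≤ r⁻¹
  · exact key v w hw h1.1 h1.2
  · by_cases h2 : r ≤ N w ∧ N w ≤ r⁻¹
    · have := key w v hv h2.1 h2.2
      rwa [abs_sub_comm, add_comm (mm ε w), qq_comm] at this
    · have h4 := abs_sub (f v) (f w)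
      have := hout v hv h1
      have := hout w hw h2
      have := mul_nonneg hK0 (qq_nonneg ε v w)
      linarith

lemma close_ne {v w : ℂ × ℂ} {θ : ℝ} (hv : v ≠ 0) (hθ : θ ≤ 1 / 2) (h : N (v - w) ≤ θ * N v) :
    w ≠ 0 ∧ N v ≤ 2 * N w ∧ |N w - N v| ≤ θ * N v := by
  have hp := N_pos hv
  have h1 := N_add_le (v - w) w
  have h2 := N_add_le (w - v) v
  rw [sub_add_cancel] at h1 h2
  have h3 : N (w - v) = N (v - w) := by
    rw [← neg_sub v w, ← neg_one_smul ℂ (v - w), N_smul]; simp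
  rw [h3] at h2
  have h4 : N v ≤ 2 * N w := by nlinarith
  exact ⟨ne_of_N (by linarith), h4, abs_le.2 ⟨by linarith, by linarith⟩⟩

lemma close_dd {v w : ℂ × ℂ} {θ : ℝ} (hv : v ≠ 0) (hθ : θ ≤ 1 / 2) (h : N (v - w) ≤ θ * N v) :
    LL v w ≤ 2 * θ ∧ dd v w ≤ 2 * θ := by
  obtain ⟨hw, h1, h2⟩ := close_ne hv hθ h
  have p1 := N_pos hv
  have p2 := N_pos hw
  have hθ0 : 0 ≤ θ := by
    have := N_nonneg (v - w)
    by_contra hh; push Not at hh; nlinarith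
  rw [abs_le] at h2
  constructor
  · unfold LL
    rw [← Real.log_div p1.ne' p2.ne', abs_le]
    constructor
    · have := Real.log_le_sub_one_of_pos (div_pos p2 p1)
      rw [Real.log_div p2.ne' p1.ne'] at this
      rw [Real.log_div p1.ne' p2.ne']
      have h3 : N w / N v ≤ 1 + θ := by rw [div_le_iff₀ p1]; linarith
      linarith
    · have := Real.log_le_sub_one_of_pos (div_pos p1 p2)
      have h3 : N v / N w ≤ 1 + 2 * θ := by rw [div_le_iff₀ p2]; nlinarith
      linarith
  · unfold dd
    have e : wd v w = - wd v (v - w) := by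
      rw [wd_sub_right]; simp [wd]; ring
    have h3 := wd_norm_le v (v - w)
    rw [e, norm_neg, div_le_iff₀ (by positivity)]
    calc _ ≤ N v * (θ * N v) := h3.trans (by gcongr)
      _ ≤ N v * (θ * (2 * N w)) := by gcongr
      _ = _ := by ring

/-- uniform regularity of a function on nonzero vectors -/
def Reg (F : ℂ × ℂ → ℝ) : Prop := ∀ η > 0, ∃ θ > 0, θ ≤ 1 / 2 ∧ ∀ v w : ℂ × ℂ, v ≠ 0 → N (v - w) ≤ θ * N v → |F v - F w| ≤ η

lemma Adm.Gr_reg (h : Adm ε C f) (hc : Ctr P ε ρ) : Reg (Gr P f) := by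
  intro η hη
  have hr : 0 < 1 - ρ := by linarith [hc.rho]
  have he := hc.pos
  have hB := Wc_pos hc
  obtain ⟨K, hK0, hK⟩ := h.pw hc.pos (η := η * (1 - ρ) / 4) (by positivity)
  obtain ⟨c, hcd⟩ : ∃ c, c = K * (2 + Wc P ε ρ) / (1 - ρ) := ⟨_, rfl⟩
  have hc0 : 0 ≤ c := by rw [hcd]; positivity
  obtain ⟨t, ht⟩ : ∃ t : ℝ, t = (η / (2 * (c + 1))) ^ (1 / (ε / 2)) := ⟨_, rfl⟩
  have hb0 : 0 < η / (2 * (c + 1)) := by positivity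
  have ht0 : 0 < t := ht ▸ Real.rpow_pos_of_pos hb0 _
  have hte : t ^ (ε / 2) = η / (2 * (c + 1)) := by
    rw [ht, ← Real.rpow_mul hb0.le, one_div, inv_mul_cancel₀ (by positivity), Real.rpow_one]
  refine ⟨min (1 / 2) (t / 2), lt_min (by norm_num) (by positivity), min_le_left _ _, fun v w hv hvw => ?_⟩
  obtain ⟨hw, -, -⟩ := close_ne hv (min_le_left _ _) hvw
  obtain ⟨hl, hd⟩ := close_dd hv (min_le_left _ _) hvw
  have hm : min (1 / 2) (t / 2) ≤ t / 2 := min_le_right _ _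
  have l1 : LL v w ^ (ε / 2) ≤ t ^ (ε / 2) := Real.rpow_le_rpow (LL_nonneg _ _) (by linarith) (by positivity)
  have d1 : dd v w ^ (ε / 2) ≤ t ^ (ε / 2) := Real.rpow_le_rpow (dd_nonneg _ _) (by linarith) (by positivity)
  obtain ⟨a1, a2⟩ := mm_U hc hv
  obtain ⟨b1, b2⟩ := mm_U hc hw
  obtain ⟨q1, q2⟩ := qq_U hc hv hw
  have j1 : Integrable (fun g => η * (1 - ρ) / 4 * (mm ε (sm g v) + mm ε (sm g w))) (Ur P) := (a1.add b1).const_mul _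
  have j2 := q1.const_mul K
  unfold Gr
  rw [← integral_sub (h.int hc hv) (h.int hc hw), ← Real.norm_eq_abs]
  calc _ ≤ ∫ g, (η * (1 - ρ) / 4 * (mm ε (sm g v) + mm ε (sm g w)) + K * qq ε (sm g v) (sm g w)) ∂(Ur P) :=
        norm_integral_le_of_norm_le (j1.add j2) (Eventually.of_forall fun g => hK _ _ (sm_ne hv) (sm_ne hw))
    _ = η * (1 - ρ) / 4 * (∫ g, mm ε (sm g v) ∂(Ur P) + ∫ g, mm ε (sm g w) ∂(Ur P)) + K * ∫ g, qq ε (sm g v) (sm g w) ∂(Ur P) := by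
        rw [integral_add j1 j2, integral_const_mul, integral_const_mul, integral_add a1 b1]
    _ ≤ η * (1 - ρ) / 4 * (1 / (1 - ρ) + 1 / (1 - ρ)) + K * ((2 * t ^ (ε / 2) + Wc P ε ρ * t ^ (ε / 2)) / (1 - ρ)) := by
        gcongr
        exact q2.trans (by gcongr)
    _ = η / 2 + c * t ^ (ε / 2) := by rw [hcd]; field_simp; ring
    _ ≤ _ := by
        rw [hte]
        have : c * (η / (2 * (c + 1))) ≤ η / 2 := by
          rw [← mul_div_assoc, div_le_div_iff₀ (by positivity) (by positivity)]; nlinarith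
        linarith
end

open MeasureTheory Filter
noncomputable section

/-! ### A maximum principle near zero -/

variable {P : Measure SL2} [IsProbabilityMeasure P]
variable {ε ρ C : ℝ} {f : ℂ × ℂ → ℝ}

lemma N_sub_comm (v w : ℂ × ℂ) : N (v - w) = N (w - v) := by
  rw [← neg_sub w v, ← neg_one_smul ℂ (w - v), N_smul]; simp

/-- bounded regular solutions of the Poisson equation with right-hand side vanishing at zero -/
structure Poi (P : Measure SL2) (Cb : ℝ) (D d : ℂ × ℂ → ℝ) : Prop where
  bdd : ∀ v, v ≠ 0 → |D v| ≤ Cb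
  meas : Measurable D
  reg : Reg D
  eq : ∀ v, v ≠ 0 → D v = d v + ∫ g, D (sm g v) ∂P
  lim : ∀ η > 0, ∃ r > 0, ∀ v, v ≠ 0 → N v < r → |d v| ≤ η

variable {Cb M : ℝ} {D d : ℂ × ℂ → ℝ}

lemma Poi.step (h : Poi P Cb D d) (hc : Ctr P ε ρ) (hM : ∀ δ > 0, ∃ r > 0, ∀ v, v ≠ 0 → N v < r → D v ≤ M + δ)
    {k : SL2} (hk : k ∈ measSupp P) {η : ℝ} (hη : 0 < η) :
    ∃ δ > 0, ∃ r > 0, ∀ v, v ≠ 0 → N v < r → M - δ < D v → M - η < D (sm k v) := by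
  have he := hc.pos
  have hmD := h.meas
  obtain ⟨θ, hθ, -, hreg⟩ := h.reg (η / 2) (by positivity)
  obtain ⟨O, hO⟩ : ∃ O : Set SL2, O = {g | e1 (g * k⁻¹) < θ} := ⟨_, rfl⟩
  have hOo : IsOpen O := by
    rw [hO]; exact isOpen_lt (cont_e1.comp (continuous_mul_const _)) continuous_const
  have hOp : 0 < P O := hk O hOo (by
    have : e1 (k * k⁻¹) < θ := by rw [mul_inv_cancel]; simpa [e1] using hθ
    rw [hO]; exact this)
  obtain ⟨p, hp⟩ : ∃ p, p = P.real O := ⟨_, rfl⟩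
  have hp0 : 0 < p := by rw [hp, Measure.real]; exact ENNReal.toReal_pos hOp.ne' (measure_ne_top _ _)
  obtain ⟨δ, hδ⟩ : ∃ δ, δ = η * p / 8 := ⟨_, rfl⟩
  have hδ0 : 0 < δ := by rw [hδ]; positivity
  have hCb : 0 ≤ Cb := (abs_nonneg _).trans (h.bdd (1, 0) (by simp))
  have hi : Integrable (fun g => nF g ^ ε) P := int_rpow hc (by linarith)
  obtain ⟨I, hI⟩ : ∃ I, I = ∫ g, nF g ^ ε ∂P := ⟨_, rfl⟩
  have hI0 : 0 ≤ I := by rw [hI]; exact integral_nonneg fun g => Real.rpow_nonneg (nF_nonneg g) _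
  obtain ⟨κ, hκ⟩ : ∃ κ, κ = δ / ((Cb + |M|) * I + 1) := ⟨_, rfl⟩
  have hκ0 : 0 < κ := by rw [hκ]; positivity
  have hκ1 : κ * (Cb + |M|) * I ≤ δ := by
    have : κ * ((Cb + |M|) * I + 1) = δ := by rw [hκ]; field_simp
    nlinarith
  obtain ⟨R, hR⟩ : ∃ R : ℝ, R = κ⁻¹ ^ (1 / ε) := ⟨_, rfl⟩
  have hR0 : 0 < R := hR ▸ Real.rpow_pos_of_pos (inv_pos.2 hκ0) _
  have hRe : R ^ ε = κ⁻¹ := by rw [hR, ← Real.rpow_mul (inv_pos.2 hκ0).le, one_div, inv_mul_cancel₀ he.ne', Real.rpow_one]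
  obtain ⟨r1, hr1, hr1'⟩ := hM δ hδ0
  obtain ⟨r2, hr2, hr2'⟩ := h.lim δ hδ0
  refine ⟨δ, hδ0, min (r1 / R) r2, lt_min (by positivity) hr2, fun v hv hvr hDv => ?_⟩
  by_contra hcon
  push Not at hcon
  have hv1 : N v * R < r1 := by
    have := lt_of_lt_of_le hvr (min_le_left _ _); rwa [lt_div_iff₀ hR0] at this
  have hv2 := lt_of_lt_of_le hvr (min_le_right _ _)
  have hbound (g : SL2) : D (sm g v) ≤ M + δ + κ * (Cb + |M|) * nF g ^ ε - O.indicator (fun _ => η / 2) g := by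
    have hn : 0 ≤ κ * (Cb + |M|) * nF g ^ ε := by have := Real.rpow_nonneg (nF_nonneg g) ε; positivity
    by_cases hg : g ∈ O
    · rw [Set.indicator_of_mem hg]
      have hg' : e1 (g * k⁻¹) < θ := by rw [hO] at hg; exact hg
      have h1 := N_sm_sub_le (g * k⁻¹) (sm k v)
      rw [← sm_mul, inv_mul_cancel_right, N_sub_comm] at h1
      have h2 := hreg (sm k v) (sm g v) (sm_ne hv) (h1.trans (by have := N_nonneg (sm k v); gcongr))
      rw [abs_le] at h2
      linarith
    · rw [Set.indicator_of_notMem hg, sub_zero]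
      by_cases hgR : nF g ≤ R
      · have := hr1' (sm g v) (sm_ne hv) (lt_of_le_of_lt ((N_sm_le g v).trans (by have := N_nonneg v; gcongr)) (by linarith : R * N v < r1))
        linarith
      · push Not at hgR
        have h1 : κ⁻¹ ≤ nF g ^ ε := by rw [← hRe]; exact Real.rpow_le_rpow hR0.le hgR.le he.le
        have h2 : 1 ≤ κ * nF g ^ ε := by
          rw [inv_le_iff_one_le_mul₀ hκ0] at h1; linarith
        have h3 := (le_abs_self _).trans (h.bdd (sm g v) (sm_ne hv))
        have h4 : Cb + |M| ≤ (Cb + |M|) * (κ * nF g ^ ε) := le_mul_of_one_le_right (by positivity) h2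
        have := neg_abs_le M
        nlinarith
  have hOm : MeasurableSet O := hOo.measurableSet
  have i1 : Integrable (fun g => D (sm g v)) P := by
    refine Integrable.mono' (integrable_const Cb) (Measurable.aestronglyMeasurable (by fun_prop)) (Eventually.of_forall fun g => ?_)
    exact h.bdd _ (sm_ne hv)
  have i2 : Integrable (fun g => M + δ + κ * (Cb + |M|) * nF g ^ ε) P := (integrable_const _).add (hi.const_mul _)
  have i3 : Integrable (fun g => O.indicator (fun _ => η / 2) g) P := (integrable_const _).indicator hOm
  have h1 := integral_mono (μ := P) i1 (i2.sub i3) hbound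
  have h2 : ∫ g, (M + δ + κ * (Cb + |M|) * nF g ^ ε - O.indicator (fun _ => η / 2) g) ∂P = M + δ + κ * (Cb + |M|) * I - p * (η / 2) := by
    rw [integral_sub i2 i3, integral_add (integrable_const _) (hi.const_mul _), integral_const_mul, integral_indicator_const _ hOm, ← hp, ← hI]
    simp
  have h3 : ∫ g, D (sm g v) ∂P ≤ M + δ + κ * (Cb + |M|) * I - p * (η / 2) := h1.trans h2.le
  have h4 := h.eq v hv
  have h5 := (le_abs_self _).trans (hr2' v hv hv2)
  nlinarith

lemma Poi.prop (h : Poi P Cb D d) (hc : Ctr P ε ρ) (hM : ∀ δ > 0, ∃ r > 0, ∀ v, v ≠ 0 → N v < r → D v ≤ M + δ)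
    {k : SL2} (hk : k ∈ Submonoid.closure (measSupp P)) : ∀ η : ℝ, 0 < η → 
    ∃ δ > 0, ∃ r > 0, ∀ v, v ≠ 0 → N v < r → M - δ < D v → M - η < D (sm k v) := by
  induction hk using Submonoid.closure_induction with
  | mem x hx => exact fun η hη => h.step hc hM hx hη
  | one => exact fun η hη => ⟨η, hη, 1, one_pos, fun v _ _ h => by rwa [sm_one]⟩
  | mul x y _ _ hx hy =>
    intro η hη
    obtain ⟨δ, hδ, r, hr, h1⟩ := hx η hη
    obtain ⟨δ', hδ', r', hr', h2⟩ := hy δ hδ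
    refine ⟨δ', hδ', min r' (r / nF y), lt_min hr' (div_pos hr (nF_pos y)), fun v hv hvr hD => ?_⟩
    have hv1 := lt_of_lt_of_le hvr (min_le_left _ _)
    have hv2 := lt_of_lt_of_le hvr (min_le_right _ _)
    rw [lt_div_iff₀ (nF_pos y)] at hv2
    rw [sm_mul]
    exact h1 _ (sm_ne hv) (lt_of_le_of_lt (N_sm_le y v) (by linarith)) (h2 v hv hv1 hD)

lemma move_out {S : Set SL2} (hS : ¬ Group.IsSolvable (Subgroup.closure S)) (B : SL2) {v : ℂ × ℂ} (hv : v ≠ 0) :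
    ∃ s ∈ Submonoid.closure S, (sm B⁻¹ (sm s v)).1 ≠ 0 := by
  by_cases h0 : (sm B⁻¹ v).1 = 0
  · obtain ⟨q, hq⟩ : ∃ q, q = (sm B⁻¹ v).2 := ⟨_, rfl⟩
    have hvq : v = sm B (0, q) := by
      rw [← sm_sm_inv B v]; congr 1; exact Prod.ext h0 hq.symm
    have hq0 : q ≠ 0 := by
      rintro h; rw [h] at hvq; exact hv (hvq.trans (sm_zero B))
    have hB := det_eq B
    have hw : (![B 0 1, B 1 1] : Fin 2 → ℝ) ≠ 0 := by
      intro h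
      have a := congrFun h 0
      have b := congrFun h 1
      simp at a b
      rw [a, b] at hB; simp at hB
    obtain ⟨s, hs, hsw⟩ := irr hS hw
    refine ⟨s, Submonoid.subset_closure hs, ?_⟩
    have : (sm B⁻¹ (sm s v)).1 = q * ((rw2 (s • ![B 0 1, B 1 1]) ![B 0 1, B 1 1] : ℝ) : ℂ) := by
      rw [hvq]
      simp only [sm, inv00, inv01, rw2, mulVec_ent]
      simp
      ring
    rw [this]
    exact mul_ne_zero hq0 (Complex.ofReal_ne_zero.2 hsw)
  · exact ⟨1, Submonoid.one_mem _, by rwa [sm_one]⟩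
end

open MeasureTheory Filter
noncomputable section

variable {P : Measure SL2} [IsProbabilityMeasure P]
variable {ε ρ C : ℝ} {f : ℂ × ℂ → ℝ}

lemma Adm.shift (h : Adm ε C f) (he : 0 < ε) {a : ℝ} (ha : 1 ≤ a) :
    Adm ε (C * (a ^ (2 * ε) + 1)) (fun v => f ((a : ℂ) • v) - f v) := by
  have hC := h.C_nonneg
  have ha0 : 0 < a := by linarith
  have hac : (a : ℂ) ≠ 0 := Complex.ofReal_ne_zero.2 ha0.ne'
  have hN (v) : N ((a : ℂ) • v) = a * N v := by rw [N_smul, Complex.norm_real, Real.norm_of_nonneg ha0.le]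
  have hA : 1 ≤ a ^ (2 * ε) := Real.one_le_rpow ha (by positivity)
  refine ⟨?_, ?_, ?_, ?_⟩
  · refine ContinuousOn.sub (h.cont.comp (by fun_prop) fun v hv => ?_) h.cont
    exact smul_ne_zero hac hv
  · intro c hc v
    rw [smul_comm, h.phase c hc, h.phase c hc]
  · intro v hv
    have h1 := h.up _ (smul_ne_zero hac hv)
    have h2 := h.up v hv
    rw [hN, Real.mul_rpow ha0.le (N_nonneg v)] at h1
    refine (abs_sub _ _).trans ?_
    linarith
  · intro v hv
    have h1 := h.dn _ (smul_ne_zero hac hv)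
    have h2 := h.dn v hv
    rw [hN, Real.mul_rpow ha0.le (N_nonneg v)] at h1
    have h3 : a ^ (-(2 * ε)) ≤ a ^ (2 * ε) := Real.rpow_le_rpow_of_exponent_le ha (by linarith)
    have h4 := Real.rpow_nonneg (N_nonneg v) (-(2 * ε))
    have h5 : C * (a ^ (-(2 * ε)) * N v ^ (-(2 * ε))) ≤ C * (a ^ (2 * ε) * N v ^ (-(2 * ε))) := by gcongr
    refine (abs_sub _ _).trans ?_
    linarith

lemma Adm.Gr_shift (h : Adm ε C f) (hc : Ctr P ε ρ) {a : ℝ} (ha : 0 < a) {v : ℂ × ℂ} (hv : v ≠ 0) :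
    Gr P (fun v => f ((a : ℂ) • v) - f v) v = Gr P f ((a : ℂ) • v) - Gr P f v := by
  have hac : (a : ℂ) ≠ 0 := Complex.ofReal_ne_zero.2 ha.ne'
  have h1 := h.int hc (smul_ne_zero hac hv)
  simp only [sm_smul] at h1
  unfold Gr
  simp only [sm_smul]
  exact integral_sub h1 (h.int hc hv)

lemma Adm.poi (h : Adm ε C f) (hc : Ctr P ε ρ) : Poi P (4 * C / (1 - ρ)) (Gr P f) f := by
  refine ⟨fun v hv => h.Gr_le hc hv, h.Gr_meas, h.Gr_reg hc, fun v hv => h.Gr_eq hc hv, fun η hη => ?_⟩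
  have he := hc.pos
  have hC := h.C_nonneg
  have hb0 : 0 < η / (C + 1) := by positivity
  refine ⟨(η / (C + 1)) ^ (1 / (2 * ε)), Real.rpow_pos_of_pos hb0 _, fun v hv hvr => ?_⟩
  have : N v ^ (2 * ε) ≤ η / (C + 1) := by
    calc N v ^ (2 * ε) ≤ ((η / (C + 1)) ^ (1 / (2 * ε))) ^ (2 * ε) := Real.rpow_le_rpow (N_nonneg v) hvr.le (by positivity)
      _ = _ := by rw [← Real.rpow_mul hb0.le, one_div, inv_mul_cancel₀ (by positivity), Real.rpow_one]
  calc |f v| ≤ C * N v ^ (2 * ε) := h.up v hv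
    _ ≤ C * (η / (C + 1)) := by gcongr
    _ ≤ η := by rw [← mul_div_assoc, div_le_iff₀ (by positivity)]; nlinarith

lemma hyp_sm {g : SL2} {l : ℝ} {B : SL2} (h : IsHyp g l B) (n : ℕ) (w : ℂ × ℂ) :
    sm (g ^ n) w = sm B ((l : ℂ) ^ n * (sm B⁻¹ w).1, ((l : ℂ) ^ n)⁻¹ * (sm B⁻¹ w).2) := by
  have e : sm (g ^ n) w = sm B (sm (B⁻¹ * g ^ n * B) (sm B⁻¹ w)) := by
    rw [← sm_mul, ← sm_mul]; congr 1; group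
  obtain ⟨i0, i1, i2, i3⟩ := hyp_pow h n
  rw [e]; congr 1
  generalize sm B⁻¹ w = u
  simp only [sm, i0, i1, i2, i3]
  simp

lemma hyp_close {F : ℂ × ℂ → ℝ} (hR : Reg F) (hph : ∀ c : ℂ, ‖c‖ = 1 → ∀ v, F (c • v) = F v)
    {g : SL2} {l : ℝ} {B : SL2} (h : IsHyp g l B) {c : ℝ} (hc : 0 < c) {η : ℝ} (hη : 0 < η) :
    ∃ n0 : ℕ, ∀ n ≥ n0, ∀ w, w ≠ 0 → c * N w ≤ ‖(sm B⁻¹ w).1‖ →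
      |F (((|l| : ℝ) : ℂ) • sm (g ^ n) w) - F (sm (g ^ (n + 1)) w)| ≤ η := by
  obtain ⟨θ, hθ, -, hreg⟩ := hR η hη
  have ha := h.1
  have ha0 : 0 < |l| := by linarith
  have hl0 : l ≠ 0 := abs_pos.1 ha0
  have hb := nF_pos B
  obtain ⟨n0, hn0⟩ := pow_unbounded_of_one_lt (2 * nF B ^ 3 / (θ * c)) ha
  refine ⟨n0, fun n hn w hw hcw => ?_⟩
  have hA : 2 * nF B ^ 3 ≤ θ * c * |l| ^ n := by
    have : 2 * nF B ^ 3 / (θ * c) ≤ |l| ^ n := hn0.le.trans (pow_le_pow_right₀ ha.le hn)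
    rw [div_le_iff₀ (by positivity)] at this; linarith
  have hA1 : 1 ≤ |l| ^ n := one_le_pow₀ ha.le
  have hlc : (l : ℂ) ≠ 0 := Complex.ofReal_ne_zero.2 hl0
  have hlac : ((|l| : ℝ) : ℂ) ≠ 0 := Complex.ofReal_ne_zero.2 ha0.ne'
  have hFe : F (((|l| : ℝ) : ℂ) • sm (g ^ n) w) = F ((l : ℂ) • sm (g ^ n) w) := by
    rw [← hph ((l : ℂ) / ((|l| : ℝ) : ℂ)) (by rw [norm_div, Complex.norm_real, Complex.norm_real, Real.norm_eq_abs, Real.norm_eq_abs, abs_abs, div_self ha0.ne']),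
      smul_smul, div_mul_cancel₀ _ hlac]
  rw [hFe]
  have hq : ‖(sm B⁻¹ w).2‖ ≤ nF B * N w := (snd_le_N _).trans ((N_sm_le _ _).trans (by rw [nF_inv]))
  have e1 : (l : ℂ) • sm (g ^ n) w = sm B ((l : ℂ) ^ (n + 1) * (sm B⁻¹ w).1, (l : ℂ) * ((l : ℂ) ^ n)⁻¹ * (sm B⁻¹ w).2) := by
    rw [hyp_sm h, ← sm_smul]; congr 1
    ext <;> simp <;> ring
  have e2 := hyp_sm h (n + 1) w
  have hp : 0 < N w := N_pos hw
  generalize (sm B⁻¹ w).1 = p at *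
  generalize (sm B⁻¹ w).2 = q at *
  refine hreg _ _ (smul_ne_zero hlc (sm_ne hw)) ?_
  have hNv : |l| * |l| ^ n * (c * N w) ≤ nF B * N ((l : ℂ) • sm (g ^ n) w) := by
    have h1 := fst_le_N (sm B⁻¹ ((l : ℂ) • sm (g ^ n) w))
    have h2 := N_sm_le B⁻¹ ((l : ℂ) • sm (g ^ n) w)
    rw [nF_inv] at h2
    rw [e1, sm_inv_sm] at h1
    simp only [norm_mul, norm_pow, Complex.norm_real, Real.norm_eq_abs] at h1
    have h3 : N ((l : ℂ) ^ (n + 1) * p, (l : ℂ) * ((l : ℂ) ^ n)⁻¹ * q) = N (sm B⁻¹ ((l : ℂ) • sm (g ^ n) w)) := by rw [e1, sm_inv_sm]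
    rw [h3] at h1
    calc _ = |l| ^ (n + 1) * (c * N w) := by ring
      _ ≤ |l| ^ (n + 1) * ‖p‖ := by gcongr
      _ ≤ _ := h1.trans h2
  have hdiff : N ((l : ℂ) • sm (g ^ n) w - sm (g ^ (n + 1)) w) ≤ nF B * (2 * |l| * (|l| ^ n)⁻¹ * (nF B * N w)) := by
    have e3 : (l : ℂ) • sm (g ^ n) w - sm (g ^ (n + 1)) w = sm B (0, ((l : ℂ) * ((l : ℂ) ^ n)⁻¹ - ((l : ℂ) ^ (n + 1))⁻¹) * q) := by
      rw [e1, e2, sub_eq_iff_eq_add, ← sm_add]; congr 1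
      ext <;> simp <;> ring
    rw [e3]
    refine (N_sm_le _ _).trans ?_
    gcongr
    refine (N_le_add _).trans ?_
    simp only [norm_zero, zero_add, norm_mul]
    gcongr
    refine (norm_sub_le _ _).trans ?_
    simp only [norm_mul, norm_inv, norm_pow, Complex.norm_real, Real.norm_eq_abs]
    have : (|l| ^ (n + 1))⁻¹ ≤ |l| * (|l| ^ n)⁻¹ := by
      rw [pow_succ, mul_inv, mul_comm]
      gcongr
      exact (inv_le_one_of_one_le₀ ha.le).trans ha.le
    linarith
  have hfin : nF B * N ((l : ℂ) • sm (g ^ n) w - sm (g ^ (n + 1)) w) ≤ nF B * (θ * N ((l : ℂ) • sm (g ^ n) w)) := by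
    calc _ ≤ nF B * (nF B * (2 * |l| * (|l| ^ n)⁻¹ * (nF B * N w))) := by gcongr
      _ = (2 * nF B ^ 3) * (|l| * (|l| ^ n)⁻¹ * N w) := by ring
      _ ≤ (θ * c * |l| ^ n) * (|l| * (|l| ^ n)⁻¹ * N w) := by gcongr
      _ = θ * c * |l| * N w := by field_simp
      _ ≤ θ * c * |l| * N w * |l| ^ n := le_mul_of_one_le_right (by positivity) hA1
      _ = θ * (|l| * |l| ^ n * (c * N w)) := by ring
      _ ≤ θ * (nF B * N ((l : ℂ) • sm (g ^ n) w)) := by gcongr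
      _ = _ := by ring
  exact le_of_mul_le_mul_left hfin hb

/-- one-sided asymptotic periodicity -/
lemma Adm.one_sided (hS : ¬ Group.IsSolvable (Subgroup.closure (measSupp P))) (h : Adm ε C f) (hc : Ctr P ε ρ)
    {g : SL2} (hg : g ∈ Submonoid.closure (measSupp P)) {l : ℝ} {B : SL2} (hh : IsHyp g l B) {η : ℝ} (hη : 0 < η) :
    ∃ r > 0, ∀ v, v ≠ 0 → N v < r → Gr P f (((|l| : ℝ) : ℂ) • v) - Gr P f v ≤ η := by
  have he := hc.pos
  have ha := hh.1
  have ha0 : 0 < |l| := by linarith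
  have hsh := h.shift he ha.le
  have hpoi := hsh.poi hc
  obtain ⟨D, hDdef⟩ : ∃ D, D = Gr P (fun v => f (((|l| : ℝ) : ℂ) • v) - f v) := ⟨_, rfl⟩
  rw [← hDdef] at hpoi
  obtain ⟨F, hF⟩ : ∃ F, F = Gr P f := ⟨_, rfl⟩
  have hD (v) (hv : v ≠ 0) : D v = F (((|l| : ℝ) : ℂ) • v) - F v := by rw [hDdef, hF]; exact h.Gr_shift hc ha0 hv
  have hFb (v) (hv : v ≠ 0) : |F v| ≤ 4 * C / (1 - ρ) := by rw [hF]; exact h.Gr_le hc hv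
  have hFr : Reg F := by rw [hF]; exact h.Gr_reg hc
  have hFp : ∀ c : ℂ, ‖c‖ = 1 → ∀ v, F (c • v) = F v := by rw [hF]; exact h.Gr_phase
  obtain ⟨Cb, hCb⟩ : ∃ Cb, Cb = 4 * (C * (|l| ^ (2 * ε) + 1)) / (1 - ρ) := ⟨_, rfl⟩
  rw [← hCb] at hpoi
  obtain ⟨Cf, hCf⟩ : ∃ Cf, Cf = 4 * C / (1 - ρ) := ⟨_, rfl⟩
  rw [← hCf] at hFb
  rw [← hF]
  clear hsh hDdef hF hCb hCf
  by_contra hcon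
  obtain ⟨S, hSd⟩ : ∃ S : Set ℝ, S = {t | ∃ r > 0, ∀ v, v ≠ 0 → N v < r → D v ≤ t} := ⟨_, rfl⟩
  have memS (t) : t ∈ S ↔ ∃ r > 0, ∀ v, v ≠ 0 → N v < r → D v ≤ t := by rw [hSd]; rfl
  have hup : ∀ t ∈ S, η ≤ t := by
    intro t ht
    rw [memS] at ht
    by_contra hlt
    push Not at hlt
    obtain ⟨r, hr, hr'⟩ := ht
    exact hcon ⟨r, hr, fun v hv hvr => by rw [← hD v hv]; exact (hr' v hv hvr).trans hlt.le⟩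
  have hne : S.Nonempty := ⟨Cb, (memS _).2 ⟨1, one_pos, fun v hv _ => (le_abs_self _).trans (hpoi.bdd v hv)⟩⟩
  have hbd : BddBelow S := ⟨η, hup⟩
  obtain ⟨M, hM⟩ : ∃ M, M = sInf S := ⟨_, rfl⟩
  have hMη : η ≤ M := by rw [hM]; exact le_csInf hne hup
  have hMs : ∀ δ > 0, ∃ r > 0, ∀ v, v ≠ 0 → N v < r → D v ≤ M + δ := by
    intro δ hδ
    obtain ⟨t, ht, htl⟩ := exists_lt_of_csInf_lt hne (show sInf S < M + δ by rw [← hM]; linarith)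
    obtain ⟨r, hr, hr'⟩ := (memS t).1 ht
    exact ⟨r, hr, fun v hv hvr => (hr' v hv hvr).trans htl.le⟩
  -- compactness
  have hK : IsCompact {y : ℂ × ℂ | (1 : ℝ) ≤ N y ∧ N y ≤ 1} := isCompact_annulus 1 1
  have key : ∃ δ > 0, ∃ r > 0, ∀ v, v ≠ 0 → (((N v)⁻¹ : ℝ) : ℂ) • v ∈ {y : ℂ × ℂ | (1 : ℝ) ≤ N y ∧ N y ≤ 1} → N v < r → D v ≤ M - δ := by
    refine hK.induction_on (p := fun s => ∃ δ > 0, ∃ r > 0, ∀ v, v ≠ 0 → (((N v)⁻¹ : ℝ) : ℂ) • v ∈ s → N v < r → D v ≤ M - δ) ?_ ?_ ?_ ?_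
    · exact ⟨1, one_pos, 1, one_pos, fun v _ h => absurd h (Set.notMem_empty _)⟩
    · rintro s t hst ⟨δ, hδ, r, hr, h1⟩
      exact ⟨δ, hδ, r, hr, fun v hv hm => h1 v hv (hst hm)⟩
    · rintro s t ⟨δ, hδ, r, hr, h1⟩ ⟨δ', hδ', r', hr', h2⟩
      refine ⟨min δ δ', lt_min hδ hδ', min r r', lt_min hr hr', fun v hv hm hvr => ?_⟩
      rcases hm with hm | hm
      · linarith [h1 v hv hm (lt_of_lt_of_le hvr (min_le_left _ _)), min_le_left δ δ']
      · linarith [h2 v hv hm (lt_of_lt_of_le hvr (min_le_right _ _)), min_le_right δ δ']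
    · intro v0 hv0
      have hv0' : (1 : ℝ) ≤ N v0 := hv0.1
      have hv0n : v0 ≠ 0 := ne_of_N (by linarith)
      obtain ⟨s, hs, hsv⟩ := move_out hS B hv0n
      obtain ⟨c0, hc0⟩ : ∃ c0, c0 = ‖(sm B⁻¹ (sm s v0)).1‖ := ⟨_, rfl⟩
      have hc00 : 0 < c0 := by rw [hc0]; exact norm_pos_iff.2 hsv
      have hcont : Continuous fun x => ‖(sm B⁻¹ (sm s x)).1‖ :=
        (continuous_fst.comp ((cont_sm_right B⁻¹).comp (cont_sm_right s))).norm
      refine ⟨{x | c0 / 2 < ‖(sm B⁻¹ (sm s x)).1‖}, mem_nhdsWithin_of_mem_nhds ((isOpen_lt continuous_const hcont).mem_nhds ?_), ?_⟩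
      · change c0 / 2 < ‖(sm B⁻¹ (sm s v0)).1‖
        rw [← hc0]; linarith
      have hsp := nF_pos s
      obtain ⟨n0, hn0⟩ := hyp_close hFr hFp hh (c := c0 / 2 / nF s) (by positivity) (η := η / 4) (by positivity)
      have tele : ∀ K : ℕ, ∃ δ > 0, ∃ r > 0, ∀ v, v ≠ 0 → c0 / 2 / nF s * N (sm s v) ≤ ‖(sm B⁻¹ (sm s v)).1‖ → N v < r → M - δ < D v →
          K * (η / 2) ≤ F (sm (g ^ (n0 + K)) (sm s v)) - F (sm (g ^ n0) (sm s v)) := by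
        intro K
        induction K with
        | zero => exact ⟨1, one_pos, 1, one_pos, fun v _ _ _ _ => by simp⟩
        | succ K ih =>
          obtain ⟨δ, hδ, r, hr, h1⟩ := ih
          obtain ⟨δ', hδ', r', hr', h2⟩ := hpoi.prop hc hMs (Submonoid.mul_mem _ (Submonoid.pow_mem _ hg (n0 + K)) hs) (η / 4) (by positivity)
          refine ⟨min δ δ', lt_min hδ hδ', min r r', lt_min hr hr', fun v hv hm hvr hDv => ?_⟩
          have a1 := h1 v hv hm (lt_of_lt_of_le hvr (min_le_left _ _)) (by linarith [min_le_left δ δ'])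
          have a2 := h2 v hv (lt_of_lt_of_le hvr (min_le_right _ _)) (by linarith [min_le_right δ δ'])
          rw [sm_mul, hD _ (sm_ne (sm_ne hv))] at a2
          have a3 := hn0 (n0 + K) (by omega) (sm s v) (sm_ne hv) hm
          rw [abs_le] at a3
          rw [show n0 + (K + 1) = n0 + K + 1 by ring]
          push_cast
          linarith [a3.2]
      obtain ⟨K, hK⟩ := exists_nat_gt (2 * Cf / (η / 2))
      rw [div_lt_iff₀ (by positivity)] at hK
      obtain ⟨δ, hδ, r, hr, h1⟩ := tele K
      refine ⟨δ, hδ, r, hr, fun v hv hm hvr => ?_⟩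
      by_contra hlt
      push Not at hlt
      have hp := N_pos hv
      have hm' : c0 / 2 < ‖(sm B⁻¹ (sm s ((((N v)⁻¹ : ℝ) : ℂ) • v))).1‖ := hm
      rw [sm_smul, sm_smul, Prod.smul_fst, norm_smul, Complex.norm_real, Real.norm_of_nonneg (inv_nonneg.2 hp.le), lt_inv_mul_iff₀ hp] at hm'
      have a1 := h1 v hv (by
        have h3 : c0 / 2 / nF s * N (sm s v) ≤ c0 / 2 / nF s * (nF s * N v) := by gcongr; exact N_sm_le s v
        have h4 : c0 / 2 / nF s * (nF s * N v) = N v * (c0 / 2) := by field_simp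
        linarith) hvr hlt
      have b1 := hFb (sm (g ^ (n0 + K)) (sm s v)) (sm_ne (sm_ne hv))
      have b2 := hFb (sm (g ^ n0) (sm s v)) (sm_ne (sm_ne hv))
      rw [abs_le] at b1 b2
      linarith [b1.2, b2.1]
  obtain ⟨δ, hδ, r, hr, h1⟩ := key
  have : M - δ ∈ S := by
    rw [memS]
    refine ⟨r, hr, fun v hv hvr => h1 v hv ?_ hvr⟩
    have hp := N_pos hv
    have : N ((((N v)⁻¹ : ℝ) : ℂ) • v) = 1 := by
      rw [N_smul, Complex.norm_real, Real.norm_of_nonneg (inv_nonneg.2 hp.le), inv_mul_cancel₀ hp.ne']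
    exact ⟨this.ge, this.le⟩
  have := csInf_le hbd this
  rw [← hM] at this
  linarith
end

open MeasureTheory Filter
noncomputable section

variable {P : Measure SL2} [IsProbabilityMeasure P]
variable {ε ρ C : ℝ} {f : ℂ × ℂ → ℝ}

lemma Adm.neg (h : Adm ε C f) : Adm ε C (fun v => - f v) :=
  ⟨h.cont.neg, fun c hc v => by rw [h.phase c hc], fun v hv => by rw [abs_neg]; exact h.up v hv,
    fun v hv => by rw [abs_neg]; exact h.dn v hv⟩

lemma Gr_neg (f : ℂ × ℂ → ℝ) (v) : Gr P (fun v => - f v) v = - Gr P f v := by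
  unfold Gr; exact integral_neg _

/-- real scaling -/
def es (s : ℝ) (v : ℂ × ℂ) : ℂ × ℂ := ((Real.exp s : ℝ) : ℂ) • v

lemma es_ne {s : ℝ} {v : ℂ × ℂ} (hv : v ≠ 0) : es s v ≠ 0 :=
  smul_ne_zero (Complex.ofReal_ne_zero.2 (Real.exp_pos s).ne') hv
lemma N_es (s : ℝ) (v : ℂ × ℂ) : N (es s v) = Real.exp s * N v := by
  unfold es; rw [N_smul, Complex.norm_real, Real.norm_of_nonneg (Real.exp_pos s).le]
lemma es_add (s t : ℝ) (v : ℂ × ℂ) : es (s + t) v = es s (es t v) := by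
  unfold es; rw [smul_smul, Real.exp_add]; push_cast; rfl
lemma es_zero (v : ℂ × ℂ) : es 0 v = v := by unfold es; simp
lemma sm_es (g : SL2) (s : ℝ) (v : ℂ × ℂ) : sm g (es s v) = es s (sm g v) := sm_smul _ _ _
lemma cont_es : Continuous (fun p : ℝ × (ℂ × ℂ) => es p.1 p.2) := by
  unfold es; fun_prop
@[fun_prop] lemma meas_es {α : Type*} [MeasurableSpace α] {a : α → ℝ} {b : α → ℂ × ℂ} (ha : Measurable a) (hb : Measurable b) :
    Measurable (fun x => es (a x) (b x)) := cont_es.measurable.comp (ha.prodMk hb)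

/-- asymptotic periods -/
def perS (F : ℂ × ℂ → ℝ) : AddSubgroup ℝ where
  carrier := {a | ∀ η > 0, ∃ r > 0, ∀ v, v ≠ 0 → N v < r → |F (es a v) - F v| ≤ η}
  zero_mem' := fun η hη => ⟨1, one_pos, fun v _ _ => by rw [es_zero]; simpa using hη.le⟩
  add_mem' := by
    intro a b ha hb η hη
    obtain ⟨r, hr, h1⟩ := ha (η / 2) (by positivity)
    obtain ⟨r', hr', h2⟩ := hb (η / 2) (by positivity)
    refine ⟨min r' (r / Real.exp b), lt_min hr' (by positivity), fun v hv hvr => ?_⟩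
    have e1 := h2 v hv (lt_of_lt_of_le hvr (min_le_left _ _))
    have e2 := lt_of_lt_of_le hvr (min_le_right _ _)
    rw [lt_div_iff₀ (Real.exp_pos b)] at e2
    have e3 := h1 (es b v) (es_ne hv) (by rw [N_es]; linarith)
    rw [es_add]
    have := abs_sub_le (F (es a (es b v))) (F (es b v)) (F v)
    linarith
  neg_mem' := by
    intro a ha η hη
    obtain ⟨r, hr, h1⟩ := ha η hη
    refine ⟨r / Real.exp (-a), by positivity, fun v hv hvr => ?_⟩
    rw [lt_div_iff₀ (Real.exp_pos _)] at hvr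
    have := h1 (es (-a) v) (es_ne hv) (by rw [N_es]; linarith)
    rw [← es_add, add_neg_cancel, es_zero, abs_sub_comm] at this
    exact this

lemma mem_perS {F : ℂ × ℂ → ℝ} {a : ℝ} : a ∈ perS F ↔ ∀ η > 0, ∃ r > 0, ∀ v, v ≠ 0 → N v < r → |F (es a v) - F v| ≤ η := Iff.rfl

lemma Adm.hyp_mem (hS : ¬ Group.IsSolvable (Subgroup.closure (measSupp P))) (h : Adm ε C f) (hc : Ctr P ε ρ)
    {g : SL2} (hg : g ∈ Submonoid.closure (measSupp P)) {l : ℝ} {B : SL2} (hh : IsHyp g l B) : Real.log |l| ∈ perS (Gr P f) := by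
  rw [mem_perS]
  intro η hη
  obtain ⟨r, hr, h1⟩ := h.one_sided hS hc hg hh hη
  obtain ⟨r', hr', h2⟩ := h.neg.one_sided hS hc hg hh hη
  refine ⟨min r r', lt_min hr hr', fun v hv hvr => ?_⟩
  have e1 := h1 v hv (lt_of_lt_of_le hvr (min_le_left _ _))
  have e2 := h2 v hv (lt_of_lt_of_le hvr (min_le_right _ _))
  rw [Gr_neg, Gr_neg] at e2
  unfold es
  have := hh.1
  rw [Real.exp_log (by linarith), abs_le]
  constructor <;> linarith

lemma Adm.per (hS : ¬ Group.IsSolvable (Subgroup.closure (measSupp P))) (h : Adm ε C f) (hc : Ctr P ε ρ) (a : ℝ) :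
    ∀ η > 0, ∃ r > 0, ∀ v, v ≠ 0 → N v < r → |Gr P f (es a v) - Gr P f v| ≤ η := by
  intro η hη
  rcases AddSubgroup.dense_or_cyclic (perS (Gr P f)) with hd | ⟨c, hcy⟩
  · obtain ⟨θ, hθ, -, hreg⟩ := h.Gr_reg hc (η / 2) (by positivity)
    have hco : ContinuousAt (fun t => |Real.exp a - Real.exp t|) a := by fun_prop
    have hev : ∀ᶠ t in nhds a, |Real.exp a - Real.exp t| < θ * Real.exp a := by
      refine hco.eventually_lt_const ?_
      simpa using by positivity
    obtain ⟨t, ht1, ht2⟩ := hd.inter_nhds_nonempty hev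
    have ht1' : t ∈ perS (Gr P f) := ht1
    have ht2' : |Real.exp a - Real.exp t| < θ * Real.exp a := ht2
    obtain ⟨r, hr, h1⟩ := mem_perS.1 ht1' (η / 2) (by positivity)
    refine ⟨r, hr, fun v hv hvr => ?_⟩
    have e1 := h1 v hv hvr
    have e2 := hreg (es a v) (es t v) (es_ne hv) (by
      have : es a v - es t v = ((Real.exp a - Real.exp t : ℝ) : ℂ) • v := by
        unfold es; rw [← sub_smul]; push_cast; rfl
      rw [this, N_smul, N_es, Complex.norm_real, Real.norm_eq_abs, ← mul_assoc]
      have := N_nonneg v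
      gcongr)
    have := abs_sub_le (Gr P f (es a v)) (Gr P f (es t v)) (Gr P f v)
    linarith
  · exfalso
    refine nonarith hS c fun g hg l B hh => ?_
    have := h.hyp_mem hS hc hg hh
    rw [hcy, AddSubgroup.mem_closure_singleton] at this
    obtain ⟨k, hk⟩ := this
    exact ⟨k, by rw [← hk]; simp⟩
end

open MeasureTheory Filter
noncomputable section

/-! ### The phase function -/

variable {P : Measure SL2} [IsProbabilityMeasure P] {m : Measure (ℂ × ℂ)} [IsProbabilityMeasure m]

def om (v : ℂ × ℂ) : ℝ := (v.1 * (starRingEnd ℂ) v.2).im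
def bb (v : ℂ × ℂ) (p : (ℂ × ℂ) × (ℂ × ℂ)) : ℝ := (wd v p.1 * (starRingEnd ℂ) (wd v p.2)).re
def aa (p : (ℂ × ℂ) × (ℂ × ℂ)) : ℝ := (wd p.1 p.2).re
def at1 : ℝ → ℝ := dslope Real.arctan 0
def AA (v : ℂ × ℂ) (p : (ℂ × ℂ) × (ℂ × ℂ)) : ℝ := aa p / bb v p * at1 (om v * aa p / bb v p)

lemma cont_at1 : Continuous at1 := by
  rw [← continuousOn_univ]
  exact (continuousOn_dslope univ_mem).2 ⟨Real.continuous_arctan.continuousOn, Real.differentiable_arctan.differentiableAt⟩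

lemma mul_at1 (z : ℝ) : z * at1 z = Real.arctan z := by
  have := sub_smul_dslope Real.arctan 0 z
  unfold at1
  simpa using this

lemma at1_zero : at1 0 = 1 := by
  unfold at1; rw [dslope_same]; simp

lemma at1_lower (z : ℝ) : 1 ≤ |at1 z| * Real.sqrt (1 + z ^ 2) := by
  by_cases hz : z = 0
  · rw [hz, at1_zero]; simp
  · have h1 := Real.abs_sin_le_abs (x := Real.arctan z)
    rw [Real.sin_arctan, abs_div, ← mul_at1, abs_mul, abs_of_nonneg (Real.sqrt_nonneg _), div_le_iff₀ (by positivity), mul_assoc] at h1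
    have hz' : 0 < |z| := abs_pos.2 hz
    exact le_of_mul_le_mul_left (by linarith) hz'

lemma om_sm (g : SL2) (v : ℂ × ℂ) : om (sm g v) = om v := by
  have h := det_eq g
  unfold om sm
  simp only [Complex.mul_im, Complex.add_re, Complex.add_im, Complex.mul_re, map_add, map_mul, Complex.conj_ofReal, Complex.conj_re, Complex.conj_im, Complex.ofReal_re, Complex.ofReal_im]
  linear_combination (v.1.im * v.2.re - v.1.re * v.2.im) * h

lemma om_es (s : ℝ) (v : ℂ × ℂ) : om (es s v) = Real.exp (2 * s) * om v := by
  unfold om es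
  rw [two_mul, Real.exp_add]
  simp only [Prod.smul_fst, Prod.smul_snd, smul_eq_mul, Complex.mul_im, Complex.mul_re, map_mul, Complex.conj_ofReal, Complex.conj_re, Complex.conj_im, Complex.ofReal_re, Complex.ofReal_im]
  ring

lemma norm_one_mul_conj {c : ℂ} (hc : ‖c‖ = 1) : c * (starRingEnd ℂ) c = 1 := by
  rw [Complex.mul_conj, Complex.normSq_eq_norm_sq, hc]; simp

lemma om_phase {c : ℂ} (hc : ‖c‖ = 1) (v : ℂ × ℂ) : om (c • v) = om v := by
  unfold om
  have : (c • v).1 * (starRingEnd ℂ) (c • v).2 = (c * (starRingEnd ℂ) c) * (v.1 * (starRingEnd ℂ) v.2) := by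
    simp; ring
  rw [this, norm_one_mul_conj hc, one_mul]

lemma bb_phase {c : ℂ} (hc : ‖c‖ = 1) (v p) : bb (c • v) p = bb v p := by
  unfold bb
  have : wd (c • v) p.1 * (starRingEnd ℂ) (wd (c • v) p.2) = (c * (starRingEnd ℂ) c) * (wd v p.1 * (starRingEnd ℂ) (wd v p.2)) := by
    simp [wd]; ring
  rw [this, norm_one_mul_conj hc, one_mul]

lemma bb_es (s : ℝ) (v p) : bb (es s v) p = Real.exp (2 * s) * bb v p := by
  unfold bb es
  rw [wd_smul_left, wd_smul_left, two_mul, Real.exp_add, map_mul, Complex.conj_ofReal, ← Complex.re_ofReal_mul]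
  congr 1; push_cast; ring

lemma AA_phase {c : ℂ} (hc : ‖c‖ = 1) (v p) : AA (c • v) p = AA v p := by
  unfold AA; rw [bb_phase hc, om_phase hc]

lemma AA_es (s : ℝ) (v p) : AA (es s v) p = Real.exp (-(2 * s)) * AA v p := by
  unfold AA
  rw [bb_es, om_es]
  have h := Real.exp_pos (2 * s)
  have : Real.exp (2 * s) * om v * aa p / (Real.exp (2 * s) * bb v p) = om v * aa p / bb v p := by
    rw [mul_assoc, mul_div_mul_left _ _ h.ne']
  rw [this, Real.exp_neg, ← mul_assoc, mul_comm (Real.exp (2 * s)), div_mul_eq_div_div]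
  ring

lemma om_AA (v p) : om v * AA v p = Real.arctan (om v * aa p / bb v p) := by
  rw [← mul_at1]; unfold AA; ring

lemma uw {v : ℂ × ℂ} {p : (ℂ × ℂ) × (ℂ × ℂ)} (h1 : IsR p.1) (h2 : IsR p.2) :
    wd v p.1 * (starRingEnd ℂ) (wd v p.2) = (bb v p : ℂ) + ((om v * aa p : ℝ) : ℂ) * Complex.I := by
  obtain ⟨⟨x1, x2⟩, ⟨y1, y2⟩⟩ := p
  obtain ⟨a1, a2⟩ := h1
  obtain ⟨b1, b2⟩ := h2
  simp only at a1 a2 b1 b2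
  apply Complex.ext
  · simp [bb]
  · simp [om, aa, wd, a1, a2, b1, b2]; ring

lemma AA_lower {v : ℂ × ℂ} {p : (ℂ × ℂ) × (ℂ × ℂ)} (h1 : IsR p.1) (h2 : IsR p.2) (n1 : N p.1 = 1) (n2 : N p.2 = 1)
    (hb : bb v p ≠ 0) : |aa p| ≤ |AA v p| * N v ^ 2 := by
  obtain ⟨z, hz⟩ : ∃ z, z = om v * aa p / bb v p := ⟨_, rfl⟩
  have hb' : 0 < |bb v p| := abs_pos.2 hb
  have e1 : |bb v p| * Real.sqrt (1 + z ^ 2) ≤ N v ^ 2 := by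
    have hn : ‖wd v p.1 * (starRingEnd ℂ) (wd v p.2)‖ ≤ N v ^ 2 := by
      rw [norm_mul, RCLike.norm_conj]
      have := wd_norm_le v p.1
      have := wd_norm_le v p.2
      rw [n1, mul_one] at *
      rw [n2, mul_one] at *
      rw [sq]
      exact mul_le_mul (by assumption) (by assumption) (norm_nonneg _) (N_nonneg v)
    have hsq : ‖wd v p.1 * (starRingEnd ℂ) (wd v p.2)‖ ^ 2 = bb v p ^ 2 + (om v * aa p) ^ 2 := by
      rw [uw h1 h2, ← Complex.normSq_eq_norm_sq, Complex.normSq_add_mul_I]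
    refine le_trans (abs_le_of_sq_le_sq' (le_of_eq ?_) (norm_nonneg _)).2 hn
    rw [hsq, mul_pow, sq_abs, Real.sq_sqrt (by positivity), hz, div_pow]
    field_simp
  have h3 := at1_lower z
  unfold AA
  rw [← hz, abs_mul, abs_div]
  calc |aa p| ≤ |aa p| * (|at1 z| * Real.sqrt (1 + z ^ 2)) := le_mul_of_one_le_right (abs_nonneg _) h3
    _ = |aa p| / |bb v p| * |at1 z| * (|bb v p| * Real.sqrt (1 + z ^ 2)) := by field_simp
    _ ≤ _ := by gcongr

def zv (v x : ℂ × ℂ) : ℂ := wd v x / (starRingEnd ℂ) (wd v x)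

lemma zv_zv {v : ℂ × ℂ} {p : (ℂ × ℂ) × (ℂ × ℂ)} (h1 : IsR p.1) (h2 : IsR p.2) (hb : bb v p ≠ 0) :
    zv v p.1 * (starRingEnd ℂ) (zv v p.2) = Complex.exp ((2 * (om v * AA v p) : ℝ) * Complex.I) := by
  obtain ⟨z, hz⟩ : ∃ z, z = om v * aa p / bb v p := ⟨_, rfl⟩
  have hbc : (bb v p : ℂ) ≠ 0 := Complex.ofReal_ne_zero.2 hb
  have e0 : wd v p.1 * (starRingEnd ℂ) (wd v p.2) = bb v p * (1 + z * Complex.I) := by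
    rw [uw h1 h2, hz]; push_cast; field_simp
  have e1 : (starRingEnd ℂ) (wd v p.1) * wd v p.2 = bb v p * (1 - z * Complex.I) := by
    have := congrArg (starRingEnd ℂ) e0
    simp only [map_mul, Complex.conj_conj, Complex.conj_ofReal, map_add, map_one, Complex.conj_I] at this
    rw [this]; ring
  have e2 : zv v p.1 * (starRingEnd ℂ) (zv v p.2) = (1 + z * Complex.I) / (1 - z * Complex.I) := by
    unfold zv
    rw [map_div₀, Complex.conj_conj, div_mul_div_comm, e0, e1, mul_div_mul_left _ _ hbc]
  have e3 : (1 + (z : ℂ) * Complex.I) * (1 - z * Complex.I) = ((1 + z ^ 2 : ℝ) : ℂ) := by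
    push_cast; ring_nf; rw [Complex.I_sq]; ring
  have hz2 : ((1 + z ^ 2 : ℝ) : ℂ) ≠ 0 := Complex.ofReal_ne_zero.2 (by positivity)
  have e4 : (1 - (z : ℂ) * Complex.I) ≠ 0 := by
    intro h; rw [h, mul_zero] at e3; exact hz2 e3.symm
  have hs0 : 0 < 1 + z ^ 2 := by positivity
  have e5 : Complex.exp ((Real.arctan z : ℝ) * Complex.I) = (1 + z * Complex.I) / (Real.sqrt (1 + z ^ 2) : ℝ) := by
    rw [Complex.exp_mul_I, ← Complex.ofReal_cos, ← Complex.ofReal_sin, Real.cos_arctan, Real.sin_arctan]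
    push_cast; ring
  have e6 : Complex.exp ((2 * Real.arctan z : ℝ) * Complex.I) = (1 + z * Complex.I) ^ 2 / ((1 + z ^ 2 : ℝ) : ℂ) := by
    have : ((2 * Real.arctan z : ℝ) : ℂ) * Complex.I = (Real.arctan z : ℝ) * Complex.I + (Real.arctan z : ℝ) * Complex.I := by push_cast; ring
    rw [this, Complex.exp_add, e5, div_mul_div_comm, ← Complex.ofReal_mul, Real.mul_self_sqrt hs0.le, ← sq]
  rw [e2, om_AA, ← hz, e6, ← e3]
  rw [div_eq_div_iff e4 (by rw [e3]; exact hz2)]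
  ring

lemma ae_pair (hs : Sys P m) : ∀ᵐ p ∂(m.prod m), (IsR p.1 ∧ N p.1 = 1) ∧ (IsR p.2 ∧ N p.2 = 1) := by
  filter_upwards [Measure.quasiMeasurePreserving_fst.ae hs.unit, Measure.quasiMeasurePreserving_snd.ae hs.unit] with p h1 h2
  exact ⟨h1, h2⟩

@[fun_prop] lemma meas_om : Measurable om := by unfold om; fun_prop
@[fun_prop] lemma meas_bb {α : Type*} [MeasurableSpace α] {a : α → ℂ × ℂ} {b : α → (ℂ × ℂ) × (ℂ × ℂ)} (ha : Measurable a) (hb : Measurable b) :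
    Measurable (fun x => bb (a x) (b x)) := by unfold bb; fun_prop
@[fun_prop] lemma meas_aa : Measurable aa := by unfold aa; fun_prop
@[fun_prop] lemma meas_at1 : Measurable at1 := cont_at1.measurable
@[fun_prop] lemma meas_AA {α : Type*} [MeasurableSpace α] {a : α → ℂ × ℂ} {b : α → (ℂ × ℂ) × (ℂ × ℂ)} (ha : Measurable a) (hb : Measurable b) :
    Measurable (fun x => AA (a x) (b x)) := by unfold AA; fun_prop
@[fun_prop] lemma meas_zv {α : Type*} [MeasurableSpace α] {a b : α → ℂ × ℂ} (ha : Measurable a) (hb : Measurable b) :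
    Measurable (fun x => zv (a x) (b x)) := by unfold zv; fun_prop

lemma ae_aa (hs : Sys P m) : ∀ᵐ p ∂(m.prod m), aa p ≠ 0 := by
  have hm : MeasurableSet {p : (ℂ × ℂ) × (ℂ × ℂ) | aa p = 0} := measurableSet_eq_fun (by fun_prop) (by fun_prop)
  have h0 : (m.prod m) {p : (ℂ × ℂ) × (ℂ × ℂ) | aa p = 0} = 0 := by
    rw [Measure.measure_prod_null hm]
    filter_upwards [hs.unit] with x hx
    refine measure_mono_null_ae ?_ (hs.null x hx.1 (ne_of_N (by rw [hx.2]; exact one_pos)))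
    filter_upwards [hs.unit] with y hy h
    have h' : (wd x y).re = 0 := h
    change wd y x = 0
    rw [wd_comm]
    have : (wd x y).im = 0 := by simp [wd, hx.1.1, hx.1.2, hy.1.1, hy.1.2]
    have h0 : wd x y = 0 := Complex.ext h' this
    rw [h0, neg_zero]
  exact measure_eq_zero_iff_ae_notMem.1 h0

lemma ae_bb (hs : Sys P m) {v : ℂ × ℂ} (hv : v ≠ 0) : ∀ᵐ p ∂(m.prod m), bb v p ≠ 0 := by
  have hm : MeasurableSet {p : (ℂ × ℂ) × (ℂ × ℂ) | bb v p = 0} := measurableSet_eq_fun (by fun_prop) (by fun_prop)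
  have h0 : (m.prod m) {p : (ℂ × ℂ) × (ℂ × ℂ) | bb v p = 0} = 0 := by
    rw [Measure.measure_prod_null hm]
    have hnull : ∀ᵐ x ∂m, ¬ wd x v = 0 := measure_eq_zero_iff_ae_notMem.1 (null_c hs hv)
    filter_upwards [hs.unit, hnull] with x hx hxv
    obtain ⟨c, hc⟩ : ∃ c, c = (starRingEnd ℂ) (wd v x) := ⟨_, rfl⟩
    obtain ⟨w, hw⟩ : ∃ w : ℂ × ℂ, w = (((c * v.1).re : ℂ), ((c * v.2).re : ℂ)) := ⟨_, rfl⟩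
    have hwR : IsR w := by rw [hw]; exact ⟨Complex.ofReal_im _, Complex.ofReal_im _⟩
    have hwd (y : ℂ × ℂ) (hy : IsR y) : wd w y = ((c * wd v y).re : ℂ) := by
      obtain ⟨y1, y2⟩ := y
      obtain ⟨a1, a2⟩ := hy
      simp only at a1 a2
      rw [hw]
      apply Complex.ext
      · simp [wd, a1, a2]; ring
      · simp [wd, a1, a2]
    have hne : w ≠ 0 := by
      rintro rfl
      have h2 := hwd x hx.1
      rw [hc, mul_comm, Complex.mul_conj] at h2
      have h3 : wd (0 : ℂ × ℂ) x = 0 := by simp [wd]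
      rw [h3, Complex.ofReal_re] at h2
      have h4 : wd v x = 0 := Complex.normSq_eq_zero.1 (Complex.ofReal_eq_zero.1 h2.symm)
      rw [wd_comm, h4] at hxv
      exact hxv neg_zero
    refine measure_mono_null_ae ?_ (hs.null w hwR hne)
    filter_upwards [hs.unit] with y hy h
    have h' : (wd v x * (starRingEnd ℂ) (wd v y)).re = 0 := h
    change wd y w = 0
    rw [wd_comm, hwd y hy.1, hc]
    rw [← Complex.conj_re] at h'
    simp only [map_mul, Complex.conj_conj] at h'
    rw [h']; simp
  exact measure_eq_zero_iff_ae_notMem.1 h0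
end

open MeasureTheory Filter
noncomputable section

variable {P : Measure SL2} [IsProbabilityMeasure P] {m : Measure (ℂ × ℂ)} [IsProbabilityMeasure m]

def QQ (m : Measure (ℂ × ℂ)) (T : ℝ) (v : ℂ × ℂ) : ℝ := ∫ p, Real.cos (2 * T * AA v p) ∂(m.prod m)

lemma QQ_abs (T : ℝ) (v) : |QQ m T v| ≤ 1 := by
  unfold QQ
  rw [← Real.norm_eq_abs]
  have := norm_integral_le_of_norm_le_const (μ := m.prod m) (f := fun p => Real.cos (2 * T * AA v p)) (C := 1)
    (Eventually.of_forall fun p => Real.abs_cos_le_one _)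
  simpa using this

@[fun_prop] lemma QQ_meas (T : ℝ) : Measurable (QQ m T) := by
  have : StronglyMeasurable (fun p : (ℂ × ℂ) × ((ℂ × ℂ) × (ℂ × ℂ)) => Real.cos (2 * T * AA p.1 p.2)) := Measurable.stronglyMeasurable (by fun_prop)
  exact this.integral_prod_right.measurable

lemma QQ_phase (T : ℝ) {c : ℂ} (hc : ‖c‖ = 1) (v) : QQ m T (c • v) = QQ m T v := by
  unfold QQ; simp only [AA_phase hc]

lemma cont_om : Continuous om := by unfold om; fun_prop
lemma cont_bb (p) : Continuous (fun v => bb v p) := by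
  unfold bb wd; fun_prop

lemma QQ_cont (hs : Sys P m) (T : ℝ) {v : ℂ × ℂ} (hv : v ≠ 0) : ContinuousAt (QQ m T) v := by
  unfold QQ
  refine continuousAt_of_dominated (bound := fun _ => 1) ?_ ?_ (integrable_const _) ?_
  · exact Eventually.of_forall fun w => Measurable.aestronglyMeasurable (by fun_prop)
  · exact Eventually.of_forall fun w => Eventually.of_forall fun p => Real.abs_cos_le_one _
  · filter_upwards [ae_bb hs hv] with p hp
    have h1 := (cont_bb p).continuousAt (x := v)
    have h2 := cont_om.continuousAt (x := v)
    have h3 : ContinuousAt (fun w => at1 (om w * aa p / bb w p)) v :=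
      cont_at1.continuousAt.comp ((h2.mul continuousAt_const).div h1 hp)
    have h4 : ContinuousAt (fun w => AA w p) v := (continuousAt_const.div h1 hp).mul h3
    exact Real.continuous_cos.continuousAt.comp (continuousAt_const.mul h4)

lemma zv_norm (v x) : ‖zv v x‖ ≤ 1 := by
  unfold zv
  rw [norm_div, RCLike.norm_conj]
  exact div_self_le_one _

lemma zv_pow_norm (v x) (k : ℕ) : ‖zv v x ^ k‖ ≤ 1 := by
  rw [norm_pow]; exact pow_le_one₀ (norm_nonneg _) (zv_norm v x)

lemma QQ_orbit (hs : Sys P m) {T : ℝ} {k : ℕ} {v : ℂ × ℂ} (hv : v ≠ 0) (hk : k * om v = - T) :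
    QQ m T v = ‖∫ x, zv v x ^ k ∂m‖ ^ 2 := by
  have h1 : (∫ x, zv v x ^ k ∂m) * (starRingEnd ℂ) (∫ x, zv v x ^ k ∂m) =
      ∫ p, (zv v p.1 ^ k) * (starRingEnd ℂ) (zv v p.2 ^ k) ∂(m.prod m) := by
    rw [← integral_conj, integral_prod_mul (fun x => zv v x ^ k) (fun x => (starRingEnd ℂ) (zv v x ^ k))]
  have h2 : ∫ p, (zv v p.1 ^ k) * (starRingEnd ℂ) (zv v p.2 ^ k) ∂(m.prod m) =
      ∫ p, Complex.exp (((-(2 * T * AA v p) : ℝ) : ℂ) * Complex.I) ∂(m.prod m) := by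
    refine integral_congr_ae ?_
    filter_upwards [ae_bb hs hv, ae_pair hs] with p hp1 hp2
    rw [map_pow, ← mul_pow, zv_zv hp2.1.1 hp2.2.1 hp1, ← Complex.exp_nat_mul]
    congr 1
    have : -(2 * T * AA v p) = k * (2 * (om v * AA v p)) := by
      rw [show T = -(k * om v) by linarith]; ring
    rw [this]; push_cast; ring
  have hIn : Integrable (fun p => Complex.exp (((-(2 * T * AA v p) : ℝ) : ℂ) * Complex.I)) (m.prod m) := by
    refine Integrable.mono' (integrable_const 1) (Measurable.aestronglyMeasurable (by fun_prop)) (Eventually.of_forall fun p => ?_)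
    rw [Complex.norm_exp_ofReal_mul_I]
  rw [← Complex.normSq_eq_norm_sq, ← Complex.ofReal_re (Complex.normSq _), ← Complex.mul_conj, h1, h2]
  have h3 := integral_re (𝕜 := ℂ) hIn
  rw [show (∫ p, Complex.exp (((-(2 * T * AA v p) : ℝ) : ℂ) * Complex.I) ∂(m.prod m)).re = RCLike.re (∫ p, Complex.exp (((-(2 * T * AA v p) : ℝ) : ℂ) * Complex.I) ∂(m.prod m)) from rfl, ← h3]
  unfold QQ
  refine integral_congr_ae (Eventually.of_forall fun p => ?_)
  change Real.cos (2 * T * AA v p) = (Complex.exp (((-(2 * T * AA v p) : ℝ) : ℂ) * Complex.I)).re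
  rw [Complex.exp_ofReal_mul_I_re, Real.cos_neg]

lemma sq_int_le {h : SL2 → ℝ} (hm : Measurable h) (hb : ∀ g, |h g| ≤ 1) : (∫ g, h g ∂P) ^ 2 ≤ ∫ g, h g ^ 2 ∂P := by
  have i1 : Integrable h P := Integrable.mono' (integrable_const 1) hm.aestronglyMeasurable (Eventually.of_forall hb)
  have i2 : Integrable (fun g => h g ^ 2) P := Integrable.mono' (integrable_const 1) (Measurable.aestronglyMeasurable (by fun_prop))
    (Eventually.of_forall fun g => by rw [Real.norm_eq_abs, abs_pow]; exact pow_le_one₀ (abs_nonneg _) (hb g))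
  obtain ⟨c, hc⟩ : ∃ c, c = ∫ g, h g ∂P := ⟨_, rfl⟩
  have h0 : 0 ≤ ∫ g, (h g ^ 2 - 2 * c * h g + c ^ 2) ∂P := integral_nonneg fun g => by
    change 0 ≤ h g ^ 2 - 2 * c * h g + c ^ 2
    nlinarith [sq_nonneg (h g - c)]
  have j1 : Integrable (fun g => h g ^ 2 - 2 * c * h g) P := i2.sub (i1.const_mul _)
  rw [integral_add j1 (integrable_const _), integral_sub i2 (i1.const_mul _), integral_const_mul, ← hc] at h0
  simp at h0
  rw [← hc]; linarith

lemma zv_smul_right (v : ℂ × ℂ) {c : ℝ} (hc : c ≠ 0) (x) : zv v ((c : ℂ) • x) = zv v x := by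
  unfold zv
  rw [wd_smul_right, map_mul, Complex.conj_ofReal, mul_div_mul_left _ _ (Complex.ofReal_ne_zero.2 hc)]

lemma zv_es (s : ℝ) (v x) : zv (es s v) x = zv v x := by
  unfold zv es
  rw [wd_smul_left, map_mul, Complex.conj_ofReal, mul_div_mul_left _ _ (Complex.ofReal_ne_zero.2 (Real.exp_pos s).ne')]

lemma zv_sm (g : SL2) (v x) : zv v (sm g⁻¹ x) = zv (sm g v) x := by
  unfold zv
  rw [← wd_sm g v, sm_sm_inv]

lemma zv_stat (hs : Sys P m) (k : ℕ) (v : ℂ × ℂ) : ∫ x, zv v x ^ k ∂m = ∫ g, ∫ x, zv (sm g v) x ^ k ∂m ∂P := by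
  have h := map_stat hs 1 (F := fun x => zv v x ^ k) (by fun_prop) (fun c hc x => by
    change zv v ((c : ℂ) • x) ^ k = zv v x ^ k
    rw [zv_smul_right v hc])
  rw [cp_one] at h
  have hm : Measurable fun p : SL2 × (ℂ × ℂ) => zv v (sm p.1⁻¹ p.2) ^ k := by fun_prop
  have h1 := integral_map (μ := P.prod m) hm.aemeasurable (f := fun t : ℂ => t) (by fun_prop)
  have h2 := integral_map (μ := m) (show Measurable fun x => zv v x ^ k by fun_prop).aemeasurable (f := fun t : ℂ => t) (by fun_prop)
  rw [h, h2] at h1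
  rw [h1, integral_prod]
  · simp only [zv_sm]
  · exact Integrable.mono' (integrable_const 1) hm.aestronglyMeasurable (Eventually.of_forall fun p => zv_pow_norm _ _ _)

lemma QQ_sub (hs : Sys P m) {T : ℝ} {k : ℕ} {v : ℂ × ℂ} (hv : v ≠ 0) (hk : k * om v = - T) :
    QQ m T v ≤ ∫ g, QQ m T (sm g v) ∂P := by
  have e (g : SL2) : QQ m T (sm g v) = ‖∫ x, zv (sm g v) x ^ k ∂m‖ ^ 2 := QQ_orbit hs (sm_ne hv) (by rw [om_sm]; exact hk)
  simp only [e]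
  have hm : Measurable fun g : SL2 => ‖∫ x, zv (sm g v) x ^ k ∂m‖ := by
    have : StronglyMeasurable (fun p : SL2 × (ℂ × ℂ) => zv (sm p.1 v) p.2 ^ k) := Measurable.stronglyMeasurable (by fun_prop)
    exact this.integral_prod_right.measurable.norm
  have hb (g : SL2) : ‖∫ x, zv (sm g v) x ^ k ∂m‖ ≤ 1 := by
    have := norm_integral_le_of_norm_le_const (μ := m) (f := fun x => zv (sm g v) x ^ k) (C := 1)
      (Eventually.of_forall fun x => zv_pow_norm _ _ _)
    simpa using this
  rw [QQ_orbit hs hv hk, zv_stat hs]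
  refine le_trans ?_ (sq_int_le hm fun g => by rw [abs_of_nonneg (norm_nonneg _)]; exact hb g)
  gcongr
  exact norm_integral_le_integral_norm _

def z0 : ℂ × ℂ := (1, Complex.I)
lemma z0_ne : z0 ≠ 0 := by unfold z0; simp
lemma om_z0 : om z0 = -1 := by unfold om z0; simp

lemma zv_z0 {x : ℂ × ℂ} (hx : IsR x) (hn : N x = 1) : zv z0 x = - Zc x := by
  have h2 : x.1 ^ 2 + x.2 ^ 2 = (x.1 + x.2 * Complex.I) * (x.1 - x.2 * Complex.I) := by
    ring_nf; rw [Complex.I_sq]; ring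
  have e1 : (starRingEnd ℂ) x.1 = x.1 := Complex.conj_eq_iff_im.2 hx.1
  have e2 : (starRingEnd ℂ) x.2 = x.2 := Complex.conj_eq_iff_im.2 hx.2
  have e3 : wd z0 x = - Complex.I * (x.1 + x.2 * Complex.I) := by
    simp only [wd, z0]; ring_nf; rw [Complex.I_sq]; ring
  have e4 : (starRingEnd ℂ) (wd z0 x) = Complex.I * (x.1 - x.2 * Complex.I) := by
    rw [e3]; simp [e1, e2]; ring
  have h0 : x.1 ^ 2 + x.2 ^ 2 ≠ 0 := by
    have h := N_sq x
    rw [hn] at h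
    unfold N2 at h
    have a1 : ‖x.1‖ ^ 2 = x.1.re ^ 2 := by
      rw [← Complex.normSq_eq_norm_sq, Complex.normSq_apply, hx.1]; ring
    have a2 : ‖x.2‖ ^ 2 = x.2.re ^ 2 := by
      rw [← Complex.normSq_eq_norm_sq, Complex.normSq_apply, hx.2]; ring
    have b1 : x.1 = (x.1.re : ℂ) := Complex.ext rfl (by simp [hx.1])
    have b2 : x.2 = (x.2.re : ℂ) := Complex.ext rfl (by simp [hx.2])
    rw [b1, b2]
    rw [a1, a2] at h
    have : (x.1.re : ℂ) ^ 2 + (x.2.re : ℂ) ^ 2 = ((x.1.re ^ 2 + x.2.re ^ 2 : ℝ) : ℂ) := by push_cast; ring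
    rw [this, ← h]; simp
  have hA : x.1 + x.2 * Complex.I ≠ 0 := by intro h; rw [h2, h, zero_mul] at h0; exact h0 rfl
  have hB : x.1 - x.2 * Complex.I ≠ 0 := by intro h; rw [h2, h, mul_zero] at h0; exact h0 rfl
  unfold zv Zc
  rw [e4, e3, h2]
  field_simp

lemma QQ_es_z0 (hs : Sys P m) {T : ℝ} (hT : 0 < T) {k : ℕ} (hk : 0 < k) :
    QQ m T (es (Real.log (T / k) / 2) z0) = ‖∫ x, Zc x ^ k ∂m‖ ^ 2 := by
  have hk' : (0 : ℝ) < k := by exact_mod_cast hk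
  rw [QQ_orbit hs (k := k) (es_ne z0_ne)]
  · congr 1
    have : ∫ x, zv (es (Real.log (T / k) / 2) z0) x ^ k ∂m = ∫ x, (-1) ^ k * Zc x ^ k ∂m := by
      refine integral_congr_ae ?_
      filter_upwards [hs.unit] with x hx
      rw [zv_es, zv_z0 hx.1 hx.2, neg_pow]
    rw [this, integral_const_mul, norm_mul, norm_pow, norm_neg, norm_one, one_pow, one_mul]
  · rw [om_es, om_z0, mul_div_cancel₀ _ two_ne_zero, Real.exp_log (by positivity)]
    field_simp
end

open MeasureTheory Filter
noncomputable section

/-! ### The source function -/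

variable {P : Measure SL2} [IsProbabilityMeasure P] {m : Measure (ℂ × ℂ)} [IsProbabilityMeasure m]
variable {ε ρ : ℝ}

def ch (v : ℂ × ℂ) : ℝ := 1 / (1 + N v ^ 2)

lemma cont_ch : Continuous ch := by
  unfold ch
  have := cont_N
  exact continuous_const.div (by fun_prop) (fun v => by positivity)
@[fun_prop] lemma meas_ch : Measurable ch := cont_ch.measurable
lemma ch_pos (v) : 0 < ch v := by unfold ch; positivity
lemma ch_le (v) : ch v ≤ 1 := by unfold ch; rw [div_le_one (by positivity)]; nlinarith [sq_nonneg (N v)]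

lemma ch_dn (he : 0 < ε) (he1 : ε ≤ 1) {v : ℂ × ℂ} (hv : v ≠ 0) : ch v ≤ N v ^ (-(2 * ε)) := by
  have hp := N_pos hv
  rcases le_total (N v) 1 with h | h
  · exact (ch_le v).trans (Real.one_le_rpow_of_pos_of_le_one_of_nonpos hp h (by linarith))
  · have h1 : N v ^ (-(2 : ℝ)) ≤ N v ^ (-(2 * ε)) := Real.rpow_le_rpow_of_exponent_le h (by linarith)
    refine le_trans ?_ h1
    rw [Real.rpow_neg hp.le, ← one_div, Real.rpow_two]
    unfold ch
    gcongr
    linarith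

lemma ch_up (he : 0 < ε) (he1 : ε ≤ 1) (v : ℂ × ℂ) : 1 - ch v ≤ N v ^ (2 * ε) := by
  have hp := N_nonneg v
  have e : 1 - ch v = N v ^ 2 / (1 + N v ^ 2) := by unfold ch; field_simp; ring
  rcases le_total (N v) 1 with h | h
  · have h1 : N v ^ (2 : ℝ) ≤ N v ^ (2 * ε) := Real.rpow_le_rpow_of_exponent_ge' hp h (by linarith) (by linarith)
    rw [Real.rpow_two] at h1
    rw [e]
    refine le_trans ?_ h1
    exact div_le_self (sq_nonneg _) (by nlinarith [sq_nonneg (N v)])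
  · have := Real.one_le_rpow h (show 0 ≤ 2 * ε by linarith)
    linarith [ch_pos v]

lemma ch_diff_one (v w) : |ch v - ch w| ≤ 1 := by
  rw [abs_le]; constructor <;> linarith [ch_pos v, ch_pos w, ch_le v, ch_le w]

lemma ch_diff_dn (he : 0 < ε) (he1 : ε ≤ 1) (g : SL2) {v : ℂ × ℂ} (hv : v ≠ 0) :
    |ch v - ch (sm g v)| ≤ nF g ^ (2 * ε) * N v ^ (-(2 * ε)) := by
  have h1 := ch_dn he he1 hv
  have h2 := ch_dn he he1 (sm_ne (g := g) hv)
  have h3 := ph_sm_le (ε := 2 * ε) (by linarith) g hv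
  unfold ph at h3
  have h4 : 1 ≤ nF g ^ (2 * ε) := Real.one_le_rpow (one_le_nF g) (by linarith)
  have h5 : N v ^ (-(2 * ε)) ≤ nF g ^ (2 * ε) * N v ^ (-(2 * ε)) := le_mul_of_one_le_left (Real.rpow_nonneg (N_nonneg v) _) h4
  rw [abs_le]; constructor <;> linarith [ch_pos v, ch_pos (sm g v)]

lemma ch_diff_up (he : 0 < ε) (he1 : ε ≤ 1) (g : SL2) (v : ℂ × ℂ) :
    |ch v - ch (sm g v)| ≤ nF g ^ (2 * ε) * N v ^ (2 * ε) := by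
  have h1 := ch_up he he1 v
  have h2 := ch_up he he1 (sm g v)
  have h3 : N (sm g v) ^ (2 * ε) ≤ (nF g * N v) ^ (2 * ε) := Real.rpow_le_rpow (N_nonneg _) (N_sm_le g v) (by linarith)
  rw [Real.mul_rpow (nF_nonneg g) (N_nonneg v)] at h3
  have h4 : 1 ≤ nF g ^ (2 * ε) := Real.one_le_rpow (one_le_nF g) (by linarith)
  have h5 : N v ^ (2 * ε) ≤ nF g ^ (2 * ε) * N v ^ (2 * ε) := le_mul_of_one_le_left (Real.rpow_nonneg (N_nonneg v) _) h4
  rw [abs_le]; constructor <;> linarith [ch_le v, ch_le (sm g v)]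

def fT (P : Measure SL2) (m : Measure (ℂ × ℂ)) (T : ℝ) (v : ℂ × ℂ) : ℝ :=
  ∫ g, (ch v - ch (sm g v)) * QQ m T (sm g v) ∂P

lemma ch_phase {c : ℂ} (hc : ‖c‖ = 1) (v) : ch (c • v) = ch v := by
  unfold ch; rw [N_smul, hc, one_mul]

lemma mul_QQ_le (T : ℝ) (a : ℝ) (v) : |a * QQ m T v| ≤ |a| := by
  rw [abs_mul]; exact mul_le_of_le_one_right (abs_nonneg _) (QQ_abs T v)

lemma fT_adm (hs : Sys P m) (hc : Ctr P ε ρ) (T : ℝ) : Adm ε (∫ g, nF g ^ (2 * ε) ∂P) (fT P m T) := by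
  have hi := int_rpow hc (s := 2 * ε) (by linarith [hc.pos])
  refine ⟨?_, ?_, ?_, ?_⟩
  · intro v hv
    refine ContinuousAt.continuousWithinAt ?_
    unfold fT
    refine continuousAt_of_dominated (bound := fun _ => 1) ?_ ?_ (integrable_const _) ?_
    · exact Eventually.of_forall fun w => Measurable.aestronglyMeasurable (by fun_prop)
    · exact Eventually.of_forall fun w => Eventually.of_forall fun g => (mul_QQ_le _ _ _).trans (ch_diff_one _ _)
    · refine Eventually.of_forall fun g => ?_
      have h1 : ContinuousAt (fun w => sm g w) v := (cont_sm_right g).continuousAt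
      have h2 : ContinuousAt (fun w => QQ m T (sm g w)) v :=
        ContinuousAt.comp (f := fun w => sm g w) (g := QQ m T) (QQ_cont hs T (sm_ne hv)) h1
      have h3 : ContinuousAt (fun w => ch (sm g w)) v := cont_ch.continuousAt.comp h1
      exact (cont_ch.continuousAt.sub h3).mul h2
  · intro c hc v
    unfold fT
    simp only [sm_smul, ch_phase hc, QQ_phase T hc]
  · intro v _
    rw [← integral_mul_const, ← Real.norm_eq_abs]
    refine norm_integral_le_of_norm_le (f := fun g => (ch v - ch (sm g v)) * QQ m T (sm g v)) (hi.mul_const _) (Eventually.of_forall fun g => ?_)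
    exact (mul_QQ_le _ _ _).trans (ch_diff_up hc.pos hc.le1 g v)
  · intro v hv
    rw [← integral_mul_const, ← Real.norm_eq_abs]
    refine norm_integral_le_of_norm_le (f := fun g => (ch v - ch (sm g v)) * QQ m T (sm g v)) (hi.mul_const _) (Eventually.of_forall fun g => ?_)
    exact (mul_QQ_le _ _ _).trans (ch_diff_dn hc.pos hc.le1 g hv)

lemma int_chQ (R : Measure SL2) [IsProbabilityMeasure R] (T : ℝ) (v) : Integrable (fun g => ch (sm g v) * QQ m T (sm g v)) R := by
  refine Integrable.mono' (integrable_const 1) (Measurable.aestronglyMeasurable (by fun_prop)) (Eventually.of_forall fun g => ?_)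
  rw [Real.norm_eq_abs]
  refine (mul_QQ_le _ _ _).trans ?_
  rw [abs_of_pos (ch_pos _)]; exact ch_le _

lemma h_step (hs : Sys P m) {T : ℝ} {k : ℕ} {v : ℂ × ℂ} (hv : v ≠ 0) (hk : k * om v = -T) :
    ch v * QQ m T v ≤ fT P m T v + ∫ g, ch (sm g v) * QQ m T (sm g v) ∂P := by
  have h1 := QQ_sub hs hv hk
  have i1 : Integrable (fun g => (ch v - ch (sm g v)) * QQ m T (sm g v)) P := by
    refine Integrable.mono' (integrable_const 1) (Measurable.aestronglyMeasurable (by fun_prop)) (Eventually.of_forall fun g => ?_)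
    exact (mul_QQ_le _ _ _).trans (ch_diff_one _ _)
  unfold fT
  rw [← integral_add i1 (int_chQ P T v)]
  calc ch v * QQ m T v ≤ ch v * ∫ g, QQ m T (sm g v) ∂P := mul_le_mul_of_nonneg_left h1 (ch_pos v).le
    _ = ∫ g, ch v * QQ m T (sm g v) ∂P := (integral_const_mul _ _).symm
    _ ≤ _ := le_of_eq (integral_congr_ae (Eventually.of_forall fun g => by simp only; ring))

lemma h_iter (hs : Sys P m) (hc : Ctr P ε ρ) {T : ℝ} {k : ℕ} {v : ℂ × ℂ} (hv : v ≠ 0) (hk : k * om v = -T) (n : ℕ) :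
    ch v * QQ m T v ≤ ∑ i ∈ Finset.range n, ∫ g, fT P m T (sm g v) ∂(cp P i) + ∫ g, ch (sm g v) * QQ m T (sm g v) ∂(cp P n) := by
  have hA := fT_adm hs hc T
  have hm := hA.meas
  induction n with
  | zero => simp [cp, integral_dirac, sm_one]
  | succ n ih =>
    refine ih.trans ?_
    rw [Finset.sum_range_succ, add_assoc]
    refine add_le_add le_rfl ?_
    have hi := int_chQ (m := m) (cp P (n + 1)) T v
    change Integrable _ (Measure.mconv P (cp P n)) at hi
    have e : ∫ g, ch (sm g v) * QQ m T (sm g v) ∂(cp P (n + 1)) =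
        ∫ g, ∫ y, ch (sm y (sm g v)) * QQ m T (sm y (sm g v)) ∂P ∂(cp P n) := by
      change ∫ g, ch (sm g v) * QQ m T (sm g v) ∂(Measure.mconv P (cp P n)) = _
      rw [integral_mconv hi, integral_integral_swap]
      · simp only [sm_mul]
      · exact (integrable_map_measure hi.1 (by fun_prop)).1 hi
    have i1 : Integrable (fun g => fT P m T (sm g v)) (cp P n) := by
      refine Integrable.mono' (integrable_const (∫ g, nF g ^ (2 * ε) ∂P)) (Measurable.aestronglyMeasurable (by fun_prop)) (Eventually.of_forall fun g => ?_)
      exact hA.le_C (sm_ne hv)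
    have i2 : Integrable (fun g => ∫ y, ch (sm y (sm g v)) * QQ m T (sm y (sm g v)) ∂P) (cp P n) := by
      have : StronglyMeasurable (fun p : SL2 × SL2 => ch (sm p.2 (sm p.1 v)) * QQ m T (sm p.2 (sm p.1 v))) := Measurable.stronglyMeasurable (by fun_prop)
      refine Integrable.mono' (integrable_const 1) this.integral_prod_right.aestronglyMeasurable (Eventually.of_forall fun g => ?_)
      have := norm_integral_le_of_norm_le_const (μ := P) (f := fun y => ch (sm y (sm g v)) * QQ m T (sm y (sm g v))) (C := 1)
        (Eventually.of_forall fun y => by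
          rw [Real.norm_eq_abs]
          refine (mul_QQ_le _ _ _).trans ?_
          rw [abs_of_pos (ch_pos _)]; exact ch_le _)
      simpa using this
    rw [e, ← integral_add i1 i2]
    refine integral_mono (int_chQ _ T v) (i1.add i2) fun g => ?_
    exact h_step hs (sm_ne hv) (by rw [om_sm]; exact hk)

lemma ph_cp (hc : Ctr P ε ρ) {v : ℂ × ℂ} (hv : v ≠ 0) (n : ℕ) :
    ∫⁻ g, ENNReal.ofReal (ph ε (sm g v)) ∂(cp P n) ≤ ENNReal.ofReal (ρ ^ n * ph ε v) := by
  induction n with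
  | zero =>
    rw [lint_zero (by fun_prop), sm_one]; simp
  | succ n ih =>
    have hr := hc.rho0
    rw [lint_succ' (by fun_prop) n, lintegral_lintegral_swap (Measurable.aemeasurable (by fun_prop))]
    calc _ ≤ ∫⁻ x, ENNReal.ofReal ρ * ENNReal.ofReal (ph ε (sm x v)) ∂(cp P n) := by
          refine lintegral_mono fun x => ?_
          have h1 := int_ph hc (sm_ne (g := x) hv)
          have h2 : ∫ g, ph ε (sm g (sm x v)) ∂P ≤ ρ * ph ε (sm x v) := hc.ctr _ (sm_ne (g := x) hv)
          simp only [sm_mul]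
          rw [← ofReal_integral_eq_lintegral_ofReal h1 (Eventually.of_forall fun y => ph_nonneg _ _), ← ENNReal.ofReal_mul hr.le]
          exact ENNReal.ofReal_le_ofReal h2
      _ = ENNReal.ofReal ρ * ∫⁻ x, ENNReal.ofReal (ph ε (sm x v)) ∂(cp P n) := lintegral_const_mul _ (by fun_prop)
      _ ≤ ENNReal.ofReal ρ * ENNReal.ofReal (ρ ^ n * ph ε v) := by gcongr
      _ = _ := by
          rw [← ENNReal.ofReal_mul hr.le]; congr 1; ring

lemma ch_le_ph (hc : Ctr P ε ρ) {v : ℂ × ℂ} (hv : v ≠ 0) : ch v ≤ ph ε v := by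
  have := ch_dn (ε := ε / 2) (by linarith [hc.pos]) (by linarith [hc.le1]) hv
  unfold ph
  rwa [mul_div_cancel₀ _ two_ne_zero] at this

lemma chQ_cp_le (hc : Ctr P ε ρ) (T : ℝ) {v : ℂ × ℂ} (hv : v ≠ 0) (n : ℕ) :
    ∫ g, ch (sm g v) * QQ m T (sm g v) ∂(cp P n) ≤ ρ ^ n * ph ε v := by
  have hr := hc.rho0
  have hp := ph_nonneg ε v
  have h1 : ∫ g, ch (sm g v) * QQ m T (sm g v) ∂(cp P n) ≤ ∫ g, ch (sm g v) ∂(cp P n) := by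
    refine integral_mono (int_chQ _ T v) ?_ fun g => ?_
    · refine Integrable.mono' (integrable_const 1) (Measurable.aestronglyMeasurable (by fun_prop)) (Eventually.of_forall fun g => ?_)
      rw [Real.norm_eq_abs, abs_of_pos (ch_pos _)]; exact ch_le _
    · exact mul_le_of_le_one_right (ch_pos _).le ((le_abs_self _).trans (QQ_abs T _))
  refine h1.trans ?_
  rw [integral_eq_lintegral_of_nonneg_ae (Eventually.of_forall fun g => (ch_pos _).le) (Measurable.aestronglyMeasurable (by fun_prop))]
  refine ENNReal.toReal_le_of_le_ofReal (by positivity) (le_trans (lintegral_mono fun g => ?_) (ph_cp hc hv n))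
  exact ENNReal.ofReal_le_ofReal (ch_le_ph hc (sm_ne hv))

lemma h_le_Gr (hs : Sys P m) (hc : Ctr P ε ρ) {T : ℝ} {k : ℕ} {v : ℂ × ℂ} (hv : v ≠ 0) (hk : k * om v = -T) :
    ch v * QQ m T v ≤ Gr P (fT P m T) v := by
  have hi := (fT_adm hs hc T).int hc hv
  have hsum : HasSum (fun n => ∫ g, fT P m T (sm g v) ∂(cp P n)) (Gr P (fT P m T) v) :=
    hasSum_integral_measure hi
  have h1 := hsum.tendsto_sum_nat
  have h2 : Tendsto (fun n : ℕ => ρ ^ n * ph ε v) atTop (nhds (0 * ph ε v)) :=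
    (tendsto_pow_atTop_nhds_zero_of_lt_one hc.rho0.le hc.rho).mul_const _
  have h3 := h1.add h2
  rw [zero_mul, add_zero] at h3
  exact ge_of_tendsto' h3 fun n => (h_iter hs hc hv hk n).trans (add_le_add le_rfl (chQ_cp_le hc T hv n))
end

open MeasureTheory Filter
noncomputable section

/-! ### The oscillatory estimate -/

variable {P : Measure SL2} [IsProbabilityMeasure P] {m : Measure (ℂ × ℂ)} [IsProbabilityMeasure m]
variable {ε ρ : ℝ}

lemma osc {q B : ℝ} (hq : 0 < q) (hB : B ≠ 0) :
    |∫ s in (0:ℝ)..1, 1 / (1 + Real.exp s ^ 2 * q) * Real.cos (B * Real.exp (-(2 * s)))| ≤ 1 / (|B| * q) := by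
  have hB' : 0 < |B| := abs_pos.2 hB
  obtain ⟨ψ, hψ⟩ : ∃ ψ : ℝ → ℝ, ψ = fun s => (Real.exp (-(2 * s)) + q)⁻¹ := ⟨_, rfl⟩
  obtain ⟨ψ', hψ'⟩ : ∃ ψ' : ℝ → ℝ, ψ' = fun s => 2 * Real.exp (-(2 * s)) / (Real.exp (-(2 * s)) + q) ^ 2 := ⟨_, rfl⟩
  obtain ⟨u, hu⟩ : ∃ u : ℝ → ℝ, u = fun s => -(Real.sin (B * Real.exp (-(2 * s))) / (2 * B)) := ⟨_, rfl⟩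
  obtain ⟨u', hu'⟩ : ∃ u' : ℝ → ℝ, u' = fun s => Real.exp (-(2 * s)) * Real.cos (B * Real.exp (-(2 * s))) := ⟨_, rfl⟩
  have hpos (s : ℝ) : 0 < Real.exp (-(2 * s)) + q := by positivity
  have dE (s : ℝ) : HasDerivAt (fun s : ℝ => Real.exp (-(2 * s))) (Real.exp (-(2 * s)) * (-(2 * 1))) s :=
    ((hasDerivAt_id s).const_mul 2).neg.exp
  have dψ (s : ℝ) : HasDerivAt ψ (ψ' s) s := by
    rw [hψ, hψ']
    have := ((dE s).add_const q).inv (hpos s).ne'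
    refine this.congr_deriv ?_
    simp only
    ring
  have du (s : ℝ) : HasDerivAt u (u' s) s := by
    rw [hu, hu']
    have := ((((dE s).const_mul B).sin).div_const (2 * B)).neg
    refine this.congr_deriv ?_
    field_simp
  have cψ' : Continuous ψ' := by
    rw [hψ']
    exact Continuous.div (by fun_prop) (by fun_prop) (fun s => (pow_pos (hpos s) 2).ne')
  have cu' : Continuous u' := by rw [hu']; fun_prop
  have cu : Continuous u := by rw [hu]; fun_prop
  have ibp := intervalIntegral.integral_mul_deriv_eq_deriv_mul (a := 0) (b := 1) (u := ψ) (v := u) (u' := ψ') (v' := u')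
    (fun x _ => dψ x) (fun x _ => du x) (cψ'.intervalIntegrable _ _) (cu'.intervalIntegrable _ _)
  have ftc : ∫ s in (0:ℝ)..1, ψ' s = ψ 1 - ψ 0 :=
    intervalIntegral.integral_eq_sub_of_hasDerivAt (fun x _ => dψ x) (cψ'.intervalIntegrable _ _)
  have e : ∫ s in (0:ℝ)..1, 1 / (1 + Real.exp s ^ 2 * q) * Real.cos (B * Real.exp (-(2 * s))) = ∫ s in (0:ℝ)..1, ψ s * u' s := by
    congr 1; ext s
    rw [hψ, hu']
    have e1 : Real.exp s ^ 2 * Real.exp (-(2 * s)) = 1 := by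
      rw [← Real.exp_nat_mul, ← Real.exp_add]; simp
    have e2 : 1 / (1 + Real.exp s ^ 2 * q) = (Real.exp (-(2 * s)) + q)⁻¹ * Real.exp (-(2 * s)) := by
      have := hpos s
      have h2 : 0 < 1 + Real.exp s ^ 2 * q := by positivity
      rw [div_eq_iff h2.ne', mul_assoc, eq_inv_mul_iff_mul_eq₀ this.ne']
      linear_combination (-q) * e1
    simp only
    rw [e2]; ring
  have ub (s : ℝ) : |u s| ≤ 1 / (2 * |B|) := by
    rw [hu]; simp only
    rw [abs_neg, abs_div, abs_mul, abs_two]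
    gcongr
    exact Real.abs_sin_le_one _
  have ψ'0 (s : ℝ) : 0 ≤ ψ' s := by rw [hψ']; simp only; positivity
  have ψ0 (s : ℝ) : 0 ≤ ψ s := by rw [hψ]; simp only; exact inv_nonneg.2 (hpos s).le
  have ψ1 : ψ 1 ≤ 1 / q := by
    rw [hψ]; simp only; rw [inv_eq_one_div]; gcongr; linarith [Real.exp_pos (-(2 * 1))]
  have h3 : |∫ s in (0:ℝ)..1, ψ' s * u s| ≤ (ψ 1 - ψ 0) * (1 / (2 * |B|)) := by
    rw [← ftc, ← intervalIntegral.integral_mul_const, ← Real.norm_eq_abs]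
    refine intervalIntegral.norm_integral_le_of_norm_le zero_le_one (Eventually.of_forall fun s _ => ?_)
      ((cψ'.mul continuous_const).intervalIntegrable _ _)
    rw [Real.norm_eq_abs, abs_mul, abs_of_nonneg (ψ'0 s)]
    exact mul_le_mul_of_nonneg_left (ub s) (ψ'0 s)
  rw [e, ibp]
  have t1 : |ψ 1 * u 1| ≤ ψ 1 * (1 / (2 * |B|)) := by
    rw [abs_mul, abs_of_nonneg (ψ0 1)]; exact mul_le_mul_of_nonneg_left (ub 1) (ψ0 1)
  have t2 : |ψ 0 * u 0| ≤ ψ 0 * (1 / (2 * |B|)) := by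
    rw [abs_mul, abs_of_nonneg (ψ0 0)]; exact mul_le_mul_of_nonneg_left (ub 0) (ψ0 0)
  calc |ψ 1 * u 1 - ψ 0 * u 0 - ∫ s in (0:ℝ)..1, ψ' s * u s|
      ≤ |ψ 1 * u 1| + |ψ 0 * u 0| + |∫ s in (0:ℝ)..1, ψ' s * u s| := by
        refine (abs_sub _ _).trans ?_
        exact add_le_add (abs_sub _ _) le_rfl
    _ ≤ ψ 1 * (1 / (2 * |B|)) + ψ 0 * (1 / (2 * |B|)) + (ψ 1 - ψ 0) * (1 / (2 * |B|)) := by gcongr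
    _ = ψ 1 * (1 / |B|) := by field_simp; ring
    _ ≤ 1 / q * (1 / |B|) := by gcongr
    _ = _ := by field_simp

def I1 : Measure ℝ := volume.restrict (Set.Ioc 0 1)
instance : IsProbabilityMeasure I1 := ⟨by unfold I1; simp⟩

lemma osc_ch {v : ℂ × ℂ} (hv : v ≠ 0) {B : ℝ} (hB : B ≠ 0) :
    |∫ s, ch (es s v) * Real.cos (B * Real.exp (-(2 * s))) ∂I1| ≤ 1 / (|B| * N v ^ 2) := by
  have h := osc (q := N v ^ 2) (B := B) (pow_pos (N_pos hv) 2) hB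
  rw [intervalIntegral.integral_of_le zero_le_one] at h
  unfold I1 ch
  simp only [N_es, mul_pow]
  exact h

def FF (T : ℝ) (v : ℂ × ℂ) (s : ℝ) (g : SL2) (p : (ℂ × ℂ) × (ℂ × ℂ)) : ℝ :=
  (ch (es s v) - ch (es s (sm g v))) * Real.cos (2 * T * AA (sm g v) p * Real.exp (-(2 * s)))

lemma FF_le (T : ℝ) (v s g p) : |FF T v s g p| ≤ 1 := by
  unfold FF
  rw [abs_mul]
  exact mul_le_one₀ (ch_diff_one _ _) (abs_nonneg _) (Real.abs_cos_le_one _)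

lemma FF_meas (T v) : Measurable (fun q : ℝ × (SL2 × ((ℂ × ℂ) × (ℂ × ℂ))) => FF T v q.1 q.2.1 q.2.2) := by
  unfold FF; fun_prop

def KK (T : ℝ) (g : SL2) (p : (ℂ × ℂ) × (ℂ × ℂ)) : ℝ := min 1 ((nF g ^ 2 + 1) / (2 * T * |aa p|))

lemma FF_osc {T : ℝ} (hT : 0 < T) {v : ℂ × ℂ} (hv : v ≠ 0) (g : SL2) {p : (ℂ × ℂ) × (ℂ × ℂ)}
    (h1 : IsR p.1) (h2 : IsR p.2) (n1 : N p.1 = 1) (n2 : N p.2 = 1) (hb : bb (sm g v) p ≠ 0) (ha : aa p ≠ 0) :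
    |∫ s, FF T v s g p ∂I1| ≤ KK T g p := by
  have hg := sm_ne (g := g) hv
  have ha' : 0 < |aa p| := abs_pos.2 ha
  have hN := N_pos hv
  have hNg := N_pos hg
  refine le_min ?_ ?_
  · have := norm_integral_le_of_norm_le_const (μ := I1) (f := fun s => FF T v s g p) (C := 1)
      (Eventually.of_forall fun s => FF_le _ _ _ _ _)
    simpa using this
  · obtain ⟨B, hB⟩ : ∃ B, B = 2 * T * AA (sm g v) p := ⟨_, rfl⟩
    have lo := AA_lower h1 h2 n1 n2 hb
    have lo2 : 2 * T * |aa p| ≤ |B| * N (sm g v) ^ 2 := by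
      rw [hB, abs_mul, abs_of_pos (by positivity : 0 < 2 * T), mul_assoc (2 * T)]
      gcongr
    have hB0 : B ≠ 0 := by
      intro h0; rw [h0, abs_zero, zero_mul] at lo2
      have : 0 < 2 * T * |aa p| := by positivity
      linarith
    have hBp := abs_pos.2 hB0
    have o1 := osc_ch hv hB0
    have o2 := osc_ch hg hB0
    have ii (w : ℂ × ℂ) : Integrable (fun s => ch (es s w) * Real.cos (B * Real.exp (-(2 * s)))) I1 := by
      refine Integrable.mono' (integrable_const 1) (Measurable.aestronglyMeasurable (by fun_prop)) (Eventually.of_forall fun s => ?_)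
      rw [Real.norm_eq_abs, abs_mul, abs_of_pos (ch_pos _)]
      exact mul_le_one₀ (ch_le _) (abs_nonneg _) (Real.abs_cos_le_one _)
    have e : ∫ s, FF T v s g p ∂I1 = ∫ s, ch (es s v) * Real.cos (B * Real.exp (-(2 * s))) ∂I1 -
        ∫ s, ch (es s (sm g v)) * Real.cos (B * Real.exp (-(2 * s))) ∂I1 := by
      rw [← integral_sub (ii v) (ii (sm g v)), hB]
      congr 1; ext s; unfold FF; ring
    rw [e]
    have k1 : 1 / (|B| * N v ^ 2) ≤ nF g ^ 2 / (2 * T * |aa p|) := by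
      rw [div_le_div_iff₀ (by positivity) (by positivity), one_mul]
      have h3 : N (sm g v) ^ 2 ≤ nF g ^ 2 * N v ^ 2 := by
        rw [← mul_pow]; exact pow_le_pow_left₀ hNg.le (N_sm_le g v) 2
      calc 2 * T * |aa p| ≤ |B| * N (sm g v) ^ 2 := lo2
        _ ≤ |B| * (nF g ^ 2 * N v ^ 2) := by gcongr
        _ = _ := by ring
    have k2 : 1 / (|B| * N (sm g v) ^ 2) ≤ 1 / (2 * T * |aa p|) := by
      gcongr
    rw [add_div]
    exact (abs_sub _ _).trans (add_le_add (o1.trans k1) (o2.trans k2))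

lemma KK_nonneg {T : ℝ} (hT : 0 < T) (g p) : 0 ≤ KK T g p := by unfold KK; positivity
lemma KK_le (T : ℝ) (g p) : KK T g p ≤ 1 := min_le_left _ _
@[fun_prop] lemma KK_meas (T : ℝ) : Measurable (fun q : SL2 × ((ℂ × ℂ) × (ℂ × ℂ)) => KK T q.1 q.2) := by unfold KK; fun_prop

def kap (P : Measure SL2) (m : Measure (ℂ × ℂ)) (T : ℝ) : ℝ := ∫ g, ∫ p, KK T g p ∂(m.prod m) ∂P

lemma KK_int_le {T : ℝ} (hT : 0 < T) (g) : |∫ p, KK T g p ∂(m.prod m)| ≤ 1 := by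
  have := norm_integral_le_of_norm_le_const (μ := m.prod m) (f := fun p => KK T g p) (C := 1)
      (Eventually.of_forall fun p => by rw [Real.norm_eq_abs, abs_of_nonneg (KK_nonneg hT g p)]; exact KK_le _ _ _)
  simpa using this

lemma KK_int_meas (T : ℝ) : StronglyMeasurable (fun g => ∫ p, KK T g p ∂(m.prod m)) :=
  (KK_meas T).stronglyMeasurable.integral_prod_right

lemma kap_nonneg {T : ℝ} (hT : 0 < T) : 0 ≤ kap P m T := integral_nonneg fun g => integral_nonneg fun p => KK_nonneg hT g p

lemma kap_tendsto (hs : Sys P m) : Tendsto (kap P m) atTop (nhds 0) := by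
  have h1 (g : SL2) : Tendsto (fun T => ∫ p, KK T g p ∂(m.prod m)) atTop (nhds 0) := by
    have := tendsto_integral_filter_of_dominated_convergence (μ := m.prod m) (l := atTop) (F := fun T p => KK T g p) (f := fun _ => 0)
      (bound := fun _ => 1) (Eventually.of_forall fun T => Measurable.aestronglyMeasurable (by unfold KK; fun_prop))
      (by
        filter_upwards [eventually_gt_atTop 0] with T hT
        exact Eventually.of_forall fun p => by rw [Real.norm_eq_abs, abs_of_nonneg (KK_nonneg hT g p)]; exact KK_le _ _ _)
      (integrable_const _)
      (by
        filter_upwards [ae_aa hs] with p hp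
        have hp' := abs_pos.2 hp
        have l1 : Tendsto (fun T : ℝ => (nF g ^ 2 + 1) / (2 * T * |aa p|)) atTop (nhds 0) := by
          refine Tendsto.div_atTop tendsto_const_nhds ?_
          exact (tendsto_id.const_mul_atTop (two_pos)).atTop_mul_const hp'
        have l2 := (tendsto_const_nhds (x := (1 : ℝ)) (f := atTop)).min l1
        simpa [KK] using l2)
    simpa using this
  have := tendsto_integral_filter_of_dominated_convergence (μ := P) (l := atTop) (F := fun T g => ∫ p, KK T g p ∂(m.prod m)) (f := fun _ => 0)
      (bound := fun _ => 1) (Eventually.of_forall fun T => (KK_int_meas T).aestronglyMeasurable)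
      (by
        filter_upwards [eventually_gt_atTop 0] with T hT
        exact Eventually.of_forall fun g => KK_int_le hT g)
      (integrable_const _) (Eventually.of_forall h1)
  rw [integral_zero] at this
  exact this

def f1 (P : Measure SL2) (m : Measure (ℂ × ℂ)) (T : ℝ) (v : ℂ × ℂ) : ℝ := ∫ s, fT P m T (es s v) ∂I1

lemma fT_es (T s : ℝ) (v) : fT P m T (es s v) = ∫ g, ∫ p, FF T v s g p ∂(m.prod m) ∂P := by
  unfold fT QQ FF
  simp only [sm_es, AA_es, integral_const_mul]
  congr 1; ext g; congr 2; ext p; congr 1; ring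

lemma f1_kap (hs : Sys P m) {T : ℝ} (hT : 0 < T) {v : ℂ × ℂ} (hv : v ≠ 0) : |f1 P m T v| ≤ kap P m T := by
  have hm := FF_meas T v
  have hI : Integrable (fun q : ℝ × (SL2 × ((ℂ × ℂ) × (ℂ × ℂ))) => FF T v q.1 q.2.1 q.2.2) (I1.prod (P.prod (m.prod m))) :=
    Integrable.mono' (integrable_const 1) hm.aestronglyMeasurable (Eventually.of_forall fun q => FF_le _ _ _ _ _)
  have e : f1 P m T v = ∫ g, ∫ p, ∫ s, FF T v s g p ∂I1 ∂(m.prod m) ∂P := by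
    unfold f1
    simp only [fT_es]
    have e1 (s : ℝ) : ∫ g, ∫ p, FF T v s g p ∂(m.prod m) ∂P = ∫ q, FF T v s q.1 q.2 ∂(P.prod (m.prod m)) := by
      rw [integral_prod]
      refine Integrable.mono' (integrable_const 1) (Measurable.aestronglyMeasurable ?_) (Eventually.of_forall fun q => FF_le _ _ _ _ _)
      unfold FF; fun_prop
    simp only [e1]
    rw [integral_integral_swap hI, integral_prod _ hI.integral_prod_right]
  rw [e, ← Real.norm_eq_abs]
  unfold kap
  refine norm_integral_le_of_norm_le (f := fun g => ∫ p, ∫ s, FF T v s g p ∂I1 ∂(m.prod m))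
    (Integrable.mono' (integrable_const 1) (KK_int_meas T).aestronglyMeasurable (Eventually.of_forall fun g => KK_int_le hT g)) (Eventually.of_forall fun g => ?_)
  refine norm_integral_le_of_norm_le (f := fun p => ∫ s, FF T v s g p ∂I1) (Integrable.mono' (integrable_const 1) (Measurable.aestronglyMeasurable (by unfold KK; fun_prop)) (Eventually.of_forall fun p => ?_)) ?_
  · rw [Real.norm_eq_abs, abs_of_nonneg (KK_nonneg hT g p)]; exact KK_le _ _ _
  · filter_upwards [ae_pair hs, ae_aa hs, ae_bb hs (sm_ne (g := g) hv)] with p h1 h2 h3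
    exact FF_osc hT hv g h1.1.1 h1.2.1 h1.1.2 h1.2.2 h3 h2
end

open MeasureTheory Filter
noncomputable section

/-! ### Conclusion -/

variable {P : Measure SL2} [IsProbabilityMeasure P] {m : Measure (ℂ × ℂ)} [IsProbabilityMeasure m]
variable {ε ρ : ℝ}

lemma ph_es (ε s : ℝ) (v : ℂ × ℂ) : ph ε (es s v) = Real.exp (-(s * ε)) * ph ε v := by
  unfold ph
  rw [N_es, Real.mul_rpow (Real.exp_pos s).le (N_nonneg v), ← Real.exp_mul]
  ring_nf

lemma Adm.es_dn {C : ℝ} {f : ℂ × ℂ → ℝ} (h : Adm ε C f) (he : 0 < ε) {s : ℝ} (hs : s ∈ Set.Ioc (0 : ℝ) 1) {v : ℂ × ℂ} (hv : v ≠ 0) :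
    |f (es s v)| ≤ C * Real.exp (2 * ε) * ph ε v ^ 2 := by
  refine (h.dn' (es_ne hv)).trans ?_
  have hC := h.C_nonneg
  rw [ph_es, mul_assoc]
  refine mul_le_mul_of_nonneg_left ?_ hC
  rw [mul_pow]
  refine mul_le_mul_of_nonneg_right ?_ (sq_nonneg _)
  rw [← Real.exp_nat_mul]
  refine Real.exp_le_exp.2 ?_
  have := mul_pos hs.1 he
  push_cast; linarith

lemma Adm.es_up {C : ℝ} {f : ℂ × ℂ → ℝ} (h : Adm ε C f) (he : 0 < ε) {s : ℝ} (hs : s ∈ Set.Ioc (0 : ℝ) 1) {v : ℂ × ℂ} (hv : v ≠ 0) :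
    |f (es s v)| ≤ C * Real.exp (2 * ε) * (ph ε v)⁻¹ ^ 2 := by
  refine (h.up' (es_ne hv)).trans ?_
  have hC := h.C_nonneg
  rw [ph_es, mul_assoc]
  refine mul_le_mul_of_nonneg_left ?_ hC
  rw [mul_inv, mul_pow]
  refine mul_le_mul_of_nonneg_right ?_ (sq_nonneg _)
  rw [← Real.exp_neg, ← Real.exp_nat_mul]
  refine Real.exp_le_exp.2 ?_
  have := mul_le_mul_of_nonneg_right hs.2 he.le
  push_cast; linarith

lemma ae_I1 : ∀ᵐ s ∂I1, s ∈ Set.Ioc (0 : ℝ) 1 := ae_restrict_mem measurableSet_Ioc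

/-- a bound by both `K φ²` and `K φ⁻²` yields a bound by `4 K m`. -/
lemma mm_of_two {K x : ℝ} (hK : 0 ≤ K) {v : ℂ × ℂ} (hv : v ≠ 0) (h1 : x ≤ K * ph ε v) (h2 : x ≤ K * (ph ε v)⁻¹) :
    x ≤ 4 * K * mm ε v := by
  rcases le_total (ph ε v) 1 with h | h
  · have := mul_le_mul_of_nonneg_left (mm_ge_small h) hK
    linarith
  · have := mul_le_mul_of_nonneg_left (mm_ge_large h) hK
    linarith

lemma Adm.es_mm {C : ℝ} {f : ℂ × ℂ → ℝ} (h : Adm ε C f) (he : 0 < ε) {s : ℝ} (hs : s ∈ Set.Ioc (0 : ℝ) 1) {v : ℂ × ℂ} (hv : v ≠ 0) :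
    |f (es s v)| ≤ 4 * (C * Real.exp (2 * ε)) * mm ε v := by
  have hC := h.C_nonneg
  have h1 := h.es_dn he hs hv
  have h2 := h.es_up he hs hv
  have hp := ph_pos ε hv
  have hp' := inv_pos.2 hp
  have hK : 0 ≤ C * Real.exp (2 * ε) := by positivity
  rcases le_total (ph ε v) 1 with h0 | h0
  · have h3 := mul_le_mul_of_nonneg_left (mm_ge_small h0) hK
    have h4 : ph ε v ^ 2 ≤ ph ε v := by nlinarith
    have := mul_le_mul_of_nonneg_left h4 hK
    linarith
  · have h3 := mul_le_mul_of_nonneg_left (mm_ge_large h0) hK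
    have h5 : (ph ε v)⁻¹ ≤ 1 := inv_le_one_of_one_le₀ h0
    have h4 : (ph ε v)⁻¹ ^ 2 ≤ (ph ε v)⁻¹ := by nlinarith
    have := mul_le_mul_of_nonneg_left h4 hK
    linarith

def CC (P : Measure SL2) (ε : ℝ) : ℝ := (∫ g, nF g ^ (2 * ε) ∂P) * Real.exp (2 * ε)

lemma sqrt_aux {x a b φ : ℝ} (hx : 0 ≤ x) (ha : x ≤ a) (hb : x ≤ b * φ ^ 2) (hb0 : 0 ≤ b) (hφ : 0 ≤ φ) : x ≤ Real.sqrt (a * b) * φ := by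
  have h : x ^ 2 ≤ (a * b) * φ ^ 2 := by
    calc x ^ 2 = x * x := sq x
      _ ≤ a * (b * φ ^ 2) := mul_le_mul ha hb hx (hx.trans ha)
      _ = _ := by ring
  calc x = Real.sqrt (x ^ 2) := (Real.sqrt_sq hx).symm
    _ ≤ Real.sqrt ((a * b) * φ ^ 2) := Real.sqrt_le_sqrt h
    _ = _ := by rw [Real.sqrt_mul (mul_nonneg (hx.trans ha) hb0), Real.sqrt_sq hφ]

lemma f1_mm (hs : Sys P m) (hc : Ctr P ε ρ) {T : ℝ} (hT : 0 < T) {v : ℂ × ℂ} (hv : v ≠ 0) :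
    |f1 P m T v| ≤ 4 * Real.sqrt (kap P m T * CC P ε) * mm ε v := by
  have hA := fT_adm hs hc T
  have hm := hA.meas
  have h0 := f1_kap hs hT hv
  have hC := hA.C_nonneg
  have hp := ph_pos ε hv
  have hCC : 0 ≤ CC P ε := by unfold CC; positivity
  have b1 : |f1 P m T v| ≤ CC P ε * ph ε v ^ 2 := by
    have := norm_integral_le_of_norm_le_const (μ := I1) (f := fun s => fT P m T (es s v)) (C := CC P ε * ph ε v ^ 2)
      (by filter_upwards [ae_I1] with s h; exact hA.es_dn hc.pos h hv)
    simpa [f1] using this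
  have b2 : |f1 P m T v| ≤ CC P ε * (ph ε v)⁻¹ ^ 2 := by
    have := norm_integral_le_of_norm_le_const (μ := I1) (f := fun s => fT P m T (es s v)) (C := CC P ε * (ph ε v)⁻¹ ^ 2)
      (by filter_upwards [ae_I1] with s h; exact hA.es_up hc.pos h hv)
    rw [probReal_univ, mul_one] at this
    exact this
  exact mm_of_two (Real.sqrt_nonneg _) hv (sqrt_aux (abs_nonneg _) h0 b1 hCC hp.le) (sqrt_aux (abs_nonneg _) h0 b2 hCC (inv_pos.2 hp).le)

def bd (P : Measure SL2) (m : Measure (ℂ × ℂ)) (ε ρ T : ℝ) : ℝ := 4 * Real.sqrt (kap P m T * CC P ε) * (1 / (1 - ρ))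

lemma avg_le (hs : Sys P m) (hc : Ctr P ε ρ) {T : ℝ} (hT : 0 < T) {v : ℂ × ℂ} (hv : v ≠ 0) :
    |∫ s, Gr P (fT P m T) (es s v) ∂I1| ≤ bd P m ε ρ T := by
  have hA := fT_adm hs hc T
  have hm := hA.meas
  have hI : Integrable (fun q : ℝ × SL2 => fT P m T (es q.1 (sm q.2 v))) (I1.prod (Ur P)) := by
    have hb : Integrable (fun q : ℝ × SL2 => (1 : ℝ) * (4 * CC P ε * mm ε (sm q.2 v))) (I1.prod (Ur P)) :=
      (integrable_const (1 : ℝ)).mul_prod ((mm_U hc hv).1.const_mul (4 * CC P ε))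
    refine Integrable.mono' hb (Measurable.aestronglyMeasurable (by fun_prop)) ?_
    have : ∀ᵐ q ∂(I1.prod (Ur P)), q.1 ∈ Set.Ioc (0 : ℝ) 1 := Measure.quasiMeasurePreserving_fst.ae ae_I1
    filter_upwards [this] with q hq
    rw [one_mul]
    exact hA.es_mm hc.pos hq (sm_ne hv)
  have e : ∫ s, Gr P (fT P m T) (es s v) ∂I1 = ∫ g, f1 P m T (sm g v) ∂(Ur P) := by
    unfold Gr f1
    simp only [sm_es]
    exact integral_integral_swap hI
  rw [e, ← Real.norm_eq_abs]
  refine (norm_integral_le_of_norm_le (f := fun g => f1 P m T (sm g v)) ((mm_U hc hv).1.const_mul (4 * Real.sqrt (kap P m T * CC P ε)))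
    (Eventually.of_forall fun g => f1_mm hs hc hT (sm_ne hv))).trans ?_
  rw [integral_const_mul]
  unfold bd
  exact mul_le_mul_of_nonneg_left (mm_U hc hv).2 (by positivity)

lemma bd_tendsto (hs : Sys P m) : Tendsto (bd P m ε ρ) atTop (nhds 0) := by
  have h1 := (kap_tendsto hs).mul_const (CC P ε)
  have h2 := (Real.continuous_sqrt.tendsto _).comp h1
  have h3 := (h2.const_mul 4).mul_const (1 / (1 - ρ))
  simp only [zero_mul, Real.sqrt_zero, mul_zero] at h3
  exact h3

lemma vk_tendsto {T : ℝ} (hT : 0 < T) : Tendsto (fun k : ℕ => N (es (Real.log (T / k) / 2) z0)) atTop (nhds 0) := by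
  have h1 : Tendsto (fun k : ℕ => T / (k : ℝ)) atTop (nhdsWithin 0 (Set.Ioi 0)) := by
    rw [tendsto_nhdsWithin_iff]
    refine ⟨tendsto_const_nhds.div_atTop tendsto_natCast_atTop_atTop, ?_⟩
    filter_upwards [eventually_gt_atTop 0] with k hk
    have : (0 : ℝ) < k := by exact_mod_cast hk
    exact div_pos hT this
  have h2 := Real.tendsto_log_nhdsGT_zero.comp h1
  have h3 := Real.tendsto_exp_atBot.comp (h2.atBot_div_const (two_pos))
  have h4 := h3.mul_const (N z0)
  rw [zero_mul] at h4
  simp only [N_es]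
  exact h4

lemma Gr_diff_tendsto (hs : Sys P m) (hc : Ctr P ε ρ) {T : ℝ} (hT : 0 < T) :
    Tendsto (fun k : ℕ => ∫ s, (Gr P (fT P m T) (es s (es (Real.log (T / k) / 2) z0)) - Gr P (fT P m T) (es (Real.log (T / k) / 2) z0)) ∂I1) atTop (nhds 0) := by
  have hA := fT_adm hs hc T
  have hG := hA.Gr_meas (P := P)
  obtain ⟨D, hD⟩ : ∃ D, D = 4 * (∫ g, nF g ^ (2 * ε) ∂P) / (1 - ρ) := ⟨_, rfl⟩
  have := tendsto_integral_filter_of_dominated_convergence (μ := I1) (l := atTop)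
    (F := fun (k : ℕ) s => Gr P (fT P m T) (es s (es (Real.log (T / k) / 2) z0)) - Gr P (fT P m T) (es (Real.log (T / k) / 2) z0)) (f := fun _ => 0)
    (bound := fun _ => D + D) (Eventually.of_forall fun T => Measurable.aestronglyMeasurable (by fun_prop))
    (Eventually.of_forall fun k => Eventually.of_forall fun s => by
      rw [hD]
      exact (abs_sub _ _).trans (add_le_add (hA.Gr_le hc (es_ne (es_ne z0_ne))) (hA.Gr_le hc (es_ne z0_ne))))
    (integrable_const _)
    (Eventually.of_forall fun s => by
      rw [Metric.tendsto_atTop]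
      intro η hη
      obtain ⟨r, hr, h⟩ := hA.per hs.nsolv hc s (η / 2) (by linarith)
      obtain ⟨K, hK⟩ := eventually_atTop.1 ((vk_tendsto hT).eventually (gt_mem_nhds hr))
      refine ⟨K, fun k hk => ?_⟩
      rw [Real.dist_eq, sub_zero]
      exact (h _ (es_ne z0_ne) (hK k hk)).trans_lt (by linarith))
  rw [integral_zero] at this
  exact this

lemma core_sq (hs : Sys P m) (hc : Ctr P ε ρ) : Tendsto (fun k : ℕ => ‖∫ x, Zc x ^ k ∂m‖ ^ 2) atTop (nhds 0) := by
  rw [Metric.tendsto_atTop]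
  intro η hη
  obtain ⟨T, hTb, hT⟩ := (((bd_tendsto (ε := ε) (ρ := ρ) hs).eventually (gt_mem_nhds (show (0:ℝ) < η / 8 by linarith))).and (eventually_gt_atTop 0)).exists
  have hA := fT_adm hs hc T
  have hG := hA.Gr_meas (P := P)
  have e1 := (Gr_diff_tendsto hs hc hT).eventually (lt_mem_nhds (show -(η / 8) < 0 by linarith))
  have e2 := (vk_tendsto hT).eventually (gt_mem_nhds (zero_lt_one))
  obtain ⟨K, hK⟩ := eventually_atTop.1 ((e1.and e2).and (eventually_gt_atTop 0))
  refine ⟨K, fun k hk => ?_⟩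
  obtain ⟨⟨h1, h2⟩, h3⟩ := hK k hk
  have hk' : (0 : ℝ) < k := by exact_mod_cast h3
  obtain ⟨w, hw⟩ : ∃ w, w = es (Real.log (T / k) / 2) z0 := ⟨_, rfl⟩
  have hw0 : w ≠ 0 := by rw [hw]; exact es_ne z0_ne
  have hom : k * om w = -T := by
    rw [hw, om_es, om_z0, mul_div_cancel₀ _ two_ne_zero, Real.exp_log (by positivity)]
    field_simp
  have h4 := h_le_Gr hs hc hw0 hom
  have h5 : QQ m T w = ‖∫ x, Zc x ^ k ∂m‖ ^ 2 := by rw [hw]; exact QQ_es_z0 hs hT h3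
  rw [← hw] at h1 h2
  have h6 := avg_le hs hc hT hw0
  have i1 : Integrable (fun s => Gr P (fT P m T) (es s w)) I1 := by
    refine Integrable.mono' (integrable_const (4 * (∫ g, nF g ^ (2 * ε) ∂P) / (1 - ρ))) (Measurable.aestronglyMeasurable (by fun_prop)) (Eventually.of_forall fun s => ?_)
    exact hA.Gr_le hc (es_ne hw0)
  rw [integral_sub i1 (integrable_const _), integral_const, probReal_univ, one_smul] at h1
  have h7 := (abs_le.1 h6).2
  rw [h5] at h4
  have h8 : 1 / 2 ≤ ch w := by
    unfold ch
    have := N_nonneg w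
    gcongr
    nlinarith
  have h9 : 0 ≤ ‖∫ x, Zc x ^ k ∂m‖ ^ 2 := by positivity
  rw [Real.dist_eq, sub_zero, abs_of_nonneg h9]
  have := mul_le_mul_of_nonneg_right h8 h9
  linarith

lemma core (hs : Sys P m) (hc : Ctr P ε ρ) : Tendsto (fun k : ℕ => ∫ x, Zc x ^ k ∂m) atTop (nhds 0) := by
  rw [tendsto_zero_iff_norm_tendsto_zero]
  have h := (Real.continuous_sqrt.tendsto _).comp (core_sq hs hc)
  rw [Real.sqrt_zero] at h
  refine h.congr fun k => ?_
  exact Real.sqrt_sq (norm_nonneg _)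
end

theorem fourier_coefficients_tendsto_zero
    (μ : Measure SL2) [IsProbabilityMeasure μ]
    (hmom : HasExpMoment μ) (hzd : ZariskiDense μ)
    (ν : Measure PX) [IsProbabilityMeasure ν] (hstat : IsMuStationary μ ν) :
    Filter.Tendsto
      (fun k : ℤ => ∫ x : PX,
        ((((x.rep 0 : ℂ) + (x.rep 1 : ℂ) * Complex.I) ^ 2) /
          ((x.rep 0 : ℂ) ^ 2 + (x.rep 1 : ℂ) ^ 2)) ^ k ∂ν)
      Filter.cofinite (nhds (0 : ℂ)) := by
  have : IsProbabilityMeasure (ν.map sec) := Measure.isProbabilityMeasure_map meas_sec.aemeasurable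
  have hs := sys_exists hmom hzd hstat
  obtain ⟨n, ε, ρ, hc⟩ := exists_ctr hs
  exact final_of_core (core (sys_cp hs n) hc)

end
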